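/- (Upper bound in the full range −1 < τ < 1.) Assume n ≥ 4. For every τ ∈ (−1,1), every C₀ > 0 and every ε > 0 there is a constant C (depending only on F, ξ, M, the a_j, b_j, and on τ, ε, C₀) such that for all B ≥ 1, all L ∈ ℕ, all reals R ≥ R₀ with (LR)² ≤ C₀·B^{1−τ}, and all Γ ∈ ℤ^{n+1} with F(Γ) ≡ 0 mod L and gcd(Γ₀,…,Γ_n, L) = 1: N_W((R,ξ),(L,Γ);B) ≤ C·( B^{n−1+ε}·(E_τ(1;B) + 1)/(Lⁿ·R^{n−1}) + B^{(n+1)(1−τ)/2+ε}/(L^{n+1}·Rⁿ) ), where E_τ(1;B) := B^{−(n−3)τ/2} if n ≥ 5 and E_τ(1;B) := B^{−τ} + B^{−(1+τ)/4} if n = 4. -/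

import Mathlib

open scoped BigOperators
open Finset Filter Topology Matrix

noncomputable section

namespace Quad

/-- The integral quadratic form `x ↦ xᵀ M_F x` where `N = 2·M_F` is an integer
symmetric matrix with even diagonal, so that the value `(xᵀ N x)/2` is an integer. -/
def Fint {m : ℕ} (N : Matrix (Fin m) (Fin m) ℤ) (x : Fin m → ℤ) : ℤ :=
  (∑ i, ∑ j, N i j * x i * x j) / 2

/-- The corresponding real quadratic form `x ↦ xᵀ M_F x`, `N = 2·M_F`. -/
def FR {m : ℕ} (N : Matrix (Fin m) (Fin m) ℤ) (x : Fin m → ℝ) : ℝ :=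
  (∑ i, ∑ j, (N i j : ℝ) * x i * x j) / 2

/-- The real quadratic form attached to a real matrix. -/
def QFR {m : ℕ} (A : Matrix (Fin m) (Fin m) ℝ) (x : Fin m → ℝ) : ℝ :=
  ∑ i, ∑ j, A i j * x i * x j

/-- The gradient `∇F(x) = 2 M_F x = N x`. -/
def grad {m : ℕ} (N : Matrix (Fin m) (Fin m) ℤ) (x : Fin m → ℤ) : Fin m → ℤ :=
  fun i => ∑ j, N i j * x j

/-- `H_{λ,L}(y) = F(λ)/L + ∇F(λ)·y` (assuming `L ∣ F(λ)`). -/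
def Hpoly {m : ℕ} (N : Matrix (Fin m) (Fin m) ℤ) (L : ℕ) (lam y : Fin m → ℤ) : ℤ :=
  Fint N lam / (L : ℤ) + ∑ i, grad N lam i * y i

/-- The additive character `e_q(t) = exp(2πit/q)`. -/
def eChar (q : ℕ) (t : ℝ) : ℂ := Complex.exp (2 * Real.pi * Complex.I * (t : ℂ) / (q : ℂ))

/-- The dual form value `N_F(c) = cᵀ · adj(N) · c`, `N = 2 M_F`; this equals `2ⁿ F*(c)`. -/
def dualF {m : ℕ} (N : Matrix (Fin m) (Fin m) ℤ) (c : Fin m → ℤ) : ℤ :=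
  ∑ i, ∑ j, N.adjugate i j * c i * c j

/-- The embedding sending the `i`-th of the `n-1` variables of `F₂` to coordinate `i+2`. -/
def emb {n : ℕ} (i : Fin (n-1)) : Fin (n+1) := ⟨i.val + 2, by have h := i.isLt; omega⟩

/-- The quadratic Gauss sum `ι_q = Σ_{x mod q} e_q(x²)`. -/
def iotaSum (q : ℕ) : ℂ := ∑ x ∈ Finset.range q, eChar q ((x : ℝ)^2)

open Classical in
/-- The exponential sum `S_{q,L,λ}(c)`. -/
def Sq (n : ℕ) (N : Matrix (Fin (n+1)) (Fin (n+1)) ℤ) (q L : ℕ)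
    (lam c : Fin (n+1) → ℤ) : ℂ :=
  ∑ a ∈ (Finset.range q).filter (fun a => Nat.gcd a q = 1),
    ∑ σ ∈ (Finset.univ : Finset (Fin (n+1) → Fin (q*L))).filter
        (fun σ => (L : ℤ) ∣ Hpoly N L lam (fun i => ((σ i : ℕ) : ℤ))),
      eChar (q*L)
        (((a : ℤ) * (Hpoly N L lam (fun i => ((σ i : ℕ) : ℤ))
            + (L : ℤ) * Fint N (fun i => ((σ i : ℕ) : ℤ)))
          + ∑ i, c i * ((σ i : ℕ) : ℤ) : ℤ) : ℝ)

/-- The good-modulus factor `S⁽¹⁾_{q,L,λ}(c)` (for `q = q₁q₂`, `gcd(q₁,2LD) = 1`). -/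
def S1 (n : ℕ) (N : Matrix (Fin (n+1)) (Fin (n+1)) ℤ) (q₁ q₂ L : ℕ) (k₁ : ℤ)
    (lam c : Fin (n+1) → ℤ) : ℂ :=
  ∑ σ : Fin (n+1) → Fin q₁,
    ∑ a ∈ (Finset.range q₁).filter (fun a => Nat.gcd a q₁ = 1),
      eChar q₁
        (((a : ℤ) * (((q₂ : ℤ) * (L : ℤ))^2 * Fint N (fun i => ((σ i : ℕ) : ℤ))
              + (q₂ : ℤ) * ((∑ i, grad N lam i * ((σ i : ℕ) : ℤ)) + k₁))
          + ∑ i, c i * ((σ i : ℕ) : ℤ) : ℤ) : ℝ)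

open Classical in
/-- The bad-modulus factor `S⁽²⁾_{q,L,λ}(c)`. -/
def S2 (n : ℕ) (N : Matrix (Fin (n+1)) (Fin (n+1)) ℤ) (q₁ q₂ L : ℕ) (k₂ : ℤ)
    (lam c : Fin (n+1) → ℤ) : ℂ :=
  ∑ σ ∈ (Finset.univ : Finset (Fin (n+1) → Fin (q₂*L))).filter
      (fun σ => (L : ℤ) ∣ Hpoly N L lam (fun i => (q₁ : ℤ) * ((σ i : ℕ) : ℤ))),
    ∑ a ∈ (Finset.range q₂).filter (fun a => Nat.gcd a q₂ = 1),
      eChar (q₂*L)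
        (((a : ℤ) * ((q₁ : ℤ)^2 * (L : ℤ) * Fint N (fun i => ((σ i : ℕ) : ℤ))
              + (q₁ : ℤ) * ((∑ i, grad N lam i * ((σ i : ℕ) : ℤ)) + k₂))
          + ∑ i, c i * ((σ i : ℕ) : ℤ) : ℤ) : ℝ)

/-- The complete quadratic exponential sum `T_q(G,m;c)`. -/
def Tq (n : ℕ) (NG : Matrix (Fin (n+1)) (Fin (n+1)) ℤ) (q : ℕ) (m : ℤ)
    (c : Fin (n+1) → ℤ) : ℂ :=
  ∑ a ∈ (Finset.range q).filter (fun a => Nat.gcd a q = 1),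
    ∑ b : Fin (n+1) → Fin q,
      eChar q (((a : ℤ) * (Fint NG (fun i => ((b i : ℕ) : ℤ)) - m)
        + ∑ i, c i * ((b i : ℕ) : ℤ) : ℤ) : ℝ)

/-- The counting function whose normalised limit is the local density
`σ_p(W;L,λ)`: the number of `v ∈ (ℤ/p^kℤ)^{n+1}` with `F(v) ≡ 0 mod p^k` and
`v ≡ λ mod p^{ord_p L}`. -/
def localCount (n : ℕ) (N : Matrix (Fin (n+1)) (Fin (n+1)) ℤ) (L : ℕ)
    (lam : Fin (n+1) → ℤ) (p k : ℕ) : ℕ :=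
  Nat.card {v : Fin (n+1) → Fin (p^k) //
    ((p : ℤ)^k ∣ Fint N (fun i => ((v i : ℕ) : ℤ))) ∧
    ∀ i, (p : ℤ)^(padicValNat p L) ∣ ((v i : ℕ) : ℤ) - lam i}

/-- The coordinates `t(x) = Mx` of an integer vector. -/
def tmap (n : ℕ) (M : Matrix (Fin (n+1)) (Fin (n+1)) ℝ) (x : Fin (n+1) → ℤ) :
    Fin (n+1) → ℝ :=
  M.mulVec (fun i => (x i : ℝ))

/-- The counting function `N_W((R,ξ),(L,Γ);B)` for the affine cone. -/
def NW (n : ℕ) (N : Matrix (Fin (n+1)) (Fin (n+1)) ℤ)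
    (M : Matrix (Fin (n+1)) (Fin (n+1)) ℝ) (a b : Fin (n+1) → ℝ)
    (B R : ℝ) (L : ℕ) (Γ : Fin (n+1) → ℤ) : ℕ :=
  Nat.card {x : Fin (n+1) → ℤ //
    x ≠ 0 ∧ Fint N x = 0 ∧ (∀ i, (L : ℤ) ∣ x i - Γ i) ∧
    tmap n M x 0 ≠ 0 ∧
    (∀ j : Fin (n+1), 2 ≤ j.val →
      a j ≤ R * (tmap n M x j / tmap n M x 0) ∧ R * (tmap n M x j / tmap n M x 0) ≤ b j) ∧
    (∀ i, |tmap n M x i| ≤ B)}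

/-- Twice the counting function `N_V((R,ξ),(L,Λ);B)` for the projective quadric:
the number of primitive integer vectors on the cone, in the real zoom region,
of height at most `B`, congruent mod `L` to a unit multiple of `Γ`. -/
def NV (n : ℕ) (N : Matrix (Fin (n+1)) (Fin (n+1)) ℤ)
    (M : Matrix (Fin (n+1)) (Fin (n+1)) ℝ) (a b : Fin (n+1) → ℝ)
    (B R : ℝ) (L : ℕ) (Γ : Fin (n+1) → ℤ) : ℕ :=
  Nat.card {x : Fin (n+1) → ℤ //
    Finset.univ.gcd x = 1 ∧ Fint N x = 0 ∧
    tmap n M x 0 ≠ 0 ∧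
    (∀ j : Fin (n+1), 2 ≤ j.val →
      a j ≤ R * (tmap n M x j / tmap n M x 0) ∧ R * (tmap n M x j / tmap n M x 0) ≤ b j) ∧
    (∀ i, |tmap n M x i| ≤ B) ∧
    (∃ γ : (ZMod L)ˣ, ∀ i, ((x i : ZMod L)) = (γ : ZMod L) * ((Γ i : ZMod L)))}

/-- The value of the singular integral `I_R` for `R ≥ R₀`. -/
def IRval (n : ℕ) (M : Matrix (Fin (n+1)) (Fin (n+1)) ℝ) (a b : Fin (n+1) → ℝ)
    (R : ℝ) : ℝ :=
  2 * (∏ j ∈ Finset.univ.filter (fun j : Fin (n+1) => 2 ≤ j.val), (b j - a j))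
    / (((n : ℝ) - 1) * |M.det| * R^(n-1))

/-- The error exponent factor `E_τ(B)`. -/
def Etau (n : ℕ) (τ B : ℝ) : ℝ :=
  if 5 ≤ n then B ^ (-(((n : ℝ) - 3) * τ / (5 * (n : ℝ) - 7)))
  else B ^ (-(2 * τ / 17))

/-- The error factor `E_τ(1;B)` from the upper-bound range `-1 < τ < 1`. -/
def Etau1 (n : ℕ) (τ B : ℝ) : ℝ :=
  if 5 ≤ n then B ^ (-(((n : ℝ) - 3) * τ / 2))
  else B ^ (-τ) + B ^ (-((1 + τ)/4))

end Quad


open scoped BigOperators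
open Finset Filter Topology Matrix
noncomputable section
namespace QH
open MeasureTheory

/-- the projection to the torus -/
def tor {ι : Type*} (x : ι → ℝ) : UnitAddTorus ι := fun i => (x i : UnitAddCircle)

lemma tor_quot {ι : Type*} [Fintype ι] : IsOpenQuotientMap (tor (ι := ι)) := by
  have h : ∀ _ : ι, IsOpenQuotientMap (fun x : ℝ => (x : UnitAddCircle)) := fun _ =>
    QuotientAddGroup.isOpenQuotientMap_mk
  exact IsOpenQuotientMap.piMap h

lemma tor_mFourier {ι : Type*} [Fintype ι] (v : ι → ℤ) (x : ι → ℝ) :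
    UnitAddTorus.mFourier v (tor x) = Complex.exp (2 * Real.pi * Complex.I * ∑ i, (v i : ℂ) * x i) := by
  rw [Finset.mul_sum, Complex.exp_sum]
  simp only [UnitAddTorus.mFourier, ContinuousMap.coe_mk, tor, fourier_coe_apply]
  refine Finset.prod_congr rfl fun i _ => ?_
  congr 1
  push_cast
  ring

lemma tor_eq {ι : Type*} {x y : ι → ℝ} (h : tor x = tor y) : ∃ k : ι → ℤ, y = fun i => x i + k i := by
  have : ∀ i, ∃ k : ℤ, y i = x i + k := by
    intro i
    have hi := congrFun h i
    simp only [tor] at hi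
    rw [QuotientAddGroup.eq] at hi
    obtain ⟨k, hk⟩ := AddSubgroup.mem_zmultiples_iff.mp hi
    refine ⟨k, ?_⟩
    simp at hk
    linarith
  choose k hk using this
  exact ⟨k, funext hk⟩

variable {ι : Type*} [Fintype ι]

/-- local uniform summability -/
def LocSum (f : (ι → ℝ) → ℂ) : Prop := ∀ r : ℝ, ∃ b : (ι → ℤ) → ℝ, Summable b ∧
  ∀ m (x : ι → ℝ), ‖x‖ ≤ r → ‖f (fun i => x i + m i)‖ ≤ b m

def cube (m : ι → ℤ) : Set (ι → ℝ) := {x | ∀ i, x i ∈ Set.Ioc (m i : ℝ) (m i + 1)}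

lemma cube_meas (m : ι → ℤ) : MeasurableSet (cube m) := by
  have : cube m = Set.univ.pi fun i => Set.Ioc (m i : ℝ) (m i + 1) := by
    ext x; simp [cube]
  rw [this]
  exact MeasurableSet.univ_pi fun i => measurableSet_Ioc

lemma cube_disj : Pairwise (Function.onFun Disjoint (cube (ι := ι))) := by
  intro m m' h
  rw [Function.onFun, Set.disjoint_left]
  intro x hx hx'
  apply h
  funext i
  have h1 := hx i
  have h2 := hx' i
  simp only [Set.mem_Ioc] at h1 h2
  have a1 : (m i : ℝ) < m' i + 1 := by linarith
  have a2 : (m' i : ℝ) < m i + 1 := by linarith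
  norm_cast at a1 a2
  lia

lemma cube_univ : (⋃ m, cube (ι := ι) m) = Set.univ := by
  rw [Set.eq_univ_iff_forall]
  intro x
  rw [Set.mem_iUnion]
  refine ⟨fun i => ⌈x i⌉ - 1, fun i => ?_⟩
  simp only [Set.mem_Ioc]
  push_cast
  constructor
  · linarith [Int.ceil_lt_add_one (x i)]
  · linarith [Int.le_ceil (x i)]

lemma cube_shift (g : (ι → ℝ) → ℂ) (m : ι → ℤ) :
    ∫ x in cube m, g x = ∫ x in cube (0 : ι → ℤ), g (fun i => x i + m i) := by
  rw [← integral_indicator (cube_meas _), ← integral_indicator (cube_meas _),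
    ← integral_add_right_eq_self _ (fun i => (m i : ℝ))]
  congr 1
  funext x
  simp only [Set.indicator]
  have : (x + fun i => (m i : ℝ)) ∈ cube m ↔ x ∈ cube (0 : ι → ℤ) := by
    simp only [cube, Set.mem_setOf_eq, Set.mem_Ioc, Pi.add_apply, Pi.zero_apply, Int.cast_zero]
    refine forall_congr' fun i => ?_
    constructor <;> rintro ⟨a, b⟩ <;> constructor <;> linarith
  by_cases hx : x ∈ cube (0 : ι → ℤ)
  · rw [if_pos hx, if_pos (this.2 hx)]; rfl
  · rw [if_neg hx, if_neg (fun h => hx (this.1 h))]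

theorem poisson (f : (ι → ℝ) → ℂ) (hf : Continuous f) (hl : LocSum f) (hi : Integrable f)
    (hs : Summable fun v : ι → ℤ =>
      ∫ x : ι → ℝ, Complex.exp (-(2 * Real.pi * Complex.I * ∑ i, (v i : ℂ) * x i)) * f x) :
    HasSum (fun v : ι → ℤ =>
      ∫ x : ι → ℝ, Complex.exp (-(2 * Real.pi * Complex.I * ∑ i, (v i : ℂ) * x i)) * f x)
      (∑' m : ι → ℤ, f (fun i => (m i : ℝ))) := by
  set S : (ι → ℝ) → ℂ := fun x => ∑' m : ι → ℤ, f (fun i => x i + m i) with hS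
  have hSc : Continuous S := by
    rw [continuous_iff_continuousAt]
    intro x
    obtain ⟨b, hb, hfb⟩ := hl (‖x‖ + 1)
    have : ContinuousOn S (Metric.closedBall 0 (‖x‖ + 1)) := by
      refine continuousOn_tsum (fun m => ?_) hb fun m y hy => hfb m y ?_
      · apply Continuous.continuousOn
        fun_prop
      · simpa using hy
    refine this.continuousAt ?_
    refine Metric.closedBall_mem_nhds_of_mem ?_
    simp
  have hSp : ∀ x y, tor x = tor y → S x = S y := by
    intro x y h
    obtain ⟨k, rfl⟩ := tor_eq h
    simp only [hS]
    rw [← (Equiv.addLeft k).tsum_eq]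
    refine tsum_congr fun m => ?_
    congr 1; funext i
    simp; ring
  obtain ⟨F, hF⟩ : ∃ F : C(UnitAddTorus ι, ℂ), ∀ x, F (tor x) = S x := by
    let F0 : UnitAddTorus ι → ℂ := fun y => S (tor_quot.surjective y).choose
    have hF0 : ∀ x, F0 (tor x) = S x := fun x =>
      hSp _ _ (tor_quot.surjective (tor x)).choose_spec
    refine ⟨⟨F0, ?_⟩, hF0⟩
    rw [tor_quot.isQuotientMap.continuous_iff]
    convert hSc
    funext x; exact hF0 x
  have hcoef : ∀ v, UnitAddTorus.mFourierCoeff F v =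
      ∫ x : ι → ℝ, Complex.exp (-(2 * Real.pi * Complex.I * ∑ i, (v i : ℂ) * x i)) * f x := by
    intro v
    set e : (ι → ℝ) → ℂ := fun x => Complex.exp (-(2 * Real.pi * Complex.I * ∑ i, (v i : ℂ) * x i)) with he
    have hec : Continuous e := by fun_prop
    have hen : ∀ x, ‖e x‖ = 1 := by
      intro x
      have : -(2 * Real.pi * Complex.I * ∑ i, (v i : ℂ) * x i) =
        ((-(2 * Real.pi * ∑ i, (v i : ℝ) * x i) : ℝ) : ℂ) * Complex.I := by push_cast; ring
      simp only [he, this, Complex.norm_exp_ofReal_mul_I]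
    have hep : ∀ x (m : ι → ℤ), e (fun i => x i + m i) = e x := by
      intro x m
      simp only [he]
      rw [Complex.exp_eq_exp_iff_exists_int]
      refine ⟨-∑ i, v i * m i, ?_⟩
      push_cast
      simp only [mul_add, Finset.sum_add_distrib]
      ring
    rw [UnitAddTorus.mFourierCoeff_eq_integral F v 0]
    have hset : {x : ι → ℝ | ∀ i, x i ∈ Set.Ioc ((0 : ι → ℝ) i) ((0 : ι → ℝ) i + 1)} = cube (0 : ι → ℤ) := by
      ext x; simp [cube]
    rw [hset]
    have h1 : ∀ x : ι → ℝ, UnitAddTorus.mFourier (-v) (fun i => (x i : UnitAddCircle)) •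
        F (fun i => (x i : UnitAddCircle)) = ∑' m : ι → ℤ, e (fun i => x i + m i) * f (fun i => x i + m i) := by
      intro x
      have := tor_mFourier (-v) x
      rw [show (fun i => (x i : UnitAddCircle)) = tor x from rfl, this, hF, smul_eq_mul, hS]
      simp only [hep]
      rw [tsum_mul_left]
      congr 2
      simp
    simp_rw [h1]
    obtain ⟨b, hb, hfb⟩ := hl 1
    have hcv : (volume : Measure (ι → ℝ)) (cube (0 : ι → ℤ)) = 1 := by
      have : cube (0 : ι → ℤ) = Set.univ.pi fun i => Set.Ioc (0 : ℝ) (1) := by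
        ext x; simp [cube]
      rw [this, Real.volume_pi_Ioc]; simp
    have hfin : IsFiniteMeasure ((volume : Measure (ι → ℝ)).restrict (cube (0 : ι → ℤ))) := ⟨by
      rw [Measure.restrict_apply_univ, hcv]; simp⟩
    have hbnd : ∀ m (x : ι → ℝ), x ∈ cube (0 : ι → ℤ) → ‖e (fun i => x i + m i) * f (fun i => x i + m i)‖ ≤ b m := by
      intro m x hx
      rw [norm_mul, hen, one_mul]
      apply hfb
      rw [pi_norm_le_iff_of_nonneg zero_le_one]
      intro i
      have := hx i
      simp at this
      rw [Real.norm_eq_abs, abs_le]; constructor <;> linarith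
    have hgi : ∀ m : ι → ℤ, Integrable (fun x : ι → ℝ => e (fun i => x i + m i) * f (fun i => x i + m i))
        (volume.restrict (cube (0 : ι → ℤ))) := by
      intro m
      refine Integrable.mono' (integrable_const (b m)) (Continuous.aestronglyMeasurable (by fun_prop)) ?_
      rw [ae_restrict_iff' (cube_meas _)]
      exact Eventually.of_forall fun x hx => hbnd m x hx
    rw [← integral_tsum_of_summable_integral_norm hgi]
    · have hIntegr : Integrable (fun x => e x * f x) := by
        refine hi.bdd_mul (c := 1) hec.aestronglyMeasurable ?_
        exact Eventually.of_forall fun x => (hen x).le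
      rw [← setIntegral_univ (f := fun x => e x * f x), ← cube_univ, integral_iUnion (cube_meas) cube_disj hIntegr.integrableOn]
      refine tsum_congr fun m => ?_
      rw [cube_shift (fun x => e x * f x)]
    · refine Summable.of_nonneg_of_le (fun m => ?_) (fun m => ?_) hb
      · exact integral_nonneg fun x => norm_nonneg _
      · calc _ ≤ ∫ x in cube (0 : ι → ℤ), b m := by
              refine setIntegral_mono_on (hgi m).norm (integrable_const _) (cube_meas _) fun x hx => hbnd m x hx
          _ = b m := by simp [Measure.real, hcv]
  have hsF : Summable (UnitAddTorus.mFourierCoeff F) := by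
    convert hs using 2 with v
    exact hcoef v
  have := UnitAddTorus.hasSum_mFourier_series_apply_of_summable hsF (tor 0)
  rw [hF] at this
  convert this using 2 with v v
  · rw [hcoef, tor_mFourier]; simp
  · simp [hS]
end QH
end

open scoped BigOperators
open Finset Filter Topology Matrix
noncomputable section
namespace QH
open MeasureTheory
variable {ι : Type*} [Fintype ι] [DecidableEq ι]

lemma sq_le_of_inv (P : Matrix ι ι ℝ) (hP : P.det ≠ 0) (y : ι → ℝ) :
    ∑ i, y i ^ 2 ≤ (∑ i, ∑ j, (P⁻¹ i j) ^ 2) * ∑ i, (P *ᵥ y) i ^ 2 := by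
  have h : y = P⁻¹ *ᵥ (P *ᵥ y) := by
    rw [Matrix.mulVec_mulVec, Matrix.nonsing_inv_mul _ (isUnit_iff_ne_zero.2 hP), Matrix.one_mulVec]
  conv_lhs => rw [h]
  rw [Finset.sum_mul]
  refine Finset.sum_le_sum fun i _ => ?_
  simp only [Matrix.mulVec, dotProduct]
  exact Finset.sum_mul_sq_le_sq_mul_sq _ _ _

lemma summable_prod_pi (g : ι → ℤ → ℝ) (hg0 : ∀ i k, 0 ≤ g i k) (hg : ∀ i, Summable (g i)) :
    Summable fun m : ι → ℤ => ∏ i, g i (m i) := by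
  refine summable_of_sum_le (c := ∏ i, ∑' k, g i k) (fun m => Finset.prod_nonneg fun i _ => hg0 _ _) fun s => ?_
  calc ∑ m ∈ s, ∏ i, g i (m i) ≤ ∑ m ∈ Fintype.piFinset (fun i => s.image (fun m => m i)), ∏ i, g i (m i) := by
        refine Finset.sum_le_sum_of_subset_of_nonneg ?_ fun m _ _ => Finset.prod_nonneg fun i _ => hg0 _ _
        intro m hm
        rw [Fintype.mem_piFinset]
        intro i
        exact Finset.mem_image_of_mem _ hm
    _ = ∏ i, ∑ k ∈ s.image (fun m => m i), g i k := by
        rw [Finset.prod_univ_sum]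
    _ ≤ ∏ i, ∑' k, g i k := by
        refine Finset.prod_le_prod (fun i _ => Finset.sum_nonneg fun k _ => hg0 _ _) fun i _ => ?_
        exact (hg i).sum_le_tsum _ fun k _ => hg0 _ _

lemma summable_gauss1 (c : ℝ) (hc : 0 < c) : Summable fun k : ℤ => Real.exp (-c * (k:ℝ) ^ 2) := by
  have := (summable_jacobiTheta₂_term_iff 0 ((c / Real.pi : ℝ) * Complex.I)).2 (by simp; positivity)
  rw [← summable_norm_iff] at this
  simp_rw [norm_jacobiTheta₂_term] at this
  convert this using 2 with k
  congr 1
  have : Real.pi ≠ 0 := Real.pi_ne_zero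
  simp
  field_simp

lemma gsum (P : Matrix ι ι ℝ) (hP : P.det ≠ 0) (c : ℝ) (hc : 0 < c) (r : ℝ) :
    ∃ b : (ι → ℤ) → ℝ, Summable b ∧ ∀ (m : ι → ℤ) (x : ι → ℝ), ‖x‖ ≤ r →
      Real.exp (-c * ∑ i, (P *ᵥ (fun i => x i + m i)) i ^ 2) ≤ b m := by
  set K := (∑ i, ∑ j, (P⁻¹ i j) ^ 2) + 1 with hK
  have hK0 : 0 < K := by positivity
  refine ⟨fun m => Real.exp (c / K * (Fintype.card ι * r ^ 2)) * ∏ i, Real.exp (-(c / (2 * K)) * (m i : ℝ) ^ 2),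
    (summable_prod_pi (fun i k => Real.exp (-(c / (2 * K)) * (k : ℝ) ^ 2)) (fun i k => (Real.exp_pos _).le) fun i => summable_gauss1 _ (by positivity)).mul_left _, ?_⟩
  intro m x hx
  beta_reduce
  rw [← Real.exp_sum, ← Real.exp_add]
  apply Real.exp_le_exp.2
  have h1 := sq_le_of_inv P hP (fun i => x i + m i)
  have h2 : ∑ i, (x i + m i) ^ 2 ≤ K * ∑ i, (P *ᵥ (fun i => x i + m i)) i ^ 2 := by
    refine h1.trans ?_
    have : 0 ≤ ∑ i, (P *ᵥ (fun i => x i + m i)) i ^ 2 := by positivity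
    rw [hK]; nlinarith
  have h3 : (∑ i, (m i : ℝ) ^ 2) / 2 - Fintype.card ι * r ^ 2 ≤ ∑ i, (x i + m i) ^ 2 := by
    have : (Fintype.card ι : ℝ) * r ^ 2 = ∑ i : ι, r ^ 2 := by simp
    rw [this, Finset.sum_div, ← Finset.sum_sub_distrib]
    refine Finset.sum_le_sum fun i _ => ?_
    have : x i ^ 2 ≤ r ^ 2 := by
      have := (norm_le_pi_norm x i).trans hx
      rw [Real.norm_eq_abs] at this
      rw [← sq_abs]; gcongr
    nlinarith [sq_nonneg (2 * x i + m i)]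
  have h4 : ((∑ i, (m i : ℝ) ^ 2) / 2 - Fintype.card ι * r ^ 2) / K ≤ ∑ i, (P *ᵥ (fun i => x i + m i)) i ^ 2 := by
    rw [div_le_iff₀ hK0]; linarith
  have h5 := mul_le_mul_of_nonneg_left h4 hc.le
  rw [← Finset.mul_sum]
  have : c * (((∑ i, (m i : ℝ) ^ 2) / 2 - Fintype.card ι * r ^ 2) / K) = (c / (2 * K)) * (∑ i, (m i : ℝ) ^ 2) - c / K * (Fintype.card ι * r ^ 2) := by
    field_simp
  linarith

/-- lower bound by the minimum of weights -/
lemma exists_min (w : ι → ℝ) (hw : ∀ i, 0 < w i) : ∃ c, 0 < c ∧ ∀ i, c ≤ w i := by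
  rcases isEmpty_or_nonempty ι with h | h
  · exact ⟨1, one_pos, fun i => h.elim i⟩
  · obtain ⟨i, hi⟩ := Finite.exists_min w
    exact ⟨w i, hw i, hi⟩

lemma gsum_w (P : Matrix ι ι ℝ) (hP : P.det ≠ 0) (w : ι → ℝ) (hw : ∀ i, 0 < w i) (γ : ι → ℝ) (r : ℝ) :
    ∃ b : (ι → ℤ) → ℝ, Summable b ∧ ∀ (m : ι → ℤ) (x : ι → ℝ), ‖x‖ ≤ r →
      Real.exp (-Real.pi * ∑ i, w i * (P *ᵥ (fun i => x i + m i + γ i)) i ^ 2) ≤ b m := by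
  obtain ⟨c, hc, hcw⟩ := exists_min w hw
  obtain ⟨b, hb, h⟩ := gsum P hP (Real.pi * c) (by positivity) (r + ‖γ‖)
  refine ⟨b, hb, fun m x hx => le_trans ?_ (h m (x + γ) ((norm_add_le _ _).trans (by linarith)))⟩
  apply Real.exp_le_exp.2
  have e : (fun i => (x + γ) i + (m i : ℝ)) = (fun i => x i + m i + γ i) := by
    funext i; simp; ring
  rw [e]
  have : c * ∑ i, (P *ᵥ (fun i => x i + m i + γ i)) i ^ 2 ≤ ∑ i, w i * (P *ᵥ (fun i => x i + m i + γ i)) i ^ 2 := by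
    rw [Finset.mul_sum]
    refine Finset.sum_le_sum fun i _ => mul_le_mul_of_nonneg_right (hcw i) (sq_nonneg _)
  nlinarith [Real.pi_pos]

lemma summable_gauss (P : Matrix ι ι ℝ) (hP : P.det ≠ 0) (w : ι → ℝ) (hw : ∀ i, 0 < w i) (γ : ι → ℝ) :
    Summable fun m : ι → ℤ => Real.exp (-Real.pi * ∑ i, w i * (P *ᵥ (fun i => m i + γ i)) i ^ 2) := by
  obtain ⟨b, hb, h⟩ := gsum_w P hP w hw γ 0
  refine Summable.of_nonneg_of_le (fun m => (Real.exp_pos _).le) (fun m => ?_) hb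
  simpa using h m 0 (by simp)

/-- complex Gaussian -/
def cg (P : Matrix ι ι ℝ) (z : ι → ℂ) (y : ι → ℝ) : ℂ :=
  Complex.exp (-Real.pi * ∑ i, z i * ((P *ᵥ y) i : ℂ) ^ 2)

lemma cg_norm (P : Matrix ι ι ℝ) (z : ι → ℂ) (y : ι → ℝ) :
    ‖cg P z y‖ = Real.exp (-Real.pi * ∑ i, (z i).re * (P *ᵥ y) i ^ 2) := by
  rw [cg, Complex.norm_exp]
  congr 1
  have : ∀ i, (z i * ((P *ᵥ y) i : ℂ) ^ 2).re = (z i).re * (P *ᵥ y) i ^ 2 := by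
    intro i
    rw [← Complex.ofReal_pow, Complex.re_mul_ofReal]
  rw [← Complex.ofReal_neg, Complex.re_ofReal_mul, Complex.re_sum]
  simp [this]

lemma cg_int_one (z : ι → ℂ) (hz : ∀ i, 0 < (z i).re) (s : ι → ℝ) :
    ∫ y : ι → ℝ, Complex.exp (-(2 * Real.pi * Complex.I * ∑ i, (s i : ℂ) * y i)) * cg 1 z y =
      (∏ i, (1 / z i) ^ (1 / 2 : ℂ)) * Complex.exp (-Real.pi * ∑ i, (s i : ℂ) ^ 2 / z i) := by
  have hpi : (Real.pi : ℂ) ≠ 0 := by exact_mod_cast Real.pi_ne_zero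
  have hz0 : ∀ i, z i ≠ 0 := fun i h => by have := hz i; rw [h] at this; simp at this
  have := GaussianFourier.integral_cexp_neg_sum_mul_add (b := fun i => Real.pi * z i)
    (fun i => by rw [Complex.re_ofReal_mul]; exact mul_pos Real.pi_pos (hz i)) (fun i => -(2 * Real.pi * Complex.I * s i))
  rw [Finset.mul_sum, Complex.exp_sum, ← Finset.prod_mul_distrib]
  refine Eq.trans ?_ (this.trans ?_)
  · congr 1; funext y
    rw [cg, ← Complex.exp_add]
    congr 1
    simp only [Matrix.one_mulVec, Finset.mul_sum, ← Finset.sum_neg_distrib, ← Finset.sum_add_distrib]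
    refine Finset.sum_congr rfl fun i _ => ?_
    ring
  · refine Finset.prod_congr rfl fun i _ => ?_
    congr 1
    · congr 1; field_simp
    · congr 1
      have h1 := hz0 i
      field_simp
      rw [Complex.I_sq]; ring

lemma cg_comp (P : Matrix ι ι ℝ) (z : ι → ℂ) (y : ι → ℝ) : cg P z y = cg 1 z (P *ᵥ y) := by
  simp [cg]

lemma cg_integrable_one (z : ι → ℂ) (hz : ∀ i, 0 < (z i).re) : Integrable (cg 1 z) := by
  have := GaussianFourier.integrable_cexp_neg_sum_mul_add (b := fun i => Real.pi * z i)
    (fun i => by rw [Complex.re_ofReal_mul]; exact mul_pos Real.pi_pos (hz i)) (fun i => 0)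
  convert this using 2 with y
  rw [cg, Finset.mul_sum]
  simp [mul_assoc]

lemma integral_comp_mat (P : Matrix ι ι ℝ) (hP : P.det ≠ 0) (g : (ι → ℝ) → ℂ) :
    ∫ x, g (P *ᵥ x) = (|P.det|⁻¹ : ℝ) • ∫ x, g x := by
  have h := Real.map_matrix_volume_pi_eq_smul_volume_pi hP
  let e : (ι → ℝ) ≃ᵐ (ι → ℝ) := (LinearEquiv.toContinuousLinearEquiv (LinearMap.equivOfDetNeZero (Matrix.toLin' P) (by simpa using hP))).toHomeomorph.toMeasurableEquiv
  have he : ∀ x, e x = P *ᵥ x := fun x => rfl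
  have h2 := e.measurableEmbedding.integral_map (μ := (volume : Measure (ι → ℝ))) g
  have h3 : (⇑e) = ⇑(Matrix.toLin' P) := by funext x; rfl
  rw [h3, h] at h2
  rw [integral_smul_measure] at h2
  simp only [Matrix.toLin'_apply] at h2
  rw [← h2, ENNReal.toReal_ofReal (abs_nonneg _), abs_inv]

lemma integrable_comp_mat (P : Matrix ι ι ℝ) (hP : P.det ≠ 0) (g : (ι → ℝ) → ℂ) (hg : Integrable g) :
    Integrable fun x => g (P *ᵥ x) := by
  have h := Real.map_matrix_volume_pi_eq_smul_volume_pi hP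
  have : Integrable g (Measure.map (⇑(Matrix.toLin' P)) volume) := by
    rw [h]; exact hg.smul_measure ENNReal.ofReal_ne_top
  exact this.comp_measurable (Continuous.measurable (LinearMap.continuous_of_finiteDimensional _))

/-- the dual Gaussian term -/
def dg (P : Matrix ι ι ℝ) (z : ι → ℂ) (v : ι → ℝ) : ℂ :=
  (|P.det|⁻¹ : ℝ) * (∏ i, (1 / z i) ^ (1 / 2 : ℂ)) * Complex.exp (-Real.pi * ∑ i, ((P⁻¹ᵀ *ᵥ v) i : ℂ) ^ 2 / z i)

lemma cg_fourier (P : Matrix ι ι ℝ) (hP : P.det ≠ 0) (z : ι → ℂ) (hz : ∀ i, 0 < (z i).re) (γ v : ι → ℝ) :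
    ∫ x : ι → ℝ, Complex.exp (-(2 * Real.pi * Complex.I * ∑ i, (v i : ℂ) * x i)) * cg P z (x + γ) =
      dg P z v * Complex.exp (2 * Real.pi * Complex.I * ∑ i, (v i : ℂ) * γ i) := by
  rw [← integral_sub_right_eq_self _ γ]
  simp only [sub_add_cancel]
  have hu : IsUnit P.det := isUnit_iff_ne_zero.2 hP
  have h1 : ∀ x : ι → ℝ, Complex.exp (-(2 * Real.pi * Complex.I * ∑ i, (v i : ℂ) * ((x - γ) i : ℝ))) * cg P z x =
     Complex.exp (2 * Real.pi * Complex.I * ∑ i, (v i : ℂ) * γ i) * 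
      (fun y : ι → ℝ => Complex.exp (-(2 * Real.pi * Complex.I * ∑ i, ((P⁻¹ᵀ *ᵥ v) i : ℂ) * y i)) * cg 1 z y) (P *ᵥ x) := by
    intro x
    simp only
    rw [← cg_comp, ← mul_assoc, ← Complex.exp_add]
    congr 2
    have h2 : ∑ i, (P⁻¹ᵀ *ᵥ v) i * (P *ᵥ x) i = ∑ i, v i * x i := by
      have : (P⁻¹ᵀ *ᵥ v) ⬝ᵥ (P *ᵥ x) = v ⬝ᵥ x := by
        rw [Matrix.mulVec_transpose, ← Matrix.dotProduct_mulVec, Matrix.mulVec_mulVec, Matrix.nonsing_inv_mul _ hu, Matrix.one_mulVec]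
      exact this
    have h3 : ∑ i, ((P⁻¹ᵀ *ᵥ v) i : ℂ) * ((P *ᵥ x) i : ℂ) = ∑ i, (v i : ℂ) * x i := by exact_mod_cast h2
    rw [h3]
    simp only [Pi.sub_apply, Complex.ofReal_sub, mul_sub, Finset.sum_sub_distrib]
    ring
  simp_rw [h1]
  rw [integral_const_mul, integral_comp_mat P hP (fun y : ι → ℝ => Complex.exp (-(2 * Real.pi * Complex.I * ∑ i, ((P⁻¹ᵀ *ᵥ v) i : ℂ) * y i)) * cg 1 z y), cg_int_one z hz, dg, Complex.real_smul]
  ring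

lemma dg_norm (P : Matrix ι ι ℝ) (z : ι → ℂ) (hz : ∀ i, 0 < (z i).re) (v : ι → ℝ) :
    ‖dg P z v‖ = |P.det|⁻¹ * (∏ i, ‖z i‖ ^ (-(1 / 2 : ℝ))) *
      Real.exp (-Real.pi * ∑ i, ((z i).re / ‖z i‖ ^ 2) * (P⁻¹ᵀ *ᵥ v) i ^ 2) := by
  have hz0 : ∀ i, z i ≠ 0 := fun i h => by have := hz i; rw [h] at this; simp at this
  rw [dg, norm_mul, norm_mul, Complex.norm_real, Real.norm_eq_abs, abs_inv, abs_abs, norm_prod]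
  congr 1
  · congr 1
    refine Finset.prod_congr rfl fun i _ => ?_
    rw [Complex.norm_cpow_of_ne_zero (by simpa using hz0 i)]
    simp only [norm_div, norm_one]
    have e1 : ((1:ℂ)/2).re = 1/2 := by simp
    have e2 : ((1:ℂ)/2).im = 0 := by simp
    rw [e1, e2, mul_zero, Real.exp_zero, div_one, one_div, Real.inv_rpow (norm_nonneg _), Real.rpow_neg (norm_nonneg _)]
  · rw [Complex.norm_exp]
    congr 1
    rw [← Complex.ofReal_neg, Complex.re_ofReal_mul, Complex.re_sum]
    congr 1
    refine Finset.sum_congr rfl fun i _ => ?_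
    rw [← Complex.ofReal_pow, div_eq_mul_inv, Complex.re_ofReal_mul, Complex.inv_re, Complex.normSq_eq_norm_sq]
    ring

theorem poisson_gauss (P : Matrix ι ι ℝ) (hP : P.det ≠ 0) (z : ι → ℂ) (hz : ∀ i, 0 < (z i).re) (γ : ι → ℝ) :
    (Summable fun v : ι → ℤ => ‖dg P z (fun i => (v i : ℝ))‖) ∧
    HasSum (fun v : ι → ℤ => dg P z (fun i => (v i : ℝ)) * Complex.exp (2 * Real.pi * Complex.I * ∑ i, (v i : ℂ) * γ i))
      (∑' m : ι → ℤ, cg P z (fun i => m i + γ i)) := by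
  have hz0 : ∀ i, z i ≠ 0 := fun i h => by have := hz i; rw [h] at this; simp at this
  have hsum : Summable fun v : ι → ℤ => ‖dg P z (fun i => (v i : ℝ))‖ := by
    simp_rw [dg_norm P z hz]
    refine Summable.mul_left _ ?_
    have h := summable_gauss P⁻¹ᵀ (by rw [Matrix.det_transpose, Matrix.det_nonsing_inv]; simpa using hP) (fun i => (z i).re / ‖z i‖ ^ 2)
      (fun i => div_pos (hz i) (by have := hz0 i; positivity)) 0
    simpa using h
  refine ⟨hsum, ?_⟩
  have key : ∀ v : ι → ℤ, ∫ x : ι → ℝ, Complex.exp (-(2 * Real.pi * Complex.I * ∑ i, (v i : ℂ) * x i)) * cg P z (x + γ) =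
     dg P z (fun i => (v i : ℝ)) * Complex.exp (2 * Real.pi * Complex.I * ∑ i, (v i : ℂ) * γ i) := by
    intro v
    have := cg_fourier P hP z hz γ (fun i => (v i : ℝ))
    simpa using this
  have hen : ∀ v : ι → ℤ, ‖Complex.exp (2 * Real.pi * Complex.I * ∑ i, (v i : ℂ) * γ i)‖ = 1 := by
    intro v
    have : (2 * Real.pi * Complex.I * ∑ i, (v i : ℂ) * γ i) =
        (((2 * Real.pi * ∑ i, (v i : ℝ) * γ i) : ℝ) : ℂ) * Complex.I := by push_cast; ring
    rw [this, Complex.norm_exp_ofReal_mul_I]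
  have hcont : Continuous fun x : ι → ℝ => cg P z (x + γ) := by
    unfold cg
    simp only [Matrix.mulVec, dotProduct]
    fun_prop
  have := poisson (fun x : ι → ℝ => cg P z (x + γ)) hcont ?_ ?_ ?_
  · simp_rw [key] at this
    exact this
  · intro r
    obtain ⟨b, hb, h⟩ := gsum_w P hP (fun i => (z i).re) hz γ r
    refine ⟨b, hb, fun m x hx => ?_⟩
    rw [cg_norm]
    exact h m x hx
  · have h1 := integrable_comp_mat P hP _ (cg_integrable_one z hz)
    have h2 : Integrable (fun x => cg P z x) := by
      convert h1 using 2 with x; exact cg_comp _ _ _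
    exact h2.comp_add_right γ
  · simp_rw [key]
    rw [← summable_norm_iff]
    simp_rw [norm_mul, hen, mul_one]
    exact hsum
end QH
end

open scoped BigOperators
open Finset Filter Topology Matrix
noncomputable section
namespace QH
open MeasureTheory
variable {ι : Type*} [Fintype ι] [DecidableEq ι]

/-- integer quadratic polynomial evaluated in a commutative ring -/
def qpoly {A : Type*} [CommRing A] (C : Matrix ι ι ℤ) (l : ι → ℤ) (k : ℤ) (x : ι → A) : A :=
  ∑ i, ∑ j, (C i j : A) * x i * x j + ∑ i, (l i : A) * x i + (k : A)

lemma qpoly_map {A A' : Type*} [CommRing A] [CommRing A'] (f : A →+* A') (C : Matrix ι ι ℤ) (l : ι → ℤ) (k : ℤ) (x : ι → A) :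
    f (qpoly C l k x) = qpoly C l k (fun i => f (x i)) := by
  simp [qpoly]

/-- complete quadratic Gauss sum over a finite ring -/
def GS {A : Type*} [CommRing A] [Fintype A] (ψ : AddChar A ℂ) (C : Matrix ι ι ℤ) (l : ι → ℤ) (k : ℤ)
    (a : A) (v : ι → A) : ℂ :=
  ∑ x : ι → A, ψ (a * qpoly C l k x + ∑ i, v i * x i)

/-- residues and quotients -/
def resEquiv (ι : Type*) (q : ℕ) [NeZero q] : (ι → ZMod q) × (ι → ℤ) ≃ (ι → ℤ) where
  toFun p := fun i => ((p.1 i).val : ℤ) + q * p.2 i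
  invFun c := (fun i => (c i : ZMod q), fun i => c i / q)
  left_inv := by
    rintro ⟨r, m⟩
    have hq : (q : ℤ) ≠ 0 := by exact_mod_cast NeZero.ne q
    refine Prod.ext (funext fun i => ?_) (funext fun i => ?_)
    · simp
    · simp only
      rw [Int.add_mul_ediv_left _ _ hq, Int.ediv_eq_zero_of_lt (by positivity) (by exact_mod_cast ZMod.val_lt _), zero_add]
  right_inv := by
    intro c
    funext i
    simp only
    rw [ZMod.val_intCast]
    exact Int.emod_add_mul_ediv _ _

lemma exp_stdAddChar (q : ℕ) [NeZero q] (j : ℤ) :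
    Complex.exp (2 * Real.pi * Complex.I * ((j : ℂ) / q)) = ZMod.stdAddChar (j : ZMod q) := by
  rw [ZMod.stdAddChar_coe]; congr 1; ring

/-- weights -/
def zw (s : ι → ℝ) (Z θ : ℝ) (i : ι) : ℂ := (1 / Z ^ 2 : ℝ) - 2 * Complex.I * (s i : ℝ) * (θ : ℝ)

lemma zw_re (s : ι → ℝ) (Z θ : ℝ) (i : ι) : (zw s Z θ i).re = 1 / Z ^ 2 := by
  have h : zw s Z θ i = ((1 / Z ^ 2 : ℝ) : ℂ) + ((-2 * s i * θ : ℝ) : ℂ) * Complex.I := by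
    rw [zw]; push_cast; ring
  rw [h, Complex.add_re, Complex.re_ofReal_mul, Complex.ofReal_re, Complex.I_re, mul_zero, add_zero]

lemma zw_norm (s : ι → ℝ) (hs : ∀ i, s i ^ 2 = 1) (Z θ : ℝ) (hZ : 0 < Z) (i : ι) :
    ‖zw s Z θ i‖ = Real.sqrt (1 + 4 * (Z ^ 2 * θ) ^ 2) / Z ^ 2 := by
  have h : zw s Z θ i = ((1 / Z ^ 2 : ℝ) : ℂ) + ((-2 * s i * θ : ℝ) : ℂ) * Complex.I := by
    rw [zw]; push_cast; ring
  rw [h, Complex.norm_add_mul_I]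
  rw [eq_div_iff (by positivity)]
  rw [← Real.sqrt_sq (show 0 ≤ Z ^ 2 by positivity), ← Real.sqrt_mul (by positivity), Real.sqrt_sq (by positivity)]
  congr 1
  have := hs i
  have hZ' := hZ.ne'
  field_simp
  linear_combination 4 * θ ^ 2 * Z ^ 4 * this

/-- the theta function -/
def Theta (P : Matrix ι ι ℝ) (s γ : ι → ℝ) (Z β : ℝ) : ℂ :=
  ∑' c : ι → ℤ, cg P (zw s Z β) (fun i => c i + γ i)

lemma cg_zw (P : Matrix ι ι ℝ) (s : ι → ℝ) (Z β θ : ℝ) (y : ι → ℝ) :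
    cg P (zw s Z (β + θ)) y = Complex.exp (2 * Real.pi * Complex.I * (β * (∑ i, s i * (P *ᵥ y) i ^ 2 : ℝ))) * cg P (zw s Z θ) y := by
  rw [cg, cg, ← Complex.exp_add]
  congr 1
  push_cast
  simp only [Finset.mul_sum, ← Finset.sum_add_distrib, zw]
  refine Finset.sum_congr rfl fun i _ => ?_
  push_cast
  ring

structure Setup (P : Matrix ι ι ℝ) (s γ : ι → ℝ) (C : Matrix ι ι ℤ) (l : ι → ℤ) (k : ℤ) : Prop where
  hP : P.det ≠ 0
  hs : ∀ i, s i ^ 2 = 1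
  hQ : ∀ c : ι → ℤ, ((qpoly C l k c : ℤ) : ℝ) = ∑ i, s i * (P *ᵥ (fun i => c i + γ i)) i ^ 2

variable {P : Matrix ι ι ℝ} {s γ : ι → ℝ} {C : Matrix ι ι ℤ} {l : ι → ℤ} {k : ℤ}

lemma Theta_summable (hS : Setup P s γ C l k) {Z : ℝ} (hZ : 0 < Z) (β : ℝ) :
    Summable fun c : ι → ℤ => cg P (zw s Z β) (fun i => c i + γ i) := by
  rw [← summable_norm_iff]
  simp_rw [cg_norm]
  exact summable_gauss P hS.hP _ (fun i => by rw [zw_re]; positivity) γ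

theorem Theta_expand (hS : Setup P s γ C l k) {Z : ℝ} (hZ : 0 < Z) (q : ℕ) [NeZero q] (a : ℤ) (θ : ℝ) :
    (Summable fun v : ι → ℤ => ‖dg ((q : ℝ) • P) (zw s Z θ) (fun i => (v i : ℝ))‖) ∧
    HasSum (fun v : ι → ℤ => dg ((q : ℝ) • P) (zw s Z θ) (fun i => (v i : ℝ)) *
       Complex.exp (2 * Real.pi * Complex.I * ((∑ i, (v i : ℂ) * γ i) / q)) *
       GS ZMod.stdAddChar C l k (a : ZMod q) (fun i => (v i : ZMod q)))
      (Theta P s γ Z (a / q + θ)) := by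
  have hq : (q : ℝ) ≠ 0 := by exact_mod_cast NeZero.ne q
  have hqc : (q : ℂ) ≠ 0 := by exact_mod_cast NeZero.ne q
  have hdet : ((q : ℝ) • P).det ≠ 0 := by
    rw [Matrix.det_smul]; exact mul_ne_zero (pow_ne_zero _ hq) hS.hP
  have hz : ∀ i, 0 < (zw s Z θ i).re := fun i => by rw [zw_re]; positivity
  refine ⟨(poisson_gauss _ hdet _ hz 0).1, ?_⟩
  have hsm := Theta_summable hS hZ (a / q + θ)
  have e1 : Theta P s γ Z (a / q + θ) = ∑ r : ι → ZMod q, ∑' m : ι → ℤ,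
      cg P (zw s Z (a / q + θ)) (fun i => ((resEquiv ι q (r, m)) i : ℝ) + γ i) := by
    rw [Theta, ← (resEquiv ι q).tsum_eq]
    have := (resEquiv ι q).summable_iff.2 hsm
    refine Eq.trans this.tsum_prod ?_
    rw [tsum_fintype]
    rfl
  have e2 : ∀ r : ι → ZMod q, ∀ m : ι → ℤ, cg P (zw s Z (a / q + θ)) (fun i => ((resEquiv ι q (r, m)) i : ℝ) + γ i)
      = ZMod.stdAddChar ((a : ZMod q) * qpoly C l k r) * cg ((q : ℝ) • P) (zw s Z θ) (fun i => m i + ((r i).val + γ i) / q) := by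
    intro r m
    rw [cg_zw, ← hS.hQ]
    congr 1
    · have : (a : ZMod q) * qpoly C l k r = ((a * qpoly C l k (resEquiv ι q (r, m)) : ℤ) : ZMod q) := by
        rw [Int.cast_mul]
        congr 1
        have := qpoly_map (Int.castRingHom (ZMod q)) C l k (resEquiv ι q (r, m))
        simp only [eq_intCast] at this
        rw [this]
        congr 1; funext i
        simp [resEquiv]
      rw [this, ← exp_stdAddChar]
      congr 1
      push_cast
      ring
    · rw [cg, cg]
      congr 3
      funext i
      congr 3
      rw [Matrix.smul_mulVec, ← Matrix.mulVec_smul]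
      congr 1; congr 1; funext j
      simp [resEquiv]
      field_simp
      ring
  rw [e1]
  simp_rw [e2]
  have e3 : ∀ r : ι → ZMod q, HasSum (fun v : ι → ℤ => ZMod.stdAddChar ((a : ZMod q) * qpoly C l k r) * (dg ((q : ℝ) • P) (zw s Z θ) (fun i => (v i : ℝ)) * Complex.exp (2 * Real.pi * Complex.I * ∑ i, (v i : ℂ) * ((((r i).val + γ i) / q : ℝ) : ℂ))))
     (∑' m : ι → ℤ, ZMod.stdAddChar ((a : ZMod q) * qpoly C l k r) * cg ((q : ℝ) • P) (zw s Z θ) (fun i => m i + ((r i).val + γ i) / q)) := by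
    intro r
    rw [tsum_mul_left]
    exact (poisson_gauss _ hdet _ hz (fun i => ((r i).val + γ i) / q)).2.mul_left _
  have e4 := hasSum_sum (s := Finset.univ) fun r _ => e3 r
  convert e4 using 2 with v
  rw [GS, Finset.mul_sum]
  refine Finset.sum_congr rfl fun r _ => ?_
  have e5 : Complex.exp (2 * Real.pi * Complex.I * ∑ i, (v i : ℂ) * ((((r i).val + γ i) / q : ℝ) : ℂ)) =
      Complex.exp (2 * Real.pi * Complex.I * ((∑ i, (v i : ℂ) * γ i) / q)) * ZMod.stdAddChar (∑ i, (v i : ZMod q) * r i) := by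
    have : (∑ i, (v i : ZMod q) * r i) = ((∑ i, v i * ((r i).val : ℤ) : ℤ) : ZMod q) := by simp
    rw [this, ← exp_stdAddChar, ← Complex.exp_add, ← mul_add]
    congr 2
    push_cast
    rw [Finset.sum_div, Finset.sum_div, ← Finset.sum_add_distrib]
    refine Finset.sum_congr rfl fun i _ => ?_
    field_simp
    ring
  rw [e5, AddChar.map_add_eq_mul]
  ring

lemma dg_zw_norm (hS : Setup P s γ C l k) {Z : ℝ} (hZ : 0 < Z) (q : ℕ) [NeZero q] (θ : ℝ) (v : ι → ℝ) :
    ‖dg ((q : ℝ) • P) (zw s Z θ) v‖ = ((q : ℝ) ^ Fintype.card ι)⁻¹ * |P.det|⁻¹ * Z ^ Fintype.card ι *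
      (1 + 4 * (Z ^ 2 * θ) ^ 2) ^ (-(Fintype.card ι / 4 : ℝ)) *
      Real.exp (-Real.pi * ((∑ i, (P⁻¹ᵀ *ᵥ v) i ^ 2) / (q ^ 2 * (1 + 4 * (Z ^ 2 * θ) ^ 2) / Z ^ 2))) := by
  have hq : (0 : ℝ) < q := by exact_mod_cast NeZero.pos q
  have hz : ∀ i, 0 < (zw s Z θ i).re := fun i => by rw [zw_re]; positivity
  set E := 1 + 4 * (Z ^ 2 * θ) ^ 2 with hE
  have hE0 : 0 < E := by positivity
  rw [dg_norm _ _ hz]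
  congr 1
  · rw [Matrix.det_smul, abs_mul, abs_pow, abs_of_pos hq, mul_inv]
    simp_rw [zw_norm s hS.hs Z θ hZ]
    rw [Finset.prod_const, Finset.card_univ, mul_assoc _ _ (E ^ _)]
    congr 1
    rw [← hE, Real.div_rpow (by positivity) (by positivity), Real.sqrt_eq_rpow, ← Real.rpow_mul hE0.le, div_pow,
      ← Real.rpow_natCast, ← Real.rpow_mul hE0.le]
    have : (Z ^ 2) ^ (-(1 / 2 : ℝ)) = Z⁻¹ := by
      rw [Real.rpow_neg (by positivity), ← Real.sqrt_eq_rpow, Real.sqrt_sq hZ.le]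
    rw [this, inv_pow, div_inv_eq_mul, mul_comm]
    congr 2
    ring
  · congr 2
    have h2 : ((q : ℝ) • P)⁻¹ᵀ *ᵥ v = (q : ℝ)⁻¹ • (P⁻¹ᵀ *ᵥ v) := by
      have : ((q : ℝ) • P)⁻¹ = (q : ℝ)⁻¹ • P⁻¹ := by
        apply Matrix.inv_eq_right_inv
        rw [Matrix.smul_mul, Matrix.mul_smul, Matrix.mul_nonsing_inv _ (isUnit_iff_ne_zero.2 hS.hP), smul_smul, mul_inv_cancel₀ hq.ne', one_smul]
      rw [this, Matrix.transpose_smul, Matrix.smul_mulVec]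
    rw [h2, Finset.sum_div]
    refine Finset.sum_congr rfl fun i _ => ?_
    rw [zw_norm s hS.hs Z θ hZ, zw_re, div_pow, Real.sq_sqrt hE0.le]
    simp only [Pi.smul_apply, smul_eq_mul]
    field_simp

end QH
end

open scoped BigOperators
open Finset Filter Topology Matrix
noncomputable section
namespace QH
open MeasureTheory
variable {ι : Type*} [Fintype ι] [DecidableEq ι]
variable {P : Matrix ι ι ℝ} {s γ : ι → ℝ} {C : Matrix ι ι ℤ} {l : ι → ℤ} {k : ℤ}

lemma zw_norm_eq (Z β : ℝ) (y : ι → ℝ) : ‖cg P (zw s Z β) y‖ = Real.exp (-Real.pi * ∑ i, (1 / Z ^ 2) * (P *ᵥ y) i ^ 2) := by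
  rw [cg_norm]; simp_rw [zw_re]

lemma Theta_continuous (hS : Setup P s γ C l k) {Z : ℝ} (hZ : 0 < Z) : Continuous (Theta P s γ Z) := by
  refine continuous_tsum (u := fun c : ι → ℤ => Real.exp (-Real.pi * ∑ i, (1 / Z ^ 2) * (P *ᵥ (fun i => c i + γ i)) i ^ 2)) (fun c => ?_) ?_ fun c β => ?_
  · unfold cg zw
    fun_prop
  · exact summable_gauss P hS.hP (fun _ => 1 / Z ^ 2) (fun i => by positivity) γ
  · rw [zw_norm_eq]

lemma Theta_term (hS : Setup P s γ C l k) (Z β : ℝ) (c : ι → ℤ) :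
    cg P (zw s Z β) (fun i => c i + γ i) =
     Complex.exp (2 * Real.pi * Complex.I * (β * (qpoly C l k c : ℤ))) *
      (Real.exp (-Real.pi * ∑ i, (1 / Z ^ 2) * (P *ᵥ (fun i => c i + γ i)) i ^ 2) : ℝ) := by
  have := cg_zw P s Z β 0 (fun i => c i + γ i)
  rw [add_zero] at this
  rw [this, ← hS.hQ]
  congr 1
  rw [cg]
  simp [zw]

lemma Theta_periodic (hS : Setup P s γ C l k) (Z β : ℝ) : Theta P s γ Z (β + 1) = Theta P s γ Z β := by
  unfold Theta
  refine tsum_congr fun c => ?_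
  rw [Theta_term hS, Theta_term hS]
  congr 1
  rw [Complex.exp_eq_exp_iff_exists_int]
  refine ⟨qpoly C l k c, ?_⟩
  push_cast; ring

lemma int_e (j : ℤ) : ∫ β in (0:ℝ)..1, Complex.exp (2 * Real.pi * Complex.I * (β * (j : ℂ))) = if j = 0 then 1 else 0 := by
  split_ifs with h
  · subst h; simp
  · have h0 : (2 * Real.pi * Complex.I * (j : ℂ)) ≠ 0 := by
      have : (j : ℂ) ≠ 0 := by exact_mod_cast h
      have : (Real.pi : ℂ) ≠ 0 := by exact_mod_cast Real.pi_ne_zero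
      simp [*]
    have := integral_exp_mul_complex (a := 0) (b := 1) h0
    have e : ∀ β : ℝ, Complex.exp (2 * Real.pi * Complex.I * (β * (j : ℂ))) = Complex.exp ((2 * Real.pi * Complex.I * (j : ℂ)) * β) := by
      intro β; congr 1; ring
    simp_rw [e]
    rw [this]
    have h1 : Complex.exp (2 * Real.pi * Complex.I * j) = 1 := by
      rw [Complex.exp_eq_one_iff]; exact ⟨j, by ring⟩
    simp [h1]

theorem count_le (hS : Setup P s γ C l k) {Z : ℝ} (hZ : 0 < Z) (S : Finset (ι → ℤ)) (K : ℝ)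
    (h : ∀ c ∈ S, qpoly C l k c = 0 ∧ ∑ i, (P *ᵥ (fun i => c i + γ i)) i ^ 2 ≤ K * Z ^ 2) :
    (S.card : ℝ) ≤ Real.exp (Real.pi * K) * ‖∫ β in (0:ℝ)..1, Theta P s γ Z β‖ := by
  set w : (ι → ℤ) → ℝ := fun c => Real.exp (-Real.pi * ∑ i, (1 / Z ^ 2) * (P *ᵥ (fun i => c i + γ i)) i ^ 2) with hw
  have hws : Summable w := summable_gauss P hS.hP (fun _ => 1 / Z ^ 2) (fun i => by positivity) γ
  have hI : HasSum (fun c => ((if qpoly C l k c = 0 then w c else 0 : ℝ) : ℂ)) (∫ β in (0:ℝ)..1, Theta P s γ Z β) := by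
    have := intervalIntegral.hasSum_integral_of_dominated_convergence (μ := volume) (a := 0) (b := 1)
      (F := fun (c : ι → ℤ) (β : ℝ) => cg P (zw s Z β) (fun i => c i + γ i)) (f := Theta P s γ Z)
      (fun c _ => w c) (fun c => ?_) (fun c => ?_) ?_ ?_ ?_
    · refine Eq.mp (congrArg (fun f => HasSum f (∫ β in (0:ℝ)..1, Theta P s γ Z β)) (funext fun c => ?_)) this
      have hT : (fun β : ℝ => cg P (zw s Z β) (fun i => c i + γ i)) = fun β : ℝ => Complex.exp (2 * Real.pi * Complex.I * (β * (qpoly C l k c : ℤ))) *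
          ((w c : ℝ) : ℂ) := funext fun β => Theta_term hS Z β c
      rw [hT]
      rw [intervalIntegral.integral_mul_const, int_e]
      split_ifs <;> simp
    · apply Continuous.aestronglyMeasurable
      unfold cg zw; fun_prop
    · refine Eventually.of_forall fun β _ => ?_
      rw [zw_norm_eq]
    · exact Eventually.of_forall fun β _ => hws
    · simp
    · exact Eventually.of_forall fun β _ => (Theta_summable hS hZ β).hasSum
  have hR : Summable fun c => (if qpoly C l k c = 0 then w c else 0 : ℝ) := by
    refine Summable.of_nonneg_of_le (fun c => ?_) (fun c => ?_) hws
    · split_ifs <;> simp [hw, Real.exp_nonneg]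
    · split_ifs <;> simp [hw, Real.exp_nonneg]
  have e1 : (∫ β in (0:ℝ)..1, Theta P s γ Z β) = ((∑' c, (if qpoly C l k c = 0 then w c else 0 : ℝ) : ℝ) : ℂ) := by
    rw [Complex.ofReal_tsum]; exact hI.tsum_eq.symm
  rw [e1, Complex.norm_real, Real.norm_eq_abs]
  have e2 : (S.card : ℝ) * Real.exp (-(Real.pi * K)) ≤ ∑' c, (if qpoly C l k c = 0 then w c else 0 : ℝ) := by
    calc (S.card : ℝ) * Real.exp (-(Real.pi * K)) = ∑ c ∈ S, Real.exp (-(Real.pi * K)) := by simp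
      _ ≤ ∑ c ∈ S, (if qpoly C l k c = 0 then w c else 0 : ℝ) := by
          refine Finset.sum_le_sum fun c hc => ?_
          obtain ⟨h1, h2⟩ := h c hc
          rw [if_pos h1]
          apply Real.exp_le_exp.2
          rw [← Finset.mul_sum]
          have : 1 / Z ^ 2 * ∑ i, (P *ᵥ (fun i => c i + γ i)) i ^ 2 ≤ K := by
            rw [one_div, inv_mul_le_iff₀ (by positivity)]; linarith
          nlinarith [Real.pi_pos]
      _ ≤ _ := hR.sum_le_tsum _ fun c _ => by split_ifs <;> simp [hw, Real.exp_nonneg]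
  have e3 := e2.trans (le_abs_self _)
  rw [Real.exp_neg, ← div_eq_mul_inv, div_le_iff₀ (Real.exp_pos _)] at e3
  linarith
end QH
end

open scoped BigOperators
open Finset Filter Topology Matrix
noncomputable section
namespace QH

/-- Kloosterman's condition, positive side -/
def condP (Q q a : ℤ) (θ : ℝ) : Prop :=
  0 < θ ∧ ∃ r : ℤ, Q - q < r ∧ r ≤ Q ∧ q ∣ a * r + 1 ∧ ((q : ℝ) + r) * (q * θ) < 1

/-- Kloosterman's condition -/
def cond (Q q a : ℤ) (θ : ℝ) : Prop := condP Q q a θ ∨ condP Q q (-a) (-θ)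

lemma condP_min {Q q a : ℤ} {β : ℝ} (hq : 1 ≤ q) (hqQ : q ≤ Q) (h : condP Q q a (β - a / q))
    (q' a' : ℤ) (hq' : 1 ≤ q') (hqQ' : q' ≤ Q) (hne : ¬ (q' = q ∧ a' = a)) :
    |(q:ℝ) * β - a| < |(q':ℝ) * β - a'| := by
  obtain ⟨h0, r, hr1, hr2, ⟨a2, ha2⟩, hlt⟩ := h
  have hq0 : (0:ℝ) < q := by exact_mod_cast (by lia : (0:ℤ) < q)
  have ht : (q:ℝ) * (β - a / q) = q * β - a := by field_simp
  rw [ht] at hlt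
  set t := (q:ℝ) * β - a with htd
  have ht0 : 0 < t := by rw [← ht]; positivity
  set t2 := (a2:ℝ) - r * β with ht2
  have hrel : (q:ℝ) * t2 + r * t = 1 := by
    have : (a:ℝ) * r + 1 = q * a2 := by exact_mod_cast ha2
    rw [htd, ht2]; linarith
  have htt : t < t2 := by
    have : (q:ℝ) * t < q * t2 := by linarith
    exact lt_of_mul_lt_mul_left this hq0.le
  -- coordinates
  set m := a2 * q' - r * a' with hm
  set k := q * a' - a * q' with hk
  have e1 : q' = m * q + k * r := by rw [hm, hk]; linear_combination q' * ha2
  have e2 : a' = m * a + k * a2 := by rw [hm, hk]; linear_combination a' * ha2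
  have e3 : (q':ℝ) * β - a' = m * t - k * t2 := by
    rw [e1, e2, htd, ht2]; push_cast; ring
  rw [e3, abs_of_pos ht0]
  rcases lt_trichotomy k 0 with hk0 | hk0 | hk0
  · -- k<0
    have hm0 : 0 ≤ m := by
      by_contra hm0
      push Not at hm0
      have : m * q < 0 := mul_neg_of_neg_of_pos hm0 (by lia)
      have : k * r ≤ 0 := mul_nonpos_of_nonpos_of_nonneg hk0.le (by lia)
      lia
    have h1 : (0:ℝ) ≤ m := by exact_mod_cast hm0
    have h2 : (k:ℝ) ≤ -1 := by exact_mod_cast (by lia : k ≤ -1)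
    refine lt_of_lt_of_le ?_ (le_abs_self _)
    nlinarith
  · have hq2 : q' = m * q := by rw [e1, hk0]; ring
    have hm1 : 1 ≤ m := by
      by_contra hm1
      push Not at hm1
      have : m * q ≤ 0 := mul_nonpos_of_nonpos_of_nonneg (by lia) (by lia)
      lia
    have hm2 : m ≠ 1 := by
      intro h1
      apply hne
      constructor
      · rw [hq2, h1, one_mul]
      · rw [e2, hk0, h1]; ring
    have h1 : (2:ℝ) ≤ m := by exact_mod_cast (by lia : 2 ≤ m)
    refine lt_of_lt_of_le ?_ (le_abs_self _)
    rw [hk0]; push_cast; nlinarith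
  · have hm0 : m ≤ 0 := by
      by_contra hm0
      push Not at hm0
      have : q ≤ m * q := by nlinarith
      have : r ≤ k * r := by nlinarith
      lia
    have h1 : (m:ℝ) ≤ 0 := by exact_mod_cast hm0
    have h2 : (1:ℝ) ≤ k := by exact_mod_cast (by lia : 1 ≤ k)
    refine lt_of_lt_of_le ?_ (neg_le_abs _)
    nlinarith

lemma cond_min {Q q a : ℤ} {β : ℝ} (hq : 1 ≤ q) (hqQ : q ≤ Q) (h : cond Q q a (β - a / q))
    (q' a' : ℤ) (hq' : 1 ≤ q') (hqQ' : q' ≤ Q) (hne : ¬ (q' = q ∧ a' = a)) :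
    |(q:ℝ) * β - a| < |(q':ℝ) * β - a'| := by
  rcases h with h | h
  · exact condP_min hq hqQ h q' a' hq' hqQ' hne
  · have : -(β - a / q) = -β - ((-a : ℤ) : ℝ) / q := by push_cast; ring
    rw [this] at h
    have := condP_min hq hqQ h q' (-a') hq' hqQ' (by
      rintro ⟨h1, h2⟩; exact hne ⟨h1, by lia⟩)
    push_cast at this
    rw [← abs_neg, ← abs_neg ((q':ℝ) * β - a')]
    convert this using 2 <;> ring

lemma condP_exists {Q q a : ℤ} {β : ℝ} (hβ : Irrational β) (hq : 1 ≤ q) (hqQ : q ≤ Q)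
    (hmin : ∀ q' a' : ℤ, 1 ≤ q' → q' ≤ Q → |(q:ℝ) * β - a| ≤ |(q':ℝ) * β - a'|)
    (hpos : 0 < (q:ℝ) * β - a) : condP Q q a (β - a / q) := by
  have hq0 : (0:ℝ) < q := by exact_mod_cast (by lia : (0:ℤ) < q)
  have ht : (q:ℝ) * (β - a / q) = q * β - a := by field_simp
  have hcop : IsCoprime a q := by
    rw [Int.isCoprime_iff_gcd_eq_one]
    by_contra hg
    have hg0 : 0 < Int.gcd a q := Int.gcd_pos_of_ne_zero_right _ (by lia)
    obtain ⟨a1, ha1⟩ := Int.gcd_dvd_left a q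
    obtain ⟨q1, hq1⟩ := Int.gcd_dvd_right a q
    set g := Int.gcd a q with hgd
    have hg2 : (2:ℤ) ≤ g := by lia
    have hq1p : 1 ≤ q1 := by
      by_contra hh
      have : (g:ℤ) * q1 ≤ 0 := mul_nonpos_of_nonneg_of_nonpos (by lia) (by lia)
      lia
    have hq1Q : q1 ≤ Q := by nlinarith
    have := hmin q1 a1 hq1p hq1Q
    rw [abs_of_pos hpos] at this
    have e : (q:ℝ) * β - a = g * (q1 * β - a1) := by
      have h1 : (a:ℝ) = g * a1 := by exact_mod_cast ha1
      have h2 : (q:ℝ) = g * q1 := by exact_mod_cast hq1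
      rw [h1, h2]; ring
    rw [e] at this hpos
    have hg2' : (2:ℝ) ≤ g := by exact_mod_cast hg2
    have hp : 0 < (q1:ℝ) * β - a1 := by
      by_contra hh
      push Not at hh
      nlinarith
    rw [abs_of_pos hp] at this
    nlinarith
  obtain ⟨u, v, huv⟩ := hcop
  -- r ≡ -u mod q in (Q-q, Q]
  set r := Q - (Q + u) % q with hr
  have hmod := Int.emod_nonneg (Q + u) (by lia : q ≠ 0)
  have hmod2 := Int.emod_lt_of_pos (Q + u) (by lia : 0 < q)
  have hdvd : q ∣ a * r + 1 := by
    have h1 := Int.emod_add_mul_ediv (Q + u) q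
    have h2 : r = -u + q * ((Q + u) / q) := by rw [hr]; linarith
    refine ⟨a * ((Q + u) / q) + v, ?_⟩
    rw [h2]; linear_combination -huv
  obtain ⟨a2, ha2⟩ := hdvd
  set t := (q:ℝ) * β - a with htd
  set t2 := (a2:ℝ) - r * β with ht2
  have hrel : (q:ℝ) * t2 + r * t = 1 := by
    have : (a:ℝ) * r + 1 = q * a2 := by exact_mod_cast ha2
    rw [htd, ht2]; linarith
  have hr1 : 1 ≤ r := by lia
  have hrQ : r ≤ Q := by lia
  have htle : t * (Q + 1) ≤ 1 := by
    obtain ⟨j, k, hk0, hkn, hjk⟩ := Real.exists_int_int_abs_mul_sub_le β (n := Q.toNat) (by lia)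
    have := hmin k j (by lia) (by lia)
    rw [abs_of_pos hpos] at this
    have h2 := this.trans hjk
    have hQ : ((Q.toNat : ℕ) : ℝ) = Q := by
      have : ((Q.toNat : ℕ) : ℤ) = Q := Int.toNat_of_nonneg (by lia)
      exact_mod_cast this
    rw [hQ, le_div_iff₀ (by have : (1:ℝ) ≤ Q := by exact_mod_cast (by lia : 1 ≤ Q)
                            linarith)] at h2
    exact h2
  have hrR : (r:ℝ) ≤ Q := by exact_mod_cast hrQ
  have ht2pos : 0 < t2 := by
    by_contra hh
    push Not at hh
    nlinarith
  have htt : t ≤ t2 := by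
    have := hmin r a2 hr1 hrQ
    rw [abs_of_pos hpos] at this
    rwa [show (r:ℝ) * β - a2 = - t2 by rw [ht2]; ring, abs_neg, abs_of_pos ht2pos] at this
  have htne : t ≠ t2 := by
    intro hh
    rw [htd, ht2] at hh
    have hqr : ((q + r : ℤ) : ℝ) * β = ((a + a2 : ℤ) : ℝ) := by push_cast; linarith
    have hne : q + r ≠ 0 := by lia
    have := hβ.intCast_mul hne
    rw [hqr] at this
    exact (Int.not_irrational _) this
  refine ⟨?_, r, by lia, hrQ, ⟨a2, ha2⟩, ?_⟩
  · have : 0 < (q:ℝ) * (β - a / q) := by rw [ht]; exact hpos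
    exact pos_of_mul_pos_right this hq0.le
  · rw [ht]
    have : t < t2 := lt_of_le_of_ne htt htne
    nlinarith

lemma cond_exists {Q : ℤ} (hQ : 1 ≤ Q) {β : ℝ} (hβ : Irrational β) :
    ∃ q a : ℤ, 1 ≤ q ∧ q ≤ Q ∧ cond Q q a (β - a / q) := by
  -- minimiser
  obtain ⟨q, hqm, hqmin⟩ := Finset.exists_min_image (Finset.Icc 1 Q) (fun q : ℤ => |(q:ℝ) * β - round ((q:ℝ) * β)|) ⟨1, by simp [hQ]⟩
  rw [Finset.mem_Icc] at hqm
  have hmin : ∀ q' a' : ℤ, 1 ≤ q' → q' ≤ Q → |(q:ℝ) * β - round ((q:ℝ) * β)| ≤ |(q':ℝ) * β - a'| := by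
    intro q' a' h1 h2
    exact (hqmin q' (by simp [h1, h2])).trans (round_le _ _)
  refine ⟨q, round ((q:ℝ) * β), hqm.1, hqm.2, ?_⟩
  set a := round ((q:ℝ) * β) with ha
  have hne : (q:ℝ) * β - a ≠ 0 := by
    intro hh
    have := hβ.intCast_mul (by lia : q ≠ 0)
    rw [sub_eq_zero.1 hh] at this
    exact (Int.not_irrational _) this
  rcases lt_or_gt_of_ne hne with h | h
  · right
    have := condP_exists (Q := Q) (q := q) (a := -a) (β := -β) hβ.neg hqm.1 hqm.2 (by
      intro q' a' h1 h2
      have := hmin q' (-a') h1 h2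
      rw [← abs_neg, ← abs_neg ((q':ℝ) * β - _)] at this
      push_cast at this ⊢
      convert this using 2 <;> ring) (by push_cast; linarith)
    convert this using 1
    push_cast; ring
  · left
    exact condP_exists hβ hqm.1 hqm.2 hmin h

lemma cond_lt {Q q a : ℤ} {θ : ℝ} (hq : 1 ≤ q) (h : cond Q q a θ) : |θ| * (q * Q) < 1 := by
  have key : ∀ a θ, condP Q q a θ → |θ| * (q * Q) < 1 := by
    intro a θ ⟨h0, r, h1, h2, _, h3⟩
    rw [abs_of_pos h0]
    have hq0 : (0:ℝ) < q := by exact_mod_cast (by lia : (0:ℤ) < q)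
    have : (Q:ℝ) ≤ q + r := by exact_mod_cast (by lia : Q ≤ q + r)
    have h4 : (0:ℝ) < q * θ := by positivity
    nlinarith
  rcases h with h | h
  · exact key _ _ h
  · have := key _ _ h
    rwa [abs_neg] at this

lemma cond_add {Q q a n : ℤ} {θ : ℝ} : cond Q q (a + n * q) θ ↔ cond Q q a θ := by
  have key : ∀ a n θ, condP Q q (a + n * q) θ ↔ condP Q q a θ := by
    intro a n θ
    unfold condP
    have : ∀ r, q ∣ (a + n * q) * r + 1 ↔ q ∣ a * r + 1 := by
      intro r
      rw [show (a + n * q) * r + 1 = a * r + 1 + q * (n * r) by ring]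
      exact (Int.dvd_add_left (Dvd.intro _ rfl))
    simp only [this]
  unfold cond
  rw [key, show -(a + n * q) = -a + (-n) * q by ring, key]

lemma cond_meas (Q q a : ℤ) : MeasurableSet {θ : ℝ | cond Q q a θ} := by
  have key : ∀ a, IsOpen {θ : ℝ | condP Q q a θ} := by
    intro a
    have : {θ : ℝ | condP Q q a θ} = ⋃ r : {r : ℤ // Q - q < r ∧ r ≤ Q ∧ q ∣ a * r + 1}, {θ : ℝ | 0 < θ ∧ ((q : ℝ) + r) * (q * θ) < 1} := by
      ext θ
      simp only [Set.mem_setOf_eq, Set.mem_iUnion, condP]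
      constructor
      · rintro ⟨h0, r, h1, h2, h3, h4⟩
        exact ⟨⟨r, h1, h2, h3⟩, h0, h4⟩
      · rintro ⟨⟨r, h1, h2, h3⟩, h0, h4⟩
        exact ⟨h0, r, h1, h2, h3, h4⟩
    rw [this]
    refine isOpen_iUnion fun r => ?_
    have h1 : IsOpen {θ : ℝ | 0 < θ} := isOpen_lt continuous_const continuous_id
    have h2 : IsOpen {θ : ℝ | ((q : ℝ) + r.1) * (q * θ) < 1} := isOpen_lt (by fun_prop) continuous_const
    exact h1.inter h2
  have : {θ : ℝ | cond Q q a θ} = {θ : ℝ | condP Q q a θ} ∪ (fun θ => -θ) ⁻¹' {θ : ℝ | condP Q q (-a) θ} := by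
    ext θ; rfl
  rw [this]
  exact ((key a).union ((key (-a)).preimage continuous_neg)).measurableSet
end QH
end

open scoped BigOperators
open Finset Filter Topology Matrix
noncomputable section
namespace QH
open MeasureTheory

lemma cond_integrable (S : ℝ → ℂ) (hc : Continuous S) (Q q a : ℤ) (hQ : 1 ≤ Q) (hq : 1 ≤ q) (y : ℝ) :
    Integrable ({θ : ℝ | cond Q q a θ}.indicator (fun θ => S (y + θ))) := by
  rw [integrable_indicator_iff (cond_meas _ _ _)]
  have : {θ : ℝ | cond Q q a θ} ⊆ Set.Icc (-1) 1 := by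
    intro θ h
    have h1 := cond_lt hq h
    have h2 : (1:ℝ) ≤ q * Q := by exact_mod_cast (by nlinarith : (1:ℤ) ≤ q * Q)
    have h3 : |θ| ≤ 1 := by nlinarith [abs_nonneg θ]
    exact abs_le.1 h3
  refine IntegrableOn.mono_set ?_ this
  exact (Continuous.continuousOn (by fun_prop)).integrableOn_Icc

lemma farey_one (S : ℝ → ℂ) (hc : Continuous S) (hp : ∀ β, S (β + 1) = S β) (Q q : ℤ) (b : ℤ) (hQ : 1 ≤ Q) (hq : 1 ≤ q)
    (hb0 : 0 ≤ b) (hb : b < q) :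
    ∫ θ, {θ : ℝ | cond Q q b θ}.indicator (fun θ => S (b / q + θ)) θ =
      ∑ n ∈ Finset.Icc (-2 : ℤ) 2, ∫ x in (0:ℝ)..1, {θ : ℝ | cond Q q b θ}.indicator (fun _ => S x) (x + n - b / q) := by
  have hpn : ∀ (n : ℤ) x, S (x + n) = S x := by
    intro n x
    have : Function.Periodic S 1 := hp
    simpa using this.int_mul n x
  have hq0 : (0:ℝ) < q := by exact_mod_cast (by lia : (0:ℤ) < q)
  have hi := cond_integrable S hc Q q b hQ hq (b / q)
  have h1 := hi.comp_sub_right ((b:ℝ) / q)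
  have h2 := h1.hasSum_intervalIntegral_comp_add_int
  rw [integral_sub_right_eq_self] at h2
  have key : ∀ (x : ℝ) (n : ℤ), {θ : ℝ | cond Q q b θ}.indicator (fun θ => S (b / q + θ)) (x + n - b / q) =
      {θ : ℝ | cond Q q b θ}.indicator (fun _ => S x) (x + n - b / q) := by
    intro x n
    by_cases hm : (x + n - b / q) ∈ {θ : ℝ | cond Q q b θ}
    · rw [Set.indicator_of_mem hm, Set.indicator_of_mem hm, ← hpn n x]
      congr 1; ring
    · rw [Set.indicator_of_notMem hm, Set.indicator_of_notMem hm]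
  simp_rw [key] at h2
  rw [← h2.tsum_eq]
  apply tsum_eq_sum
  intro n hn
  rw [Finset.mem_Icc] at hn
  have : ∀ x ∈ Set.uIcc (0:ℝ) 1, {θ : ℝ | cond Q q b θ}.indicator (fun _ => S x) (x + n - b / q) = 0 := by
    intro x hx
    rw [Set.uIcc_of_le zero_le_one, Set.mem_Icc] at hx
    apply Set.indicator_of_notMem
    intro hm
    have h1 := cond_lt hq hm
    have h2 : (1:ℝ) ≤ q * Q := by exact_mod_cast (by nlinarith : (1:ℤ) ≤ q * Q)
    have h3 : |x + n - b / q| ≤ 1 := by nlinarith [abs_nonneg (x + n - b / q)]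
    rw [abs_le] at h3
    have h4 : (b:ℝ) / q ≤ 1 := by rw [div_le_one hq0]; exact_mod_cast hb.le
    have h5 : 0 ≤ (b:ℝ) / q := div_nonneg (by exact_mod_cast hb0) hq0.le
    apply hn
    constructor
    · have : (-2:ℝ) ≤ n := by linarith
      exact_mod_cast this
    · have : (n:ℝ) ≤ 2 := by linarith
      exact_mod_cast this
  rw [intervalIntegral.integral_congr this]
  simp

theorem farey_integral (S : ℝ → ℂ) (hc : Continuous S) (hp : ∀ β, S (β + 1) = S β) (Q : ℕ) (hQ : 1 ≤ Q) :
    ∫ β in (0:ℝ)..1, S β = ∑ q ∈ Finset.Icc 1 Q, ∑ b ∈ Finset.range q,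
      ∫ θ, {θ : ℝ | cond Q q b θ}.indicator (fun θ => S (b / q + θ)) θ := by
  have h1 : ∀ q ∈ Finset.Icc 1 Q, ∀ b ∈ Finset.range q, ∫ θ, {θ : ℝ | cond Q q b θ}.indicator (fun θ => S (b / q + θ)) θ =
      ∑ n ∈ Finset.Icc (-2 : ℤ) 2, ∫ x in (0:ℝ)..1, {θ : ℝ | cond Q q b θ}.indicator (fun _ => S x) (x + n - b / q) := by
    intro q hq b hb
    rw [Finset.mem_Icc] at hq
    rw [Finset.mem_range] at hb
    have := farey_one S hc hp Q q b (by lia) (by lia) (by lia) (by lia)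
    simpa using this
  rw [Finset.sum_congr rfl fun q hq => Finset.sum_congr rfl fun b hb => h1 q hq b hb]
  have hIntegr : ∀ q ∈ Finset.Icc 1 Q, ∀ b ∈ Finset.range q, ∀ n ∈ Finset.Icc (-2 : ℤ) 2,
      IntervalIntegrable (fun x : ℝ => {θ : ℝ | cond Q q b θ}.indicator (fun _ => S x) (x + n - b / q)) volume 0 1 := by
    intro q hq b hb n hn
    have e : (fun x : ℝ => {θ : ℝ | cond Q q b θ}.indicator (fun _ => S x) (x + n - b / q)) =
       ((fun x : ℝ => x + n - b / q) ⁻¹' {θ : ℝ | cond Q q b θ}).indicator S := by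
      funext x
      rfl
    rw [e]
    have hm : MeasurableSet ((fun x : ℝ => x + n - b / q) ⁻¹' {θ : ℝ | cond Q q b θ}) :=
      (cond_meas _ _ _).preimage (by fun_prop)
    rw [intervalIntegrable_iff_integrableOn_Ioc_of_le zero_le_one]
    exact (((hc.intervalIntegrable 0 1).1).indicator hm)
  have h2 : ∑ q ∈ Finset.Icc 1 Q, ∑ b ∈ Finset.range q, ∑ n ∈ Finset.Icc (-2 : ℤ) 2, ∫ x in (0:ℝ)..1, {θ : ℝ | cond Q q b θ}.indicator (fun _ => S x) (x + n - b / q)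
     = ∫ x in (0:ℝ)..1, ∑ q ∈ Finset.Icc 1 Q, ∑ b ∈ Finset.range q, ∑ n ∈ Finset.Icc (-2 : ℤ) 2, {θ : ℝ | cond Q q b θ}.indicator (fun _ => S x) (x + n - b / q) := by
    rw [intervalIntegral.integral_finset_sum]
    · refine Finset.sum_congr rfl fun q hq => ?_
      rw [intervalIntegral.integral_finset_sum]
      · refine Finset.sum_congr rfl fun b hb => ?_
        rw [intervalIntegral.integral_finset_sum]
        intro n hn
        exact hIntegr q hq b hb n hn
      · intro b hb
        have := IntervalIntegrable.sum (Finset.Icc (-2:ℤ) 2) (fun n hn => hIntegr q hq b hb n hn)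
        have e : (∑ n ∈ Finset.Icc (-2 : ℤ) 2, fun x : ℝ => {θ : ℝ | cond Q q b θ}.indicator (fun _ => S x) (x + n - b / q)) = fun x : ℝ => ∑ n ∈ Finset.Icc (-2 : ℤ) 2, {θ : ℝ | cond Q q b θ}.indicator (fun _ => S x) (x + n - b / q) := by
          funext x; rw [Finset.sum_apply]
        rw [e] at this
        exact this
    · intro q hq
      have := IntervalIntegrable.sum (Finset.range q) (fun b hb => IntervalIntegrable.sum (Finset.Icc (-2:ℤ) 2) (fun n hn => hIntegr q hq b hb n hn))
      have e : (∑ b ∈ Finset.range q, ∑ n ∈ Finset.Icc (-2 : ℤ) 2, fun x : ℝ => {θ : ℝ | cond Q q b θ}.indicator (fun _ => S x) (x + n - b / q)) = fun x : ℝ => ∑ b ∈ Finset.range q, ∑ n ∈ Finset.Icc (-2 : ℤ) 2, {θ : ℝ | cond Q q b θ}.indicator (fun _ => S x) (x + n - b / q) := by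
        funext x; rw [Finset.sum_apply]; exact Finset.sum_congr rfl fun b _ => by rw [Finset.sum_apply]
      rw [e] at this
      exact this
  rw [h2]
  apply intervalIntegral.integral_congr_ae
  have hirr : ∀ᵐ x : ℝ, Irrational x := by
    have := (Set.countable_range (Rat.cast : ℚ → ℝ)).ae_notMem volume
    exact this
  filter_upwards [hirr] with x hx hx01
  rw [Set.uIoc_of_le zero_le_one, Set.mem_Ioc] at hx01
  obtain ⟨q, a, hq, hqQ, hco⟩ := cond_exists (Q := Q) (by lia) hx
  have hq0 : (0:ℝ) < q := by exact_mod_cast (by lia : (0:ℤ) < q)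
  have hmem : ∀ (q b : ℕ) (n : ℤ), 1 ≤ q → ((x + n - b / q) ∈ {θ : ℝ | cond Q q b θ} ↔ cond Q q (b - n * q) (x - ((b - n * q : ℤ) : ℝ) / (q : ℤ))) := by
    intro q b n hq
    have hq0 : (q:ℝ) ≠ 0 := by positivity
    have e : x - ((b - n * q : ℤ) : ℝ) / (q : ℤ) = x + n - b / q := by push_cast; field_simp; ring
    rw [e, sub_eq_add_neg (b:ℤ), ← neg_mul, cond_add]
    rfl
  simp_rw [Finset.sum_sigma']
  symm
  set b := a % q with hb
  have hb0 : 0 ≤ b := Int.emod_nonneg _ (by lia)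
  have hbq : b < q := Int.emod_lt_of_pos _ (by lia)
  set n := -(a / q) with hn
  have hbn : b - n * q = a := by
    have := Int.emod_add_mul_ediv a q
    rw [hb, hn]; linarith
  have hqn : ((q.toNat : ℕ) : ℤ) = q := Int.toNat_of_nonneg (by lia)
  have hbnn : ((b.toNat : ℕ) : ℤ) = b := Int.toNat_of_nonneg hb0
  rw [Finset.sum_eq_single (⟨q.toNat, b.toNat, n⟩ : (_ : ℕ) × (_ : ℕ) × ℤ)]
  · rw [Set.indicator_of_mem]
    rw [hmem _ _ _ (by lia)]
    rw [hqn, hbnn, hbn]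
    exact hco
  · rintro ⟨q', b', n'⟩ hm hne
    simp only [Finset.mem_sigma, Finset.mem_Icc, Finset.mem_range] at hm
    apply Set.indicator_of_notMem
    simp only
    rw [hmem _ _ _ hm.1.1]
    intro hco'
    have hkey : (q':ℤ) = q ∧ (b' - n' * q' : ℤ) = a := by
      by_contra hcon
      have l1 := cond_min hq hqQ hco q' (b' - n' * q') (by lia) (by lia) hcon
      have l2 := cond_min (by lia) (by lia) hco' q a hq hqQ (by rintro ⟨c1, c2⟩; exact hcon ⟨c1.symm, c2.symm⟩)
      push_cast at l1 l2
      exact lt_asymm l1 l2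
    obtain ⟨k1, k2⟩ := hkey
    apply hne
    have hbb : (b':ℤ) = b := by
      rw [hb, ← k2, ← k1, sub_eq_add_neg, ← neg_mul, Int.add_mul_emod_self_right, Int.emod_eq_of_lt (by lia) (by lia)]
    have hnn : n' = n := by
      rw [← hbb, ← k1, ← k2] at hbn
      have : (n - n') * (q':ℤ) = 0 := by linarith
      rcases mul_eq_zero.1 this with h | h
      · lia
      · lia
    have g1 : q' = q.toNat := by lia
    have g2 : b' = b.toNat := by lia
    rw [g1, g2, hnn]
  · intro hcon
    exfalso
    apply hcon
    simp only [Finset.mem_sigma, Finset.mem_Icc, Finset.mem_range]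
    refine ⟨⟨by lia, by lia⟩, by lia, ?_⟩
    have h1 := cond_lt hq hco
    have h2 : (1:ℝ) ≤ q * (Q:ℤ) := by
      have : (1:ℤ) ≤ q * Q := by nlinarith
      exact_mod_cast this
    have h3 : |x - a / q| < 1 := by nlinarith [abs_nonneg (x - a / q)]
    rw [abs_lt] at h3
    have h4 : (a:ℝ) < 2 * q := by
      have : (a:ℝ) / q < 2 := by linarith
      rwa [div_lt_iff₀ hq0] at this
    have h5 : -(1:ℝ) * q < a := by
      have : -1 < (a:ℝ) / q := by linarith
      rwa [lt_div_iff₀ hq0] at this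
    have h6 : a < 2 * q := by exact_mod_cast h4
    have h7 : -1 * q < a := by exact_mod_cast h5
    have h8 : a / q < 2 := Int.ediv_lt_of_lt_mul (by lia) h6
    have h9 : -1 ≤ a / q := Int.le_ediv_of_mul_le (by lia) h7.le
    constructor <;> lia
end QH
end

open scoped BigOperators
open Finset Filter Topology Matrix
noncomputable section
namespace QH
variable {ι : Type*} [Fintype ι] [DecidableEq ι]

lemma qpoly_add {A : Type*} [CommRing A] (C : Matrix ι ι ℤ) (l : ι → ℤ) (k : ℤ) (x h : ι → A) :
    qpoly C l k (x + h) = qpoly C l k x + ∑ i, (∑ j, ((C i j + C j i : ℤ) : A) * h j) * x i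
      + (∑ i, ∑ j, (C i j : A) * h i * h j + ∑ i, (l i : A) * h i) := by
  simp only [qpoly, Pi.add_apply]
  have e1 : ∑ i, ∑ j, (C i j : A) * (x i + h i) * (x j + h j) = ∑ i, ∑ j, (C i j : A) * x i * x j
     + (∑ i, ∑ j, (C i j : A) * h j * x i + ∑ i, ∑ j, (C i j : A) * h i * x j) + ∑ i, ∑ j, (C i j : A) * h i * h j := by
    simp only [← Finset.sum_add_distrib]
    refine Finset.sum_congr rfl fun i _ => Finset.sum_congr rfl fun j _ => ?_
    ring
  have e2 : ∑ i, (∑ j, ((C i j + C j i : ℤ) : A) * h j) * x i =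
      (∑ i, ∑ j, (C i j : A) * h j * x i + ∑ i, ∑ j, (C i j : A) * h i * x j) := by
    rw [Finset.sum_comm (f := fun i j => (C i j : A) * h i * x j), ← Finset.sum_add_distrib]
    refine Finset.sum_congr rfl fun i _ => ?_
    rw [← Finset.sum_add_distrib, Finset.sum_mul]
    refine Finset.sum_congr rfl fun j _ => ?_
    push_cast; ring
  have e3 : ∑ i, (l i : A) * (x i + h i) = ∑ i, (l i : A) * x i + ∑ i, (l i : A) * h i := by
    simp only [← Finset.sum_add_distrib, mul_add]
  rw [e1, e2, e3]; ring

/-- kernel of the symmetrised matrix -/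
def kerS (A : Type*) [CommRing A] [Fintype A] (N : Matrix ι ι ℤ) : Finset (ι → A) :=
  open Classical in Finset.univ.filter fun h => ∀ i, ∑ j, (N i j : A) * h j = 0

lemma sum_char_pi {A : Type*} [CommRing A] [Fintype A] (ψ : AddChar A ℂ) (hψ : ψ.IsPrimitive) (w : ι → A) :
    ∑ x : ι → A, ψ (∑ i, w i * x i) = (open Classical in if w = 0 then (Fintype.card A : ℂ) ^ Fintype.card ι else 0) := by
  classical
  have h1 : ∀ x : ι → A, ψ (∑ i, w i * x i) = ∏ i, ψ (w i * x i) := by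
    intro x
    induction (Finset.univ : Finset ι) using Finset.induction_on with
    | empty => simp
    | insert i s hi ih => rw [Finset.sum_insert hi, Finset.prod_insert hi, AddChar.map_add_eq_mul, ih]
  simp_rw [h1]
  rw [← Fintype.prod_sum (fun i (y : A) => ψ (w i * y))]
  have h2 : ∀ i, ∑ y, ψ (w i * y) = if w i = 0 then (Fintype.card A : ℂ) else 0 := by
    intro i
    have := AddChar.sum_mulShift (w i) hψ
    simp_rw [mul_comm (w i)]
    rw [this]; push_cast; rfl
  simp_rw [h2]
  split_ifs with h
  · subst h; simp
  · obtain ⟨i, hi⟩ := Function.ne_iff.1 h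
    exact Finset.prod_eq_zero (Finset.mem_univ i) (if_neg hi)

theorem GS_sq_le {A : Type*} [CommRing A] [Fintype A] (ψ : AddChar A ℂ) (hψ : ψ.IsPrimitive)
    (C : Matrix ι ι ℤ) (l : ι → ℤ) (k : ℤ) (a : Aˣ) (v : ι → A) :
    ‖GS ψ C l k (a : A) v‖ ^ 2 ≤ (Fintype.card A : ℝ) ^ Fintype.card ι * (kerS A (C + Cᵀ)).card := by
  classical
  have hn : ∀ y, ‖ψ y‖ = 1 := fun y => AddChar.norm_apply ψ y
  have hinv : ∀ y, (starRingEnd ℂ) (ψ y) = ψ (-y) := by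
    intro y
    rw [AddChar.map_neg_eq_conj]
  have key : ((‖GS ψ C l k (a : A) v‖ ^ 2 : ℝ) : ℂ) = ∑ h : ι → A,
      ψ (a * (∑ i, ∑ j, (C i j : A) * h i * h j + ∑ i, (l i : A) * h i) + ∑ i, v i * h i) *
       ∑ x : ι → A, ψ (∑ i, (a * ∑ j, ((C i j + C j i : ℤ) : A) * h j) * x i) := by
    rw [Complex.ofReal_pow, ← Complex.mul_conj']
    conv_lhs => rw [GS, map_sum, Finset.sum_mul_sum, Finset.sum_comm]
    have : ∀ x : ι → A, ∑ y : ι → A, ψ (a * qpoly C l k y + ∑ i, v i * y i) * (starRingEnd ℂ) (ψ (a * qpoly C l k x + ∑ i, v i * x i))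
      = ∑ h : ι → A, ψ (a * qpoly C l k (x + h) + ∑ i, v i * (x + h) i) * (starRingEnd ℂ) (ψ (a * qpoly C l k x + ∑ i, v i * x i)) := by
      intro x
      exact (Equiv.sum_comp (Equiv.addLeft x) (fun y => ψ (a * qpoly C l k y + ∑ i, v i * y i) * (starRingEnd ℂ) (ψ (a * qpoly C l k x + ∑ i, v i * x i)))).symm
    rw [Finset.sum_congr rfl fun x _ => this x, Finset.sum_comm]
    refine Finset.sum_congr rfl fun h _ => ?_
    rw [Finset.mul_sum]
    refine Finset.sum_congr rfl fun x _ => ?_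
    rw [hinv, ← AddChar.map_add_eq_mul, ← AddChar.map_add_eq_mul, qpoly_add]
    congr 1
    have e : ∑ i, v i * (x + h) i = ∑ i, v i * x i + ∑ i, v i * h i := by
      simp [mul_add, Finset.sum_add_distrib]
    have e2 : ∑ i, (a * ∑ j, ((C i j + C j i : ℤ) : A) * h j) * x i = a * ∑ i, (∑ j, ((C i j + C j i : ℤ) : A) * h j) * x i := by
      rw [Finset.mul_sum]
      exact Finset.sum_congr rfl fun i _ => by ring
    rw [e, e2]; ring
  have h2 : ‖GS ψ C l k (a : A) v‖ ^ 2 = ‖((‖GS ψ C l k (a : A) v‖ ^ 2 : ℝ) : ℂ)‖ := by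
    rw [Complex.norm_real, Real.norm_of_nonneg (by positivity)]
  rw [h2, key]
  refine (norm_sum_le _ _).trans ?_
  have h3 : ∀ h : ι → A, ‖ψ (a * (∑ i, ∑ j, (C i j : A) * h i * h j + ∑ i, (l i : A) * h i) + ∑ i, v i * h i) *
       ∑ x : ι → A, ψ (∑ i, (a * ∑ j, ((C i j + C j i : ℤ) : A) * h j) * x i)‖ = if h ∈ kerS A (C + Cᵀ) then (Fintype.card A : ℝ) ^ Fintype.card ι else 0 := by
    intro h
    rw [norm_mul, hn, one_mul, sum_char_pi ψ hψ (fun i => a * ∑ j, ((C i j + C j i : ℤ) : A) * h j)]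
    have : ((fun i => (a:A) * ∑ j, ((C i j + C j i : ℤ) : A) * h j) = 0) ↔ h ∈ kerS A (C + Cᵀ) := by
      simp [kerS, funext_iff]
    simp only [this]
    split_ifs <;> simp
  simp_rw [h3]
  rw [← Finset.sum_filter, Finset.sum_const, nsmul_eq_mul, mul_comm, Finset.filter_mem_eq_inter, Finset.univ_inter]

lemma GS_translate {A : Type*} [CommRing A] [Fintype A] (ψ : AddChar A ℂ)
    (C : Matrix ι ι ℤ) (l : ι → ℤ) (k : ℤ) (a : A) (v h : ι → A) (hh : ∀ i, ∑ j, ((C i j + C j i : ℤ) : A) * h j = 0) :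
    GS ψ C l k a v = ψ (a * (∑ i, ∑ j, (C i j : A) * h i * h j + ∑ i, (l i : A) * h i) + ∑ i, v i * h i) * GS ψ C l k a v := by
  conv_lhs => rw [GS, ← Equiv.sum_comp (Equiv.addRight h)]
  rw [GS, Finset.mul_sum]
  refine Finset.sum_congr rfl fun x _ => ?_
  rw [← AddChar.map_add_eq_mul, Equiv.coe_addRight, qpoly_add]
  have e : ∑ i, v i * (x + h) i = ∑ i, v i * x i + ∑ i, v i * h i := by
      simp [mul_add, Finset.sum_add_distrib]
  simp only [hh, zero_mul, Finset.sum_const_zero]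
  rw [e]; congr 1; ring
end QH
end

open scoped BigOperators
open Finset Filter Topology Matrix
noncomputable section
namespace QH
variable {ι : Type*} [Fintype ι] [DecidableEq ι]

/-- arithmetic data of the reduced quadratic polynomial -/
structure Arith (C : Matrix ι ι ℤ) (l : ι → ℤ) (k : ℤ) (i0 : ι) (L : ℕ) (N' : Matrix ι ι ℤ) : Prop where
  hL : 1 ≤ L
  hN : C + Cᵀ = Matrix.diagonal (fun i => if i = i0 then (L : ℤ) else 1) * N' * Matrix.diagonal (fun i => if i = i0 then (L : ℤ) else 1)
  hdet : N'.det ≠ 0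
  hC : (L : ℤ) ∣ C i0 i0
  hl : IsCoprime (l i0) (L : ℤ)
  hgood : ∀ p : ℕ, p.Prime → ¬ (p : ℤ) ∣ 2 * N'.det * L → ∃ h : ι → ZMod p, ∀ x : ι → ZMod p,
    qpoly C l k x = ∑ i, ∑ j, (C i j : ZMod p) * (x i + h i) * (x j + h j)

lemma mem_kerS {A : Type*} [CommRing A] [Fintype A] (X : Matrix ι ι ℤ) (h : ι → A) :
    h ∈ kerS A X ↔ (X.map (Int.cast : ℤ → A)) *ᵥ h = 0 := by
  simp [kerS, funext_iff, Matrix.mulVec, dotProduct]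

lemma card_kerS_mul {A : Type*} [CommRing A] [Fintype A] (X Y : Matrix ι ι ℤ) :
    (kerS A (X * Y)).card ≤ (kerS A X).card * (kerS A Y).card := by
  classical
  rw [mul_comm]
  refine Finset.card_le_mul_card_image_of_maps_to (f := fun h => (Y.map (Int.cast : ℤ → A)) *ᵥ h) ?_ _ ?_
  · intro h hh
    rw [mem_kerS] at *
    rw [Matrix.mulVec_mulVec, ← hh]
    congr 1
    exact (Matrix.map_mul (f := Int.castRingHom A)).symm
  · intro w hw
    rcases (Finset.filter (fun h => (Y.map (Int.cast : ℤ → A)) *ᵥ h = w) (kerS A (X * Y))).eq_empty_or_nonempty with he | ⟨h0, h0m⟩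
    · rw [he]; simp
    · refine Finset.card_le_card_of_injOn (fun h => h - h0) ?_ (fun a _ b _ hab => by simpa using hab)
      intro h hh
      rw [Finset.mem_coe, Finset.mem_filter] at hh
      rw [Finset.mem_filter] at h0m
      simp only [Finset.mem_coe]
      rw [mem_kerS, Matrix.mulVec_sub, hh.2, h0m.2, sub_self]

lemma card_zmod_mul_eq_zero (q : ℕ) [NeZero q] (m : ℕ) (hm : 0 < m) :
    (Finset.univ.filter fun x : ZMod q => (m : ZMod q) * x = 0).card ≤ m := by
  have := IsAddCyclic.card_nsmul_eq_zero_le (α := ZMod q) hm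
  simpa [nsmul_eq_mul] using this

lemma card_ker_diag (q : ℕ) [NeZero q] (L : ℕ) (hL : 1 ≤ L) (i0 : ι) :
    (kerS (ZMod q) (Matrix.diagonal (fun i => if i = i0 then (L : ℤ) else 1))).card ≤ q.gcd L := by
  refine le_trans ?_ (card_zmod_mul_eq_zero q (q.gcd L) (Nat.gcd_pos_of_pos_right _ hL))
  have key : ∀ h : ι → ZMod q, h ∈ kerS (ZMod q) (Matrix.diagonal (fun i => if i = i0 then (L : ℤ) else 1)) → 
     (L : ZMod q) * h i0 = 0 ∧ ∀ i, i ≠ i0 → h i = 0 := by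
    intro h hh
    rw [mem_kerS] at hh
    rw [Matrix.diagonal_map (by simp)] at hh
    have hh2 : ∀ i, _ := fun i => congrFun hh i
    simp only [Matrix.mulVec_diagonal] at hh2
    refine ⟨by simpa using hh2 i0, fun i hi => by simpa [hi] using hh2 i⟩
  refine Finset.card_le_card_of_injOn (fun h => h i0) ?_ ?_
  · intro h hh
    have := (key h hh).1
    simp only [Finset.coe_filter, Set.mem_setOf_eq, Finset.mem_univ, true_and]
    have e : ((q.gcd L : ℕ) : ZMod q) = (L : ZMod q) * ((q.gcdB L : ℤ) : ZMod q) := by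
      have := congrArg (Int.cast : ℤ → ZMod q) (Nat.gcd_eq_gcd_ab q L)
      push_cast at this
      simpa using this
    rw [e, mul_assoc, mul_comm _ (h i0), ← mul_assoc, this, zero_mul]
  · intro h hh h' hh' e
    have k1 := key h hh
    have k2 := key h' hh'
    funext i
    by_cases hi : i = i0
    · subst hi; exact e
    · rw [k1.2 i hi, k2.2 i hi]

lemma card_ker_det (q : ℕ) [NeZero q] (X : Matrix ι ι ℤ) (hX : X.det ≠ 0) :
    (kerS (ZMod q) X).card ≤ X.det.natAbs ^ Fintype.card ι := by
  classical
  have hp : 0 < X.det.natAbs := Int.natAbs_pos.2 hX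
  have h1 : (kerS (ZMod q) X) ⊆ Fintype.piFinset (fun _ : ι => Finset.univ.filter fun x : ZMod q => (X.det.natAbs : ZMod q) * x = 0) := by
    intro h hh
    rw [mem_kerS] at hh
    rw [Fintype.mem_piFinset]
    intro i
    simp only [Finset.mem_filter, Finset.mem_univ, true_and]
    have e : ((X.adjugate * X).map (Int.cast : ℤ → ZMod q)) *ᵥ h = 0 := by
      have : (X.adjugate * X).map (Int.cast : ℤ → ZMod q) = X.adjugate.map (Int.cast : ℤ → ZMod q) * X.map (Int.cast : ℤ → ZMod q) :=
        (Matrix.map_mul (f := Int.castRingHom (ZMod q)))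
      rw [this, ← Matrix.mulVec_mulVec, hh, Matrix.mulVec_zero]
    rw [Matrix.adjugate_mul] at e
    have e2 : (X.det : ZMod q) * h i = 0 := by
      have := congrFun e i
      simpa only [Matrix.mulVec, dotProduct, Matrix.map_apply, Matrix.smul_apply, Matrix.one_apply, smul_eq_mul, mul_ite, mul_one, mul_zero, Int.cast_ite, Int.cast_zero, ite_mul, zero_mul, Finset.sum_ite_eq, Finset.mem_univ, if_true, Pi.zero_apply] using this
    rcases Int.natAbs_eq X.det with h3 | h3
    · rw [h3] at e2; simpa using e2
    · rw [h3] at e2; simpa using e2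
  refine (Finset.card_le_card h1).trans ?_
  rw [Fintype.card_piFinset, Finset.prod_const, Finset.card_univ]
  exact Nat.pow_le_pow_left (card_zmod_mul_eq_zero q _ hp) _

theorem Arith.card_ker {C : Matrix ι ι ℤ} {l : ι → ℤ} {k : ℤ} {i0 : ι} {L : ℕ} {N' : Matrix ι ι ℤ} (H : Arith C l k i0 L N')
    (q : ℕ) [NeZero q] : (kerS (ZMod q) (C + Cᵀ)).card ≤ (q.gcd L) ^ 2 * N'.det.natAbs ^ Fintype.card ι := by
  rw [H.hN]
  refine (card_kerS_mul _ _).trans ?_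
  refine (Nat.mul_le_mul (card_kerS_mul _ _) le_rfl).trans ?_
  have h1 := card_ker_diag (ι := ι) q L H.hL i0
  have h2 := card_ker_det q N' H.hdet
  calc _ ≤ (q.gcd L * N'.det.natAbs ^ Fintype.card ι) * q.gcd L := by gcongr
    _ = _ := by ring

theorem Arith.GS_ne {C : Matrix ι ι ℤ} {l : ι → ℤ} {k : ℤ} {i0 : ι} {L : ℕ} {N' : Matrix ι ι ℤ} (H : Arith C l k i0 L N')
    (q : ℕ) [NeZero q] (ψ : AddChar (ZMod q) ℂ) (hψ : ψ.IsPrimitive) (a : ZMod q) (v : ι → ZMod q)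
    (h : GS ψ C l k a v ≠ 0) : ((q / q.gcd L : ℕ) : ZMod q) * (a * l i0 + v i0) = 0 := by
  set g := q.gcd L with hg
  have hgq : g ∣ q := Nat.gcd_dvd_left _ _
  have hgL : (g:ℤ) ∣ L := by exact_mod_cast Nat.gcd_dvd_right q L
  have hz : ∀ m : ℤ, (g:ℤ) ∣ m → ((q / g : ℕ) : ZMod q) * (m : ZMod q) = 0 := by
    rintro m ⟨m', rfl⟩
    have : ((q / g : ℕ) : ZMod q) * (g : ZMod q) = 0 := by
      rw [← Nat.cast_mul, Nat.div_mul_cancel hgq, ZMod.natCast_self]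
    push_cast
    rw [← mul_assoc, this, zero_mul]
  have hcol : ∀ i, (g : ℤ) ∣ C i i0 + C i0 i := by
    intro i
    refine hgL.trans ?_
    have := congrFun (congrFun H.hN i) i0
    rw [Matrix.mul_diagonal] at this
    simp only [Matrix.add_apply, Matrix.transpose_apply, if_true] at this
    rw [this]
    exact dvd_mul_left _ _
  have t := GS_translate ψ C l k a v (Pi.single i0 ((q / g : ℕ) : ZMod q)) (by
    intro i
    simp only [Pi.single_apply, mul_ite, mul_zero, Finset.sum_ite_eq', Finset.mem_univ, if_true]
    rw [mul_comm]
    exact hz _ (hcol i))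
  have t2 := mul_right_cancel₀ h ((one_mul _).trans t)
  have t3 := (hψ.zmod_char_eq_one_iff q _).1 t2.symm
  simp only [Pi.single_apply, mul_ite, mul_zero, ite_mul, zero_mul, Finset.sum_ite_eq', Finset.mem_univ, if_true] at t3
  have t4 : (C i0 i0 : ZMod q) * ((q / g : ℕ) : ZMod q) = 0 := by
    rw [mul_comm]; exact hz _ (hgL.trans H.hC)
  simp [t4] at t3
  rw [← t3]; ring
end QH
end

open scoped BigOperators
open Finset Filter Topology Matrix
noncomputable section
namespace QH
variable {ι : Type*} [Fintype ι] [DecidableEq ι]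

theorem Arith.card_supp {C : Matrix ι ι ℤ} {l : ι → ℤ} {k : ℤ} {i0 : ι} {L : ℕ} {N' : Matrix ι ι ℤ} (H : Arith C l k i0 L N')
    (q : ℕ) [NeZero q] (ψ : AddChar (ZMod q) ℂ) (hψ : ψ.IsPrimitive) (v : ι → ZMod q) :
    (open Classical in (Finset.univ.filter fun a : (ZMod q)ˣ => GS ψ C l k (a : ZMod q) v ≠ 0)).card ≤ q / q.gcd L := by
  classical
  set g := q.gcd L with hg
  have hgq : g ∣ q := Nat.gcd_dvd_left _ _
  have hgL : (g:ℤ) ∣ L := by exact_mod_cast Nat.gcd_dvd_right q L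
  have hg0 : 0 < g := Nat.gcd_pos_of_pos_right _ H.hL
  have hq0 : 0 < q := Nat.pos_of_ne_zero (NeZero.ne q)
  have hqg : 0 < q / g := Nat.div_pos (Nat.le_of_dvd hq0 hgq) hg0
  rcases (Finset.univ.filter fun a : (ZMod q)ˣ => GS ψ C l k (a : ZMod q) v ≠ 0).eq_empty_or_nonempty with he | ⟨a0, ha0⟩
  · rw [he]; simp
  refine le_trans ?_ (card_zmod_mul_eq_zero q (q / g) hqg)
  refine Finset.card_le_card_of_injOn (fun a => (a : ZMod q) - a0) ?_ (fun a _ b _ hab => Units.ext (by simpa using hab))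
  intro a ha
  simp only [Finset.mem_filter, Finset.mem_univ, true_and, Finset.coe_filter, Set.mem_setOf_eq] at ha ha0 ⊢
  have e1 := H.GS_ne q ψ hψ a v ha
  have e2 := H.GS_ne q ψ hψ a0 v ha0
  obtain ⟨u, w, huw⟩ := H.hl
  obtain ⟨m, hm⟩ := hgL
  have hz : ((q / g : ℕ) : ZMod q) * (g : ZMod q) = 0 := by
    rw [← Nat.cast_mul, Nat.div_mul_cancel hgq, ZMod.natCast_self]
  have h1 : (u : ZMod q) * l i0 + w * (g * m) = 1 := by
    rw [hm] at huw
    exact_mod_cast congrArg (Int.cast : ℤ → ZMod q) huw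
  have hz' : ((q / q.gcd L : ℕ) : ZMod q) * (g : ZMod q) = 0 := hz
  linear_combination (u:ZMod q) * e1 - u * e2 - ((q / g : ℕ) : ZMod q) * ((a:ZMod q) - a0) * h1 + w * m * ((a:ZMod q) - a0) * hz

/-- twisted sum over units -/
def TS {A : Type*} [CommRing A] [Fintype A] [DecidableEq A] (ψ : AddChar A ℂ) (C : Matrix ι ι ℤ) (l : ι → ℤ) (k : ℤ)
    (u : A) (v : ι → A) : ℂ :=
  ∑ a : Aˣ, ψ (u * ((a⁻¹ : Aˣ) : A)) * GS ψ C l k (a : A) v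

theorem Arith.TS_le {C : Matrix ι ι ℤ} {l : ι → ℤ} {k : ℤ} {i0 : ι} {L : ℕ} {N' : Matrix ι ι ℤ} (H : Arith C l k i0 L N')
    (q : ℕ) [NeZero q] (ψ : AddChar (ZMod q) ℂ) (hψ : ψ.IsPrimitive) (u : ZMod q) (v : ι → ZMod q) :
    ‖TS ψ C l k u v‖ ≤ Real.sqrt (N'.det.natAbs ^ Fintype.card ι : ℕ) * (q * Real.sqrt (q ^ Fintype.card ι : ℕ)) := by
  classical
  refine (norm_sum_le _ _).trans ?_
  set g := q.gcd L with hg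
  have hgq : g ∣ q := Nat.gcd_dvd_left _ _
  have hg0 : 0 < g := Nat.gcd_pos_of_pos_right _ H.hL
  have h1 : ∀ a : (ZMod q)ˣ, ‖GS ψ C l k (a : ZMod q) v‖ ≤ g * (Real.sqrt (N'.det.natAbs ^ Fintype.card ι : ℕ) * Real.sqrt (q ^ Fintype.card ι : ℕ)) := by
    intro a
    have h2 := GS_sq_le ψ hψ C l k a v
    have h3 := H.card_ker q
    refine (pow_le_pow_iff_left₀ (norm_nonneg _) (by positivity) two_ne_zero).1 ?_
    refine h2.trans ?_
    rw [mul_pow, mul_pow, Real.sq_sqrt (by positivity), Real.sq_sqrt (by positivity), ZMod.card]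
    have h4 : ((kerS (ZMod q) (C + Cᵀ)).card : ℝ) ≤ (g ^ 2 * N'.det.natAbs ^ Fintype.card ι : ℕ) := by exact_mod_cast h3
    refine (mul_le_mul_of_nonneg_left h4 (by positivity)).trans (le_of_eq ?_)
    push_cast; ring
  have h5 : ∑ a : (ZMod q)ˣ, ‖ψ (u * ((a⁻¹ : (ZMod q)ˣ) : ZMod q)) * GS ψ C l k (a : ZMod q) v‖ =
      ∑ a ∈ Finset.univ.filter fun a : (ZMod q)ˣ => GS ψ C l k (a : ZMod q) v ≠ 0, ‖GS ψ C l k (a : ZMod q) v‖ := by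
    rw [Finset.sum_filter]
    refine Finset.sum_congr rfl fun a _ => ?_
    rw [norm_mul, AddChar.norm_apply, one_mul]
    split_ifs with h
    · rfl
    · push_neg at h; rw [h, norm_zero]
  rw [h5]
  refine (Finset.sum_le_card_nsmul _ _ _ fun a _ => h1 a).trans ?_
  rw [nsmul_eq_mul]
  have h6 := H.card_supp q ψ hψ v
  have h7 : (((Finset.univ.filter fun a : (ZMod q)ˣ => GS ψ C l k (a : ZMod q) v ≠ 0).card : ℕ) : ℝ) ≤ (q / g : ℕ) := by exact_mod_cast h6
  refine (mul_le_mul_of_nonneg_right h7 (by positivity)).trans (le_of_eq ?_)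
  have h8 : ((q / g : ℕ) : ℝ) * g = q := by exact_mod_cast Nat.div_mul_cancel hgq
  rw [← mul_assoc, h8]; ring
end QH
end

open scoped BigOperators
open Finset Filter Topology Matrix
noncomputable section
namespace QH
variable {ι : Type*} [Fintype ι] [DecidableEq ι]

lemma GS_equiv {A B : Type*} [CommRing A] [Fintype A] [CommRing B] [Fintype B] (e : A ≃+* B) (ψ : AddChar B ℂ)
    (C : Matrix ι ι ℤ) (l : ι → ℤ) (k : ℤ) (a : A) (v : ι → A) [DecidableEq ι] :
    GS (ψ.compAddMonoidHom (e : A →+ B)) C l k a v = GS ψ C l k (e a) (fun i => e (v i)) := by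
  unfold GS
  rw [← Equiv.sum_comp (Equiv.arrowCongr (Equiv.refl ι) e.toEquiv)]
  refine Finset.sum_congr rfl fun x _ => ?_
  simp only [AddChar.compAddMonoidHom_apply]
  congr 1
  have := qpoly_map (e : A →+* B) C l k x
  simp only [RingHom.coe_coe] at this
  show e _ = _
  rw [map_add, map_mul, this, map_sum]
  simp only [map_mul]
  rfl

lemma TS_equiv {A B : Type*} [CommRing A] [Fintype A] [DecidableEq A] [CommRing B] [Fintype B] [DecidableEq B] (e : A ≃+* B) (ψ : AddChar B ℂ)
    (C : Matrix ι ι ℤ) (l : ι → ℤ) (k : ℤ) (u : A) (v : ι → A) :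
    TS (ψ.compAddMonoidHom (e : A →+ B)) C l k u v = TS ψ C l k (e u) (fun i => e (v i)) := by
  unfold TS
  rw [← Equiv.sum_comp (Units.mapEquiv (e : A ≃* B)).toEquiv]
  refine Finset.sum_congr rfl fun a _ => ?_
  rw [GS_equiv]
  congr 1
  simp only [AddChar.compAddMonoidHom_apply]
  congr 1
  show e _ = _
  rw [map_mul]
  rfl

lemma GS_prod {A B : Type*} [CommRing A] [Fintype A] [CommRing B] [Fintype B] (ψ : AddChar (A × B) ℂ)
    (C : Matrix ι ι ℤ) (l : ι → ℤ) (k : ℤ) (a : A × B) (v : ι → A × B) :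
    GS ψ C l k a v = GS (ψ.compAddMonoidHom (AddMonoidHom.inl A B)) C l k a.1 (fun i => (v i).1) *
      GS (ψ.compAddMonoidHom (AddMonoidHom.inr A B)) C l k a.2 (fun i => (v i).2) := by
  unfold GS
  rw [Finset.sum_mul_sum, ← Finset.sum_product', Finset.univ_product_univ,
    ← Equiv.sum_comp (Equiv.arrowProdEquivProdArrow ι (fun _ => A) (fun _ => B)).symm]
  refine Finset.sum_congr rfl fun x _ => ?_
  simp only [AddChar.compAddMonoidHom_apply]
  rw [← AddChar.map_add_eq_mul]
  congr 1
  have h1 := qpoly_map (RingHom.fst A B) C l k ((Equiv.arrowProdEquivProdArrow ι (fun _ => A) (fun _ => B)).symm x)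
  have h2 := qpoly_map (RingHom.snd A B) C l k ((Equiv.arrowProdEquivProdArrow ι (fun _ => A) (fun _ => B)).symm x)
  simp only [RingHom.coe_fst, RingHom.coe_snd] at h1 h2
  refine Prod.ext ?_ ?_
  · simp only [AddMonoidHom.inl_apply, AddMonoidHom.inr_apply, Prod.fst_add, Prod.fst_mul, Prod.fst_sum, h1, add_zero]
    rfl
  · simp only [AddMonoidHom.inl_apply, AddMonoidHom.inr_apply, Prod.snd_add, Prod.snd_mul, Prod.snd_sum, h2, zero_add]
    rfl

lemma TS_prod {A B : Type*} [CommRing A] [Fintype A] [DecidableEq A] [CommRing B] [Fintype B] [DecidableEq B] (ψ : AddChar (A × B) ℂ)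
    (C : Matrix ι ι ℤ) (l : ι → ℤ) (k : ℤ) (u : A × B) (v : ι → A × B) :
    TS ψ C l k u v = TS (ψ.compAddMonoidHom (AddMonoidHom.inl A B)) C l k u.1 (fun i => (v i).1) *
      TS (ψ.compAddMonoidHom (AddMonoidHom.inr A B)) C l k u.2 (fun i => (v i).2) := by
  unfold TS
  rw [Finset.sum_mul_sum, ← Finset.sum_product', Finset.univ_product_univ,
    ← Equiv.sum_comp (MulEquiv.prodUnits (M := A) (N := B)).toEquiv.symm]
  refine Finset.sum_congr rfl fun x _ => ?_
  rw [GS_prod, mul_mul_mul_comm]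
  congr 1
  simp only [AddChar.compAddMonoidHom_apply]
  rw [← AddChar.map_add_eq_mul]
  congr 1
  refine Prod.ext ?_ ?_
  · simp only [AddMonoidHom.inl_apply, AddMonoidHom.inr_apply, Prod.fst_add, Prod.fst_mul, add_zero]
    rfl
  · simp only [AddMonoidHom.inl_apply, AddMonoidHom.inr_apply, Prod.snd_add, Prod.snd_mul, zero_add]
    rfl

/-- multiplicativity over coprime moduli -/
theorem TS_mul (m n : ℕ) [NeZero m] [NeZero n] (hmn : m.Coprime n) (ψ : AddChar (ZMod (m * n)) ℂ) (hψ : ψ.IsPrimitive)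
    (C : Matrix ι ι ℤ) (l : ι → ℤ) (k : ℤ) (K1 K2 : ℝ) (hK1 : 0 ≤ K1)
    (h1 : ∀ (φ : AddChar (ZMod m) ℂ), φ.IsPrimitive → ∀ u v, ‖TS φ C l k u v‖ ≤ K1)
    (h2 : ∀ (φ : AddChar (ZMod n) ℂ), φ.IsPrimitive → ∀ u v, ‖TS φ C l k u v‖ ≤ K2) (u v) :
    ‖TS ψ C l k u v‖ ≤ K1 * K2 := by
  set e := ZMod.chineseRemainder hmn with he
  set ψ' : AddChar (ZMod m × ZMod n) ℂ := ψ.compAddMonoidHom (e.symm : ZMod m × ZMod n →+ ZMod (m * n)) with hψ'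
  have hback : ψ = ψ'.compAddMonoidHom (e : ZMod (m * n) →+ ZMod m × ZMod n) := by
    ext x
    simp [hψ', AddChar.compAddMonoidHom_apply]
  rw [hback, TS_equiv, TS_prod, norm_mul]
  have hprim : ∀ y : ZMod m × ZMod n, (∀ x, ψ' (y * x) = 1) → y = 0 := by
    intro y hy
    by_contra hne
    apply hψ (a := e.symm y) (by simpa using hne)
    ext x
    have := hy (e x)
    rw [hψ', AddChar.compAddMonoidHom_apply] at this
    simpa [AddChar.mulShift_apply] using this
  refine mul_le_mul (h1 _ ?_ _ _) (h2 _ ?_ _ _) (norm_nonneg _) hK1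
  · intro a ha h
    apply ha
    have := hprim (a, 0) (by
      intro x
      have := DFunLike.congr_fun h x.1
      simpa [AddChar.mulShift_apply, AddChar.compAddMonoidHom_apply, Prod.mul_def] using this)
    exact (Prod.ext_iff.1 this).1
  · intro a ha h
    apply ha
    have := hprim (0, a) (by
      intro x
      have := DFunLike.congr_fun h x.2
      simpa [AddChar.mulShift_apply, AddChar.compAddMonoidHom_apply, Prod.mul_def] using this)
    exact (Prod.ext_iff.1 this).2
end QH
end

open scoped BigOperators
open Finset Filter Topology Matrix
noncomputable section
namespace QH
variable {ι : Type*} [Fintype ι] [DecidableEq ι]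

lemma diag_form {K : Type*} [Field K] (h2 : (2:K) ≠ 0) (X : Matrix ι ι K) (hX : (X + Xᵀ).det ≠ 0) :
    ∃ (w : ι → Kˣ) (E : (ι → K) ≃ₗ[K] (ι → K)), ∀ x, ∑ i, ∑ j, X i j * x i * x j = ∑ i, (w i : K) * (E x i) ^ 2 := by
  haveI : Invertible (2:K) := invertibleOfNonzero h2
  set Q : QuadraticForm K (ι → K) := (Matrix.toBilin' X).toQuadraticMap with hQ
  have hQa : ∀ x, Q x = ∑ i, ∑ j, X i j * x i * x j := by
    intro x
    rw [hQ, LinearMap.BilinMap.toQuadraticMap_apply, Matrix.toBilin'_apply]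
    refine Finset.sum_congr rfl fun i _ => Finset.sum_congr rfl fun j _ => by ring
  have hsep : (QuadraticMap.associated (R := K) Q).SeparatingLeft := by
    intro x hx
    have h1 : ∀ y, x ⬝ᵥ ((X + Xᵀ) *ᵥ y) = 0 := by
      intro y
      have h3 : QuadraticMap.polar Q x y = 0 := by
        have := hx y
        rw [← QuadraticMap.polarBilin_apply_apply, ← QuadraticMap.two_nsmul_associated K]
        rw [LinearMap.smul_apply, LinearMap.smul_apply, this, smul_zero]
      rw [hQ, LinearMap.BilinMap.polar_toQuadraticMap, Matrix.toBilin'_apply', Matrix.toBilin'_apply'] at h3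
      rw [Matrix.add_mulVec, dotProduct_add, ← h3]
      congr 1
      rw [Matrix.mulVec_transpose, dotProduct_comm, ← Matrix.dotProduct_mulVec]
    have h4 : x ᵥ* (X + Xᵀ) = 0 := by
      rw [← dotProduct_eq_zero_iff]
      intro y
      rw [← Matrix.dotProduct_mulVec]
      exact h1 y
    by_contra hne
    exact hX (Matrix.exists_vecMul_eq_zero_iff.1 ⟨x, hne, h4⟩)
  obtain ⟨w, ⟨e⟩⟩ := QuadraticForm.equivalent_weightedSumSquares_units_of_nondegenerate' Q hsep
  have hc : Fintype.card ι = Module.finrank K (ι → K) := by simp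
  let r : ι ≃ Fin (Module.finrank K (ι → K)) := Fintype.equivFinOfCardEq hc
  refine ⟨fun i => w (r i), e.toLinearEquiv.trans (LinearEquiv.funCongrLeft K K r), fun x => ?_⟩
  rw [← hQa, ← e.map_app, QuadraticMap.weightedSumSquares_apply, ← Equiv.sum_comp r]
  refine Finset.sum_congr rfl fun i _ => ?_
  rw [Units.smul_def, smul_eq_mul, ← sq]
  rfl

lemma gauss_one {F : Type*} [Field F] [Fintype F] [DecidableEq F] (hF : ringChar F ≠ 2) (ψ : AddChar F ℂ) (hψ : ψ.IsPrimitive) (b : Fˣ) :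
    ∑ t : F, ψ (b * t ^ 2) = ((quadraticChar F (b : F) : ℤ) : ℂ) * gaussSum ((quadraticChar F).ringHomComp (Int.castRingHom ℂ)) ψ := by
  have h1 : ∑ t : F, ψ (b * t ^ 2) = ∑ s : F, (((quadraticChar F s + 1 : ℤ)) : ℂ) * ψ (b * s) := by
    rw [← Finset.sum_fiberwise_of_maps_to (s := Finset.univ) (t := Finset.univ) (g := fun t : F => t ^ 2) (fun _ _ => Finset.mem_univ _)]
    refine Finset.sum_congr rfl fun s _ => ?_
    rw [Finset.sum_congr rfl (g := fun _ => ψ (b * s)) (by intro x hx; rw [(Finset.mem_filter.1 hx).2]), Finset.sum_const, nsmul_eq_mul,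
      ← quadraticChar_card_sqrts hF s]
    congr 2
    push_cast
    congr 1
    congr 1
    ext x; simp
  have h2 : ∑ s : F, ψ (b * s) = 0 := by
    have := AddChar.sum_mulShift (b : F) hψ
    simp_rw [mul_comm (b:F)]
    rw [this]; simp
  have h3 := gaussSum_mulShift ((quadraticChar F).ringHomComp (Int.castRingHom ℂ)) ψ b
  rw [h1, ← h3]
  have h4 : ((quadraticChar F).ringHomComp (Int.castRingHom ℂ)) (b:F) = ((quadraticChar F (b : F) : ℤ) : ℂ) := rfl
  rw [h4, ← mul_assoc]
  have h5 : ((quadraticChar F (b : F) : ℤ) : ℂ) * ((quadraticChar F (b : F) : ℤ) : ℂ) = 1 := by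
    have := quadraticChar_sq_one (F := F) b.ne_zero
    rw [← sq]; exact_mod_cast this
  rw [h5, one_mul]
  push_cast
  simp_rw [add_mul, one_mul]
  rw [Finset.sum_add_distrib, h2, add_zero]
  rfl

lemma gauss_norm {F : Type*} [Field F] [Fintype F] [DecidableEq F] (hF : ringChar F ≠ 2) (ψ : AddChar F ℂ) (hψ : ψ.IsPrimitive) :
    ‖gaussSum ((quadraticChar F).ringHomComp (Int.castRingHom ℂ)) ψ‖ = Real.sqrt (Fintype.card F) := by
  have h1 := gaussSum_sq (χ := (quadraticChar F).ringHomComp (Int.castRingHom ℂ)) (by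
    rw [MulChar.ringHomComp_ne_one_iff (by exact Int.cast_injective)]
    exact quadraticChar_ne_one hF) ((quadraticChar_isQuadratic F).comp _) hψ
  have h2 := congrArg norm h1
  rw [norm_pow, norm_mul] at h2
  have h3 : ‖((quadraticChar F).ringHomComp (Int.castRingHom ℂ)) (-1)‖ = 1 := by
    show ‖((quadraticChar F (-1) : ℤ) : ℂ)‖ = 1
    rcases quadraticChar_dichotomy (F := F) (a := -1) (by simp) with h | h <;> rw [h] <;> simp
  rw [h3, one_mul, Complex.norm_natCast] at h2
  rw [← h2, Real.sqrt_sq (norm_nonneg _)]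
end QH
end

open scoped BigOperators
open Finset Filter Topology Matrix
noncomputable section
namespace QH
variable {ι : Type*} [Fintype ι] [DecidableEq ι]

lemma char_sum {A : Type*} [CommRing A] (ψ : AddChar A ℂ) (f : ι → A) : ψ (∑ i, f i) = ∏ i, ψ (f i) := by
  induction (Finset.univ : Finset ι) using Finset.induction_on with
  | empty => simp
  | insert i s hi ih => rw [Finset.sum_insert hi, Finset.prod_insert hi, AddChar.map_add_eq_mul, ih]

lemma unit_sum {F : Type*} [Field F] [Fintype F] [DecidableEq F] (hF : ringChar F ≠ 2) (ψ : AddChar F ℂ) (hψ : ψ.IsPrimitive) (s : F) :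
    ‖∑ a : Fˣ, ((quadraticChar F (a : F) : ℤ) : ℂ) * ψ (s * ((a⁻¹ : Fˣ) : F))‖ ≤ Real.sqrt (Fintype.card F) := by
  have h1 : ∑ a : Fˣ, ((quadraticChar F (a : F) : ℤ) : ℂ) * ψ (s * ((a⁻¹ : Fˣ) : F)) = ∑ x : F, ((quadraticChar F x : ℤ) : ℂ) * ψ (s * x) := by
    rw [← Equiv.sum_comp (Equiv.inv Fˣ)]
    have h2 : ∀ a : Fˣ, ((quadraticChar F ((Equiv.inv Fˣ a : Fˣ) : F) : ℤ) : ℂ) * ψ (s * (((Equiv.inv Fˣ a)⁻¹ : Fˣ) : F)) = ((quadraticChar F (a:F) : ℤ) : ℂ) * ψ (s * a) := by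
      intro a
      simp only [Equiv.inv_apply, inv_inv]
      congr 2
      have e1 : quadraticChar F ((a⁻¹ : Fˣ) : F) * quadraticChar F (a : F) = 1 := by
        rw [← map_mul]; simp
      have e2 := quadraticChar_sq_one (F := F) a.ne_zero
      have e3 : quadraticChar F (a:F) * quadraticChar F (a : F) = 1 := by rw [← sq]; exact e2
      exact mul_right_cancel₀ (by intro h; rw [h] at e3; simp at e3) (e1.trans e3.symm)
    rw [Finset.sum_congr rfl fun a _ => h2 a]
    rw [← Finset.sum_subset (Finset.subset_univ (Finset.univ.filter fun x : F => x ≠ 0)) (by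
      intro x _ hx
      have : x = 0 := by simpa using hx
      rw [this]; simp)]
    refine Finset.sum_bij (fun a _ => (a : F)) ?_ ?_ ?_ ?_
    · intro a _; simp
    · intro a _ b _ h; exact Units.ext h
    · intro x hx
      exact ⟨Units.mk0 x (by simpa using hx), Finset.mem_univ _, rfl⟩
    · intro a _; rfl
  rw [h1]
  by_cases hs : s = 0
  · subst hs
    simp only [zero_mul, AddChar.map_zero_eq_one, mul_one]
    have := quadraticChar_sum_zero hF
    rw [← Int.cast_sum, this]; simp
  · have := gauss_norm hF (ψ.mulShift s) (by
      intro a ha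
      have := hψ (mul_ne_zero hs ha)
      rwa [AddChar.mulShift_mulShift])
    rw [← this]
    apply le_of_eq; rfl

theorem TS_field {F : Type*} [Field F] [Fintype F] [DecidableEq F] (hF : ringChar F ≠ 2) (ψ : AddChar F ℂ) (hψ : ψ.IsPrimitive)
    (C : Matrix ι ι ℤ) (l : ι → ℤ) (k : ℤ) (hdet : (((C + Cᵀ).det : ℤ) : F) ≠ 0) (hodd : Odd (Fintype.card ι))
    (h : ι → F) (hh : ∀ x : ι → F, qpoly C l k x = ∑ i, ∑ j, (C i j : F) * (x i + h i) * (x j + h j)) (u : F) (v : ι → F) :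
    ‖TS ψ C l k u v‖ ≤ Real.sqrt (Fintype.card F) ^ (Fintype.card ι + 1) := by
  set X : Matrix ι ι F := C.map (Int.cast : ℤ → F) with hX
  have hXd : (X + Xᵀ).det ≠ 0 := by
    have : X + Xᵀ = (C + Cᵀ).map (Int.castRingHom F) := by
      ext i j; simp [hX]
    rw [this, ← RingHom.mapMatrix_apply, ← RingHom.map_det]
    exact hdet
  obtain ⟨w, E, hE⟩ := diag_form (Ring.two_ne_zero hF) X hXd
  set τ := gaussSum ((quadraticChar F).ringHomComp (Int.castRingHom ℂ)) ψ with hτ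
  have hG : ∀ a : Fˣ, ∑ y : ι → F, ψ (a * ∑ i, ∑ j, X i j * y i * y j) = ((quadraticChar F (a:F) : ℤ) : ℂ) * ((∏ i, ((quadraticChar F (w i : F) : ℤ) : ℂ)) * τ ^ Fintype.card ι) := by
    intro a
    calc ∑ y : ι → F, ψ (a * ∑ i, ∑ j, X i j * y i * y j) = ∑ y : ι → F, ∏ i, ψ (((a * w i : Fˣ) : F) * (E y i) ^ 2) := by
          refine Finset.sum_congr rfl fun y _ => ?_
          rw [hE, Finset.mul_sum, char_sum]
          refine Finset.prod_congr rfl fun i _ => ?_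
          congr 1; push_cast; ring
      _ = ∑ y : ι → F, ∏ i, ψ (((a * w i : Fˣ) : F) * (y i) ^ 2) :=
          Equiv.sum_comp E.toEquiv (fun y => ∏ i, ψ (((a * w i : Fˣ) : F) * (y i) ^ 2))
      _ = ∏ i, ∑ t : F, ψ (((a * w i : Fˣ) : F) * t ^ 2) := (Fintype.prod_sum (fun i (t:F) => ψ (((a * w i : Fˣ) : F) * t ^ 2))).symm
      _ = ∏ i, (((quadraticChar F (a:F) : ℤ) : ℂ) * ((quadraticChar F (w i : F) : ℤ) : ℂ) * τ) := by
          refine Finset.prod_congr rfl fun i _ => ?_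
          rw [gauss_one hF ψ hψ]
          push_cast
          rw [map_mul]; push_cast; rfl
      _ = _ := by
          rw [Finset.prod_mul_distrib, Finset.prod_mul_distrib, Finset.prod_const, Finset.prod_const, Finset.card_univ]
          have : ((quadraticChar F (a:F) : ℤ) : ℂ) ^ Fintype.card ι = ((quadraticChar F (a:F) : ℤ) : ℂ) := by
            obtain ⟨m, hm⟩ := hodd
            have e2 := quadraticChar_sq_one (F := F) a.ne_zero
            rw [hm, pow_succ, pow_mul, ← Int.cast_pow, e2]; simp
          rw [this]; ring
  -- complete the square
  obtain ⟨z, hz⟩ : ∃ z : ι → F, (X + Xᵀ) *ᵥ z = v := by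
    refine ⟨(X + Xᵀ)⁻¹ *ᵥ v, ?_⟩
    rw [Matrix.mulVec_mulVec, Matrix.mul_nonsing_inv _ (isUnit_iff_ne_zero.2 hXd), Matrix.one_mulVec]
  set c : F := (∑ i, ∑ j, X i j * z i * z j) - ∑ i, v i * z i with hc
  have hGS : ∀ a : Fˣ, GS ψ C l k (a:F) v = ψ (- ∑ i, v i * h i) * ψ (c * ((a⁻¹ : Fˣ) : F)) * ∑ y : ι → F, ψ (a * ∑ i, ∑ j, X i j * y i * y j) := by
    intro a
    rw [GS, Finset.mul_sum, ← Equiv.sum_comp (Equiv.addRight (- ((a⁻¹ : Fˣ) : F) • z - h))]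
    refine Finset.sum_congr rfl fun y _ => ?_
    rw [hh, ← AddChar.map_add_eq_mul, ← AddChar.map_add_eq_mul]
    congr 1
    simp only [Equiv.coe_addRight, Pi.add_apply, Pi.sub_apply, Pi.smul_apply, smul_eq_mul]
    have q1 := qpoly_add C 0 0 y (- ((a⁻¹ : Fˣ) : F) • z)
    simp only [qpoly, Pi.zero_apply, Int.cast_zero, zero_mul, Finset.sum_const_zero, add_zero, Pi.add_apply, Pi.smul_apply, smul_eq_mul] at q1
    have e1 : ∑ i, ∑ j, (C i j : F) * (y i + (-((a⁻¹ : Fˣ) : F) * z i - h i) + h i) * (y j + (-((a⁻¹ : Fˣ) : F) * z j - h j) + h j)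
      = ∑ i, ∑ j, (C i j : F) * (y i + -((a⁻¹ : Fˣ) : F) * z i) * (y j + -((a⁻¹ : Fˣ) : F) * z j) := by
      refine Finset.sum_congr rfl fun i _ => Finset.sum_congr rfl fun j _ => by ring
    have e2 : ∑ i, (∑ j, ((C i j + C j i : ℤ) : F) * (-((a⁻¹ : Fˣ) : F) * z j)) * y i = -((a⁻¹ : Fˣ) : F) * ∑ i, v i * y i := by
      rw [Finset.mul_sum]
      refine Finset.sum_congr rfl fun i _ => ?_
      rw [← congrFun hz i]
      simp only [Matrix.mulVec, dotProduct, Matrix.add_apply, Matrix.transpose_apply, hX, Matrix.map_apply]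
      rw [← mul_assoc, Finset.mul_sum]
      congr 1
      refine Finset.sum_congr rfl fun j _ => ?_
      push_cast; ring
    have e3 : ∑ i, ∑ j, (C i j : F) * (-((a⁻¹ : Fˣ) : F) * z i) * (-((a⁻¹ : Fˣ) : F) * z j) = ((a⁻¹ : Fˣ) : F) ^ 2 * ∑ i, ∑ j, (C i j : F) * z i * z j := by
      rw [Finset.mul_sum]
      refine Finset.sum_congr rfl fun i _ => ?_
      rw [Finset.mul_sum]
      exact Finset.sum_congr rfl fun j _ => by ring
    have e4 : ∑ i, v i * (y i + (-((a⁻¹ : Fˣ) : F) * z i - h i)) = ∑ i, v i * y i - ((a⁻¹ : Fˣ) : F) * ∑ i, v i * z i - ∑ i, v i * h i := by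
      rw [Finset.mul_sum, ← Finset.sum_sub_distrib, ← Finset.sum_sub_distrib]
      exact Finset.sum_congr rfl fun i _ => by ring
    rw [e1, q1, e2, e3, e4, hc]
    simp only [hX, Matrix.map_apply]
    have e5 : (a : F) * ((a⁻¹ : Fˣ) : F) = 1 := by simp
    linear_combination (- ∑ i, v i * y i + ((a⁻¹ : Fˣ) : F) * ∑ i, ∑ j, (C i j : F) * z i * z j) * e5
  have hTS : TS ψ C l k u v = (ψ (- ∑ i, v i * h i) * ((∏ i, ((quadraticChar F (w i : F) : ℤ) : ℂ)) * τ ^ Fintype.card ι)) * 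
      ∑ a : Fˣ, ((quadraticChar F (a : F) : ℤ) : ℂ) * ψ ((u + c) * ((a⁻¹ : Fˣ) : F)) := by
    rw [TS, Finset.mul_sum]
    refine Finset.sum_congr rfl fun a _ => ?_
    rw [hGS, hG, add_mul u c, AddChar.map_add_eq_mul]
    ring
  rw [hTS, norm_mul, norm_mul, norm_mul, AddChar.norm_apply, one_mul, norm_prod, norm_pow, gauss_norm hF ψ hψ, pow_succ]
  have hw : ∏ i, ‖((quadraticChar F (w i : F) : ℤ) : ℂ)‖ = 1 := by
    refine Finset.prod_eq_one fun i _ => ?_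
    rcases quadraticChar_dichotomy (F := F) (a := (w i : F)) (w i).ne_zero with h | h <;> rw [h] <;> simp
  rw [hw, one_mul]
  exact mul_le_mul_of_nonneg_left (unit_sum hF ψ hψ _) (by positivity)
end QH
end

open scoped BigOperators
open Finset Filter Topology Matrix
noncomputable section
namespace QH
variable {ι : Type*} [Fintype ι] [DecidableEq ι]

theorem Arith.TS_prime {C : Matrix ι ι ℤ} {l : ι → ℤ} {k : ℤ} {i0 : ι} {L : ℕ} {N' : Matrix ι ι ℤ} (H : Arith C l k i0 L N')
    (hodd : Odd (Fintype.card ι)) (p : ℕ) (hp : p.Prime) [NeZero p] (hpd : ¬ (p:ℤ) ∣ 2 * N'.det * L)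
    (ψ : AddChar (ZMod p) ℂ) (hψ : ψ.IsPrimitive) (u : ZMod p) (v : ι → ZMod p) :
    ‖TS ψ C l k u v‖ ≤ Real.sqrt p ^ (Fintype.card ι + 1) := by
  haveI : Fact p.Prime := ⟨hp⟩
  obtain ⟨h, hh⟩ := H.hgood p hp hpd
  have hdet : (((C + Cᵀ).det : ℤ) : ZMod p) ≠ 0 := by
    rw [H.hN, Matrix.det_mul, Matrix.det_mul, Matrix.det_diagonal]
    have e : ∏ i : ι, (if i = i0 then (L : ℤ) else 1) = L := by
      rw [Finset.prod_ite_eq']; simp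
    rw [e]
    intro h0
    rw [ZMod.intCast_zmod_eq_zero_iff_dvd] at h0
    have hpp : Prime (p:ℤ) := Nat.prime_iff_prime_int.1 hp
    apply hpd
    rcases hpp.dvd_or_dvd h0 with h1 | h1
    · rcases hpp.dvd_or_dvd h1 with h1 | h1
      · exact h1.mul_left _
      · exact (h1.mul_left _).mul_right _
    · exact h1.mul_left _
  have hF : ringChar (ZMod p) ≠ 2 := by
    rw [ZMod.ringChar_zmod_n]
    rintro rfl
    apply hpd
    exact ⟨N'.det * L, by push_cast; ring⟩
  have := TS_field hF ψ hψ C l k hdet hodd h hh u v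
  rw [ZMod.card] at this
  convert this

theorem Arith.TS_good {C : Matrix ι ι ℤ} {l : ι → ℤ} {k : ℤ} {i0 : ι} {L : ℕ} {N' : Matrix ι ι ℤ} (H : Arith C l k i0 L N')
    (hodd : Odd (Fintype.card ι)) (f : ℕ) : ∀ (g q : ℕ), q = f * g → ∀ [NeZero q], Squarefree f → f.Coprime g → f.Coprime (2 * N'.det.natAbs * L) →
    ∀ (ψ : AddChar (ZMod q) ℂ), ψ.IsPrimitive → ∀ (u : ZMod q) (v : ι → ZMod q), 
    ‖TS ψ C l k u v‖ ≤ Real.sqrt f ^ (Fintype.card ι + 1) * (Real.sqrt (N'.det.natAbs ^ Fintype.card ι : ℕ) * (g * Real.sqrt (g ^ Fintype.card ι : ℕ))) := by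
  induction f using Nat.strong_induction_on with
  | _ f ih =>
    intro g q hq _ hsf hfg hfM ψ hψ u v
    by_cases hf1 : f = 1
    · subst hf1
      rw [one_mul] at hq
      subst hq
      simpa using H.TS_le q ψ hψ u v
    · obtain ⟨p, hp, f', rfl⟩ := Nat.exists_prime_and_dvd hf1
      have hf0 : p * f' ≠ 0 := hsf.ne_zero
      have hf'0 : f' ≠ 0 := by rintro rfl; simp at hf0
      have hg0 : g ≠ 0 := by rintro rfl; exact NeZero.ne q (by simpa using hq)
      haveI : NeZero p := ⟨hp.ne_zero⟩
      haveI : NeZero (f' * g) := ⟨mul_ne_zero hf'0 hg0⟩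
      rw [mul_assoc] at hq
      subst hq
      have hpf' : p.Coprime f' := Nat.coprime_of_squarefree_mul hsf
      have hpg : p.Coprime g := hfg.coprime_mul_right
      have hlt : f' < p * f' := by
        have := hp.two_le
        nlinarith [Nat.pos_of_ne_zero hf'0]
      have hpd : ¬ (p:ℤ) ∣ 2 * N'.det * L := by
        intro hd
        have h1 : p.Coprime (2 * N'.det.natAbs * L) := hfM.coprime_mul_right
        have h2 : p ∣ 2 * N'.det.natAbs * L := by
          have := Int.natAbs_dvd_natAbs.2 hd
          simpa [Int.natAbs_mul] using this
        exact (Nat.Prime.coprime_iff_not_dvd hp).1 h1 h2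
      have := TS_mul p (f' * g) (Nat.Coprime.mul_right hpf' hpg) ψ hψ C l k (Real.sqrt p ^ (Fintype.card ι + 1)) _ (by positivity)
        (fun φ hφ u v => H.TS_prime hodd p hp hpd φ hφ u v)
        (fun φ hφ u v => ih f' hlt g (f' * g) rfl (hsf.squarefree_of_dvd (dvd_mul_left _ _)) hfg.coprime_mul_left hfM.coprime_mul_left φ hφ u v) u v
      refine this.trans (le_of_eq ?_)
      push_cast
      rw [Real.sqrt_mul (by positivity), mul_pow]
      ring
end QH
end

open scoped BigOperators
open Finset Filter Topology Matrix
noncomputable section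
namespace QH
lemma sin_aux (q u : ℕ) (hu : 1 ≤ u) (huq : u < q) :
    (1 / (2 * Real.sin (Real.pi * u / q)) : ℝ) ≤ q / 4 * (1 / u + 1 / ((q:ℝ) - u)) := by
  have hq : (0:ℝ) < q := by exact_mod_cast (by lia : 0 < q)
  have hu0 : (0:ℝ) < u := by exact_mod_cast (by lia : 0 < u)
  have huq' : (0:ℝ) < (q:ℝ) - u := by
    have : (u:ℝ) < q := by exact_mod_cast huq
    linarith
  have hpi := Real.pi_pos
  rcases le_total (2 * (u:ℝ)) q with h | h
  · have h1 := Real.mul_le_sin (x := Real.pi * u / q) (by positivity) (by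
      rw [div_le_div_iff₀ hq (by norm_num)]; nlinarith)
    have e : 2 / Real.pi * (Real.pi * u / q) = 2 * u / q := by field_simp
    rw [e] at h1
    calc (1 / (2 * Real.sin (Real.pi * u / q)) : ℝ) ≤ 1 / (2 * (2 * u / q)) := by gcongr
      _ = q / 4 * (1 / u) := by field_simp; norm_num
      _ ≤ _ := by gcongr; linarith [show (0:ℝ) ≤ 1 / ((q:ℝ) - u) by positivity]
  · have h1 := Real.mul_le_sin (x := Real.pi * (q - u) / q) (by positivity) (by
      rw [div_le_div_iff₀ hq (by norm_num)]; nlinarith)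
    have e : 2 / Real.pi * (Real.pi * (q - u) / q) = 2 * (q - u) / q := by field_simp
    have e2 : Real.pi * (q - u) / q = Real.pi - Real.pi * u / q := by field_simp
    rw [e, e2, Real.sin_pi_sub] at h1
    calc (1 / (2 * Real.sin (Real.pi * u / q)) : ℝ) ≤ 1 / (2 * (2 * (q - u) / q)) := by gcongr
      _ = q / 4 * (1 / (q - u)) := by field_simp; norm_num
      _ ≤ _ := by gcongr; linarith [show (0:ℝ) ≤ 1 / (u:ℝ) by positivity]

lemma sin_lower (q u : ℕ) [NeZero q] (hu : 1 ≤ u) (huq : u < q) :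
    (1 / ‖(ZMod.stdAddChar (((u:ℕ):ZMod q)) : ℂ) - 1‖ : ℝ) ≤ q / 4 * (1 / u + 1 / ((q:ℝ) - u)) := by
  refine le_trans (le_of_eq ?_) (sin_aux q u hu huq)
  have hq : (0:ℝ) < q := by exact_mod_cast (by lia : 0 < q)
  have e : (ZMod.stdAddChar (((u:ℕ):ZMod q)) : ℂ) = Complex.exp (Complex.I * ((2 * Real.pi * u / q : ℝ) : ℂ)) := by
    have := exp_stdAddChar q (u:ℤ)
    simp only [Int.cast_natCast] at this
    rw [← this]
    congr 1; push_cast; ring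
  rw [e, Complex.norm_exp_I_mul_ofReal_sub_one, Real.norm_eq_abs]
  have e2 : 2 * Real.pi * u / q / 2 = Real.pi * u / q := by ring
  rw [e2, abs_of_nonneg]
  have : 0 ≤ Real.sin (Real.pi * u / q) := by
    apply Real.sin_nonneg_of_nonneg_of_le_pi (by positivity)
    rw [div_le_iff₀ hq]
    have : (u:ℝ) ≤ q := by exact_mod_cast huq.le
    nlinarith [Real.pi_pos]
  linarith

lemma geom_le (z : ℂ) (hz : ‖z‖ = 1) (hz1 : z ≠ 1) (n : ℕ) : ‖∑ j ∈ Finset.range n, z ^ j‖ ≤ 2 / ‖z - 1‖ := by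
  rw [geom_sum_eq hz1, norm_div]
  gcongr
  refine (norm_sub_le _ _).trans ?_
  rw [norm_pow, hz]; norm_num

lemma harmonic_le (q : ℕ) (hq : 1 ≤ q) : ∑ u ∈ Finset.Ico 1 q, (1 / (u:ℝ) + 1 / ((q:ℝ) - u)) ≤ 2 * (1 + Real.log q) := by
  have h1 : ∑ u ∈ Finset.Ico 1 q, (1 / (u:ℝ)) ≤ 1 + Real.log q := by
    have := harmonic_le_one_add_log q
    refine le_trans ?_ this
    rw [harmonic_eq_sum_Icc]
    push_cast
    simp_rw [one_div]
    refine Finset.sum_le_sum_of_subset_of_nonneg ?_ (fun i _ _ => by positivity)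
    intro x hx
    rw [Finset.mem_Ico] at hx
    rw [Finset.mem_Icc]; lia
  have h2 : ∑ u ∈ Finset.Ico 1 q, (1 / ((q:ℝ) - u)) = ∑ u ∈ Finset.Ico 1 q, (1 / (u:ℝ)) := by
    refine Finset.sum_bij (fun u _ => q - u) ?_ ?_ ?_ ?_
    · intro u hu; rw [Finset.mem_Ico] at *; lia
    · intro a ha b hb h; rw [Finset.mem_Ico] at *; lia
    · intro u hu; rw [Finset.mem_Ico] at hu; exact ⟨q - u, by rw [Finset.mem_Ico]; lia, by lia⟩
    · intro u hu; rw [Finset.mem_Ico] at hu; rw [Nat.cast_sub (by lia)]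
  rw [Finset.sum_add_distrib, h2]; linarith

theorem fourier_interval (q : ℕ) [NeZero q] (Φ : ZMod q → ℂ) (K : ℝ) (s : ZMod q) (hs : s * s = 1)
    (hK : ∀ u, ‖∑ y, ZMod.stdAddChar (u * y) * Φ y‖ ≤ K) (m : ZMod q) (n : ℕ) (hn : n ≤ q) :
    ‖∑ j ∈ Finset.range n, Φ (s * (m + j))‖ ≤ (2 + Real.log q) * K := by
  have hq0 : 0 < q := Nat.pos_of_ne_zero (NeZero.ne q)
  have hqR : (0:ℝ) < q := by exact_mod_cast hq0
  set ψ := ZMod.stdAddChar (N := q) with hψ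
  have hprim : ψ.IsPrimitive := ZMod.isPrimitive_stdAddChar q
  have hinv : ∀ y, Φ y = (1 / (q:ℂ)) * ∑ u, ψ (-(u * y)) * ∑ z, ψ (u * z) * Φ z := by
    intro y
    have h1 : ∑ u, ψ (-(u * y)) * ∑ z, ψ (u * z) * Φ z = ∑ z, (∑ u, ψ (u * (z - y))) * Φ z := by
      simp_rw [Finset.mul_sum]
      rw [Finset.sum_comm]
      refine Finset.sum_congr rfl fun z _ => ?_
      rw [Finset.sum_mul]
      refine Finset.sum_congr rfl fun u _ => ?_
      rw [← mul_assoc, ← AddChar.map_add_eq_mul]; congr 2; ring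
    rw [h1]
    have h2 : ∀ z, ∑ u, ψ (u * (z - y)) = if z = y then (q:ℂ) else 0 := by
      intro z
      have := AddChar.sum_mulShift (z - y) hprim
      rw [this, ZMod.card]
      simp [sub_eq_zero]
    simp_rw [h2]
    simp only [ite_mul, zero_mul, Finset.sum_ite_eq', Finset.mem_univ, if_true]
    have hqC : (q:ℂ) ≠ 0 := by exact_mod_cast hq0.ne'
    field_simp
  have h3 : ∑ j ∈ Finset.range n, Φ (s * (m + j)) = (1 / (q:ℂ)) * ∑ u, (∑ j ∈ Finset.range n, ψ (-(u * s * m)) * ψ (-(u * s)) ^ j) * ∑ z, ψ (u * z) * Φ z := by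
    rw [Finset.sum_congr rfl fun (j:ℕ) _ => hinv (s * (m + (j : ZMod q))), ← Finset.mul_sum, Finset.sum_comm]
    congr 1
    refine Finset.sum_congr rfl fun u _ => ?_
    rw [← Finset.sum_mul]
    congr 1
    refine Finset.sum_congr rfl fun j _ => ?_
    rw [← AddChar.map_nsmul_eq_pow, ← AddChar.map_add_eq_mul]
    congr 1
    rw [nsmul_eq_mul]; ring
  have hK0 : 0 ≤ K := (norm_nonneg _).trans (hK 0)
  set cf : ZMod q → ℝ := fun u => ‖∑ j ∈ Finset.range n, ψ u ^ j‖ with hcf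
  have h4 : ‖∑ j ∈ Finset.range n, Φ (s * (m + j))‖ ≤ (1 / (q:ℝ)) * (∑ u, cf (-(u * s))) * K := by
    rw [h3, norm_mul, mul_assoc, norm_div, norm_one, Complex.norm_natCast]
    refine mul_le_mul_of_nonneg_left ?_ (by positivity)
    rw [Finset.sum_mul]
    refine (norm_sum_le _ _).trans (Finset.sum_le_sum fun u _ => ?_)
    rw [norm_mul, ← Finset.mul_sum, norm_mul, AddChar.norm_apply, one_mul]
    exact mul_le_mul_of_nonneg_left (hK u) (norm_nonneg _)
  have h5 : ∑ u, cf (-(u * s)) = ∑ u, cf u := by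
    have hb : Function.Bijective (fun u : ZMod q => -(u * s)) := by
      refine Function.bijective_iff_has_inverse.2 ⟨fun u => -(u * s), fun u => ?_, fun u => ?_⟩ <;>
      · simp only; linear_combination u * hs
    exact Function.Bijective.sum_comp hb cf
  have h6 : ∑ u, cf u = ∑ u ∈ Finset.range q, cf (u : ZMod q) := by
    refine (Finset.sum_bij (fun u _ => ((u:ℕ) : ZMod q)) ?_ ?_ ?_ ?_).symm
    · intro u _; exact Finset.mem_univ _
    · intro a ha b hb hab
      have := congrArg ZMod.val hab
      rwa [ZMod.val_natCast_of_lt (Finset.mem_range.1 ha), ZMod.val_natCast_of_lt (Finset.mem_range.1 hb)] at this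
    · intro y _; exact ⟨y.val, Finset.mem_range.2 (ZMod.val_lt y), by simp⟩
    · intro u _; rfl
  have h7 : ∑ u ∈ Finset.range q, cf (u : ZMod q) ≤ q + q / 2 * (2 * (1 + Real.log q)) := by
    rw [Finset.range_eq_Ico, Finset.sum_eq_sum_Ico_succ_bot hq0]
    refine add_le_add ?_ ?_
    · simp only [hcf, Nat.cast_zero, AddChar.map_zero_eq_one, one_pow, Finset.sum_const, Finset.card_range, nsmul_eq_mul, mul_one, Complex.norm_natCast]
      exact_mod_cast hn
    · refine le_trans ?_ (mul_le_mul_of_nonneg_left (harmonic_le q hq0) (by positivity))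
      rw [Finset.mul_sum]
      refine Finset.sum_le_sum fun u hu => ?_
      rw [Finset.mem_Ico] at hu
      have hne : ψ ((u:ℕ) : ZMod q) ≠ 1 := by
        intro h
        rw [hprim.zmod_char_eq_one_iff] at h
        rw [ZMod.natCast_eq_zero_iff] at h
        exact absurd (Nat.le_of_dvd (by lia) h) (by lia)
      refine (geom_le _ (AddChar.norm_apply _ _) hne n).trans ?_
      have := sin_lower q u hu.1 hu.2
      calc _ = 2 * (1 / ‖ψ ((u:ℕ) : ZMod q) - 1‖) := by ring
        _ ≤ 2 * (q / 4 * (1 / u + 1 / ((q:ℝ) - u))) := by gcongr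
        _ = _ := by ring
  refine h4.trans (mul_le_mul_of_nonneg_right ?_ hK0)
  rw [h5, h6]
  rw [one_div, inv_mul_le_iff₀ hqR]
  refine h7.trans (le_of_eq ?_)
  ring
end QH
end

open scoped BigOperators
open Finset Filter Topology Matrix
noncomputable section
namespace QH
variable {ι : Type*} [Fintype ι] [DecidableEq ι]

lemma seg (p : ℕ → Prop) (hp : ∀ i j, i ≤ j → p j → p i) (q : ℕ) : ∃ n ≤ q, ∀ j < q, (p j ↔ j < n) := by
  induction q with
  | zero => exact ⟨0, le_rfl, by simp⟩
  | succ q ih =>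
    obtain ⟨n, hn, h⟩ := ih
    by_cases hq : p q
    · refine ⟨q + 1, le_rfl, fun j hj => ⟨fun _ => hj, fun _ => hp j q (by lia) hq⟩⟩
    · refine ⟨n, by lia, fun j hj => ?_⟩
      rcases Nat.lt_succ_iff_lt_or_eq.mp hj with h1 | h1
      · exact h j h1
      · subst h1; constructor
        · intro h'; exact absurd h' hq
        · intro h'; lia

def PhiG {q : ℕ} (G : ZMod q → ℂ) (y : ZMod q) : ℂ := by
  classical exact if IsUnit y then G y⁻¹ else 0

open Classical in
lemma condP_sum (q : ℕ) [NeZero q] (Q : ℕ) (G : ZMod q → ℂ) (σ : ℤ) (hσ : σ * σ = 1) (θ : ℝ) :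
    ∃ n ≤ q, ∑ b ∈ (range q).filter (fun b : ℕ => condP Q q (σ * b) θ), G (b : ZMod q)
      = ∑ j ∈ range n, PhiG G ((-σ : ℤ) * ((Q : ZMod q) + 1 + j)) := by
  by_cases hθ : 0 < θ
  swap
  · refine ⟨0, by lia, ?_⟩
    rw [Finset.filter_false_of_mem]
    · simp
    · intro b _ h; exact hθ h.1
  have hq0 : 0 < q := Nat.pos_of_ne_zero (NeZero.ne q)
  have hqR : (0:ℝ) < q := by exact_mod_cast hq0
  have hσZ : (σ : ZMod q) * σ = 1 := by exact_mod_cast congrArg (Int.cast : ℤ → ZMod q) hσ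
  obtain ⟨n, hn, hseg⟩ := seg (fun j => ((q:ℝ) + ((Q:ℝ) - q + 1 + j)) * (q * θ) < 1) (by
    intro i j hij h
    refine lt_of_le_of_lt ?_ h
    have : (i:ℝ) ≤ j := by exact_mod_cast hij
    gcongr) q
  refine ⟨n, hn, ?_⟩
  have hP : ∑ j ∈ range n, PhiG G (((-σ : ℤ) : ZMod q) * ((Q : ZMod q) + 1 + j)) = 
     ∑ j ∈ (range n).filter (fun j : ℕ => IsUnit (((-σ : ℤ) : ZMod q) * ((Q : ZMod q) + 1 + j))),
        G (((-σ : ℤ) : ZMod q) * ((Q : ZMod q) + 1 + j))⁻¹ := by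
    rw [Finset.sum_filter]
    refine Finset.sum_congr rfl fun j _ => ?_
    unfold PhiG
    congr
  rw [hP]
  symm
  have key : ∀ j ∈ (range n).filter (fun j : ℕ => IsUnit (((-σ : ℤ) : ZMod q) * ((Q : ZMod q) + 1 + j))),
      σ * (((-σ : ℤ) : ZMod q) * ((Q : ZMod q) + 1 + j))⁻¹ * ((Q : ZMod q) + 1 + j) = -1 := by
    intro j hj
    obtain ⟨hj, hu⟩ := Finset.mem_filter.mp hj
    have h1 := ZMod.inv_mul_of_unit _ hu
    set y := (((-σ : ℤ) : ZMod q) * ((Q : ZMod q) + 1 + j))⁻¹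
    push_cast at h1
    linear_combination -h1
  refine Finset.sum_bij (fun j _ => ((((-σ : ℤ) : ZMod q) * ((Q : ZMod q) + 1 + j))⁻¹).val) ?_ ?_ ?_ ?_
  · intro j hj
    have hk := key j hj
    obtain ⟨hj, hu⟩ := Finset.mem_filter.mp hj
    rw [Finset.mem_range] at hj
    refine Finset.mem_filter.mpr ⟨Finset.mem_range.mpr (ZMod.val_lt _), hθ, (Q:ℤ) - q + 1 + j, by lia, by lia, ?_, ?_⟩
    · rw [← ZMod.intCast_zmod_eq_zero_iff_dvd]
      push_cast
      rw [ZMod.natCast_zmod_val]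
      push_cast at hk
      simp only [ZMod.natCast_self]
      linear_combination hk
    · have := (hseg j (by lia)).mpr hj
      push_cast; exact this
  · intro i hi j hj h
    have h2 := ZMod.val_injective q h
    have hki := key i hi
    have hkj := key j hj
    rw [h2] at hki
    have hu := (Finset.mem_filter.mp hj).2
    have h1 := ZMod.inv_mul_of_unit _ hu
    obtain ⟨hi, -⟩ := Finset.mem_filter.mp hi
    obtain ⟨hj, -⟩ := Finset.mem_filter.mp hj
    rw [Finset.mem_range] at hi hj
    have h3 : (((-σ : ℤ) : ZMod q) * ((Q : ZMod q) + 1 + j))⁻¹ * ((i : ZMod q) - j) = 0 := by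
      have : σ * ((((-σ : ℤ) : ZMod q) * ((Q : ZMod q) + 1 + j))⁻¹ * ((i : ZMod q) - j)) = 0 := by
        linear_combination hki - hkj
      linear_combination σ * this - ((((-σ : ℤ) : ZMod q) * ((Q : ZMod q) + 1 + j))⁻¹ * ((i : ZMod q) - j)) * hσZ
    have h4 : (i : ZMod q) = j := by
      linear_combination (((-σ : ℤ) : ZMod q) * ((Q : ZMod q) + 1 + j)) * h3 - ((i : ZMod q) - j) * h1
    rw [ZMod.natCast_eq_natCast_iff'] at h4
    rwa [Nat.mod_eq_of_lt (by lia), Nat.mod_eq_of_lt (by lia)] at h4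
  · intro b hb
    obtain ⟨hb, -, r, hr1, hr2, hd, hlt⟩ := Finset.mem_filter.mp hb
    rw [Finset.mem_range] at hb
    obtain ⟨j, hj⟩ := Int.eq_ofNat_of_zero_le (show 0 ≤ r - ((Q:ℤ) - q + 1) by lia)
    have hr : r = (Q:ℤ) - q + 1 + j := by lia
    have hjq : j < q := by lia
    have hd' : (σ : ZMod q) * b * ((Q : ZMod q) + 1 + j) = -1 := by
      rw [← ZMod.intCast_zmod_eq_zero_iff_dvd, hr] at hd
      push_cast at hd
      simp only [ZMod.natCast_self] at hd
      linear_combination hd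
    have hm : (b : ZMod q) * (((-σ : ℤ) : ZMod q) * ((Q : ZMod q) + 1 + j)) = 1 := by
      push_cast; linear_combination -hd'
    have hu : IsUnit (((-σ : ℤ) : ZMod q) * ((Q : ZMod q) + 1 + j)) := IsUnit.of_mul_eq_one_right _ hm
    have hinv : (((-σ : ℤ) : ZMod q) * ((Q : ZMod q) + 1 + j))⁻¹ = b := by
      have h1 := ZMod.inv_mul_of_unit _ hu
      exact hu.mul_right_cancel (h1.trans hm.symm)
    refine ⟨j, Finset.mem_filter.mpr ⟨Finset.mem_range.mpr ((hseg j hjq).mp ?_), hu⟩, ?_⟩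
    · rw [hr] at hlt; push_cast at hlt; exact hlt
    · rw [hinv, ZMod.val_natCast, Nat.mod_eq_of_lt hb]
  · intro j hj
    rw [ZMod.natCast_zmod_val]

lemma Phi_fourier {q : ℕ} [NeZero q] (ψ : AddChar (ZMod q) ℂ) (C : Matrix ι ι ℤ) (l : ι → ℤ) (k : ℤ) (u : ZMod q) (v : ι → ZMod q) :
    ∑ y, ψ (u * y) * PhiG (fun a => GS ψ C l k a v) y = TS ψ C l k u v := by
  classical
  simp only [PhiG, TS, mul_ite, mul_zero]
  rw [← Finset.sum_filter]
  symm
  refine Finset.sum_bij (fun a _ => ((a⁻¹ : (ZMod q)ˣ) : ZMod q)) ?_ ?_ ?_ ?_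
  · intro a _; simp
  · intro a _ b _ h; exact inv_injective (Units.ext h)
  · intro y hy
    obtain ⟨-, hy⟩ := Finset.mem_filter.mp hy
    exact ⟨hy.unit⁻¹, by simp, by simp⟩
  · intro a _
    congr 2
    rw [← ZMod.inv_coe_unit]
    have hu : IsUnit ((a⁻¹ : (ZMod q)ˣ) : ZMod q) := Units.isUnit _
    have h1 := ZMod.inv_mul_of_unit _ hu
    refine hu.mul_right_cancel (Eq.trans ?_ h1.symm) |>.trans ?_
    · simp
    · rw [← ZMod.inv_coe_unit]

open Classical in
lemma cond_sum_le (q : ℕ) [NeZero q] (Q : ℕ) (C : Matrix ι ι ℤ) (l : ι → ℤ) (k : ℤ) (v : ι → ZMod q) (K : ℝ)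
    (hK : ∀ u, ‖TS (ZMod.stdAddChar (N := q)) C l k u v‖ ≤ K) (θ : ℝ) :
    ‖∑ b ∈ (range q).filter (fun b : ℕ => cond Q q b θ), GS (ZMod.stdAddChar (N := q)) C l k (b : ZMod q) v‖
      ≤ (2 + Real.log q) * K := by
  have main : ∀ (σ : ℤ) (θ : ℝ), σ * σ = 1 → 
    ‖∑ b ∈ (range q).filter (fun b : ℕ => condP Q q (σ * b) θ), GS (ZMod.stdAddChar (N := q)) C l k (b : ZMod q) v‖
      ≤ (2 + Real.log q) * K := by
    intro σ θ hσ
    obtain ⟨n, hn, h⟩ := condP_sum q Q (fun b => GS (ZMod.stdAddChar (N := q)) C l k b v) σ hσ θ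
    rw [h]
    have hσZ : ((-σ:ℤ) : ZMod q) * ((-σ : ℤ)) = 1 := by
      have : (-σ) * (-σ) = 1 := by linarith
      exact_mod_cast congrArg (Int.cast : ℤ → ZMod q) this
    refine fourier_interval q _ K _ hσZ ?_ _ n hn
    intro u
    rw [Phi_fourier]; exact hK u
  rcases lt_or_ge 0 θ with h | h
  · have := main 1 θ (by norm_num)
    convert this using 3
    ext b
    rw [Finset.mem_filter, Finset.mem_filter, one_mul]
    constructor
    · rintro ⟨h1, h2 | h2⟩
      · exact ⟨h1, h2⟩
      · exact absurd h2.1 (by linarith)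
    · rintro ⟨h1, h2⟩; exact ⟨h1, Or.inl h2⟩
  · have := main (-1) (-θ) (by norm_num)
    convert this using 3
    ext b
    rw [Finset.mem_filter, Finset.mem_filter, neg_mul, one_mul]
    constructor
    · rintro ⟨h1, h2 | h2⟩
      · exact absurd h2.1 (by linarith)
      · exact ⟨h1, h2⟩
    · rintro ⟨h1, h2⟩; exact ⟨h1, Or.inr h2⟩
end QH
end

open scoped BigOperators
open Finset Filter Topology Matrix
noncomputable section
namespace QH
variable {ι : Type*} [Fintype ι] [DecidableEq ι]

/-- number of lattice points in a ball -/
def nb (φ : (ι → ℤ) →+ (ι → ℝ)) (X : ℝ) : ℕ := Set.ncard {v | ‖φ v‖ ≤ X}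

/-- theta constant -/
def gK (ι : Type*) [Fintype ι] : ℝ := ∑' m : ι → ℤ, Real.exp (-Real.pi * ∑ i, (1/2:ℝ) * (m i:ℝ) ^ 2)

lemma gK_summable : Summable (fun m : ι → ℤ => Real.exp (-Real.pi * ∑ i, (1/2:ℝ) * (m i:ℝ) ^ 2)) := by
  have := summable_gauss (1 : Matrix ι ι ℝ) (by simp) (fun _ => (1/2:ℝ)) (by intro i; norm_num) (fun _ => 0)
  simpa using this

lemma gauss_le_nb (φ : (ι → ℤ) →+ (ι → ℝ)) (hfin : ∀ X : ℝ, {v | ‖φ v‖ ≤ X}.Finite) (X : ℝ) (hX : 0 < X)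
    (S : Finset (ι → ℤ)) :
    ∑ v ∈ S, Real.exp (-Real.pi * ((∑ i, (φ v i) ^ 2) / X ^ 2)) ≤
      Real.exp (Real.pi * Fintype.card ι) * gK ι * nb φ X := by
  have hpi := Real.pi_pos
  let κ : (ι → ℤ) → (ι → ℤ) := fun v i => ⌊φ v i / X⌋
  have hterm : ∀ v, Real.exp (-Real.pi * ((∑ i, (φ v i) ^ 2) / X ^ 2)) ≤
      Real.exp (Real.pi * Fintype.card ι) * Real.exp (-Real.pi * ∑ i, (1/2:ℝ) * (κ v i:ℝ) ^ 2) := by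
    intro v
    rw [← Real.exp_add]
    apply Real.exp_le_exp.mpr
    have : ∑ i, (1/2:ℝ) * (κ v i:ℝ) ^ 2 ≤ Fintype.card ι + (∑ i, (φ v i) ^ 2) / X ^ 2 := by
      rw [Finset.sum_div, Fintype.card_eq_sum_ones]; push_cast
      rw [← Finset.sum_add_distrib]
      apply Finset.sum_le_sum; intro i _
      rw [← div_pow]
      have h1 := Int.floor_le (φ v i / X)
      have h2 := Int.lt_floor_add_one (φ v i / X)
      simp only [κ]
      set x := φ v i / X
      set z : ℝ := (⌊x⌋ : ℝ)
      nlinarith [sq_nonneg (z - 2 * (z - x)), sq_nonneg (x - (x - z)), mul_nonneg (sub_nonneg.2 h1) (by linarith : 0 ≤ z + 1 - x), sq_nonneg (x + (x - z))]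
    nlinarith
  have hfib : ∀ k, ((S.filter (fun v => κ v = k)).card : ℝ) ≤ nb φ X := by
    intro k
    rcases (S.filter (fun v => κ v = k)).eq_empty_or_nonempty with h | ⟨v0, hv0⟩
    · rw [h]; simp
    · rw [Finset.mem_filter] at hv0
      have : (S.filter (fun v => κ v = k)).card ≤ nb φ X := by
        rw [nb, ← Set.ncard_coe_finset]
        refine Set.ncard_le_ncard_of_injOn (fun v => v - v0) ?_ ?_ (hfin X)
        · intro v hv
          have hv' := (Finset.mem_filter.mp (Finset.mem_coe.mp hv)).2
          simp only [Set.mem_setOf_eq]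
          rw [map_sub, pi_norm_le_iff_of_nonneg hX.le]
          intro i
          have e : ⌊φ v i / X⌋ = ⌊φ v0 i / X⌋ := by
            have := congrFun (hv'.trans hv0.2.symm) i
            exact this
          have := Int.abs_sub_lt_one_of_floor_eq_floor e
          rw [← sub_div, abs_div, abs_of_pos hX, div_lt_one hX] at this
          exact this.le
        · intro a _ b _ h; simpa using h
      exact_mod_cast this
  calc ∑ v ∈ S, Real.exp (-Real.pi * ((∑ i, (φ v i) ^ 2) / X ^ 2)) 
      ≤ ∑ v ∈ S, Real.exp (Real.pi * Fintype.card ι) * Real.exp (-Real.pi * ∑ i, (1/2:ℝ) * (κ v i:ℝ) ^ 2) :=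
        Finset.sum_le_sum fun v _ => hterm v
    _ = Real.exp (Real.pi * Fintype.card ι) * ∑ v ∈ S, Real.exp (-Real.pi * ∑ i, (1/2:ℝ) * (κ v i:ℝ) ^ 2) := by
        rw [Finset.mul_sum]
    _ = Real.exp (Real.pi * Fintype.card ι) * ∑ k ∈ S.image κ, ((S.filter (fun v => κ v = k)).card : ℝ) * Real.exp (-Real.pi * ∑ i, (1/2:ℝ) * (k i:ℝ) ^ 2) := by
        congr 1
        rw [← Finset.sum_fiberwise_of_maps_to (t := S.image κ) (g := κ) (fun v hv => Finset.mem_image_of_mem _ hv)]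
        refine Finset.sum_congr rfl fun k _ => ?_
        rw [← nsmul_eq_mul]
        apply Finset.sum_eq_card_nsmul
        intro v hv
        rw [(Finset.mem_filter.mp hv).2]
    _ ≤ Real.exp (Real.pi * Fintype.card ι) * ∑ k ∈ S.image κ, (nb φ X : ℝ) * Real.exp (-Real.pi * ∑ i, (1/2:ℝ) * (k i:ℝ) ^ 2) := by
        gcongr with k _; exact_mod_cast hfib k
    _ = Real.exp (Real.pi * Fintype.card ι) * (∑ k ∈ S.image κ, Real.exp (-Real.pi * ∑ i, (1/2:ℝ) * (k i:ℝ) ^ 2)) * nb φ X := by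
        rw [← Finset.mul_sum]; ring
    _ ≤ _ := by
        gcongr
        exact gK_summable.sum_le_tsum _ (fun _ _ => (Real.exp_pos _).le)

lemma nb_le (φ : (ι → ℤ) →+ (ι → ℝ)) (hfin : ∀ X : ℝ, {v | ‖φ v‖ ≤ X}.Finite) (X X0 : ℝ) (hX : 0 < X) (hX0 : X ≤ X0) :
    (nb φ X : ℝ) ≤ 1 + X * nb φ (4 * X0 + 3) := by
  by_cases h : ∃ v, v ≠ 0 ∧ ‖φ v‖ ≤ X
  swap
  · push Not at h
    have : nb φ X ≤ 1 := by
      rw [nb]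
      refine (Set.ncard_le_ncard (t := {0}) ?_).trans (by simp)
      intro v hv
      by_contra hne
      exact absurd (h v hne) (not_lt.mpr hv)
    have h1 : (nb φ X : ℝ) ≤ 1 := by exact_mod_cast this
    have : 0 ≤ X * nb φ (4 * X0 + 3) := by positivity
    linarith
  obtain ⟨v, hv0, hv⟩ := h
  have hsm : ∀ m : ℕ, φ (m • v) = (m : ℝ) • φ v := by
    intro m; rw [map_nsmul, Nat.cast_smul_eq_nsmul]
  have hpos : 0 < ‖φ v‖ := by
    by_contra hc
    have hz : φ v = 0 := by
      rw [← norm_le_zero_iff]; linarith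
    have hinf : (Set.range (fun m : ℕ => m • v)).Infinite := by
      apply Set.infinite_range_of_injective
      intro a b hab
      obtain ⟨i, hi⟩ := Function.ne_iff.mp hv0
      have h1 := congrFun hab i
      simp only [Pi.smul_apply, nsmul_eq_mul] at h1
      have h2 := mul_right_cancel₀ hi h1
      exact_mod_cast h2
    apply hinf
    refine (hfin 0).subset ?_
    rintro _ ⟨m, rfl⟩
    have := hsm m
    rw [hz, smul_zero] at this
    simp only [Set.mem_setOf_eq, this, norm_zero, le_refl]
  obtain ⟨m, hm1, hm2⟩ : ∃ m : ℕ, 2 * X < m * ‖φ v‖ ∧ m * ‖φ v‖ ≤ 3 * X := by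
    refine ⟨⌊2 * X / ‖φ v‖⌋₊ + 1, ?_, ?_⟩
    · have := Nat.lt_floor_add_one (2 * X / ‖φ v‖)
      rw [div_lt_iff₀ hpos] at this
      push_cast; exact this
    · have := Nat.floor_le (a := 2 * X / ‖φ v‖) (by positivity)
      rw [le_div_iff₀ hpos] at this
      push_cast; linarith
  set u := m • v with hu
  have hun : ‖φ u‖ = m * ‖φ v‖ := by rw [hu, hsm, norm_smul]; simp
  set J := ⌈1 / X⌉₊ with hJ
  have hJ1 : 1 / X ≤ J := Nat.le_ceil _
  have hJ2 : (J:ℝ) < 1 / X + 1 := Nat.ceil_lt_add_one (by positivity)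
  have hmain : nb φ X * J ≤ nb φ (4 * X0 + 3) := by
    set s := (hfin X).toFinset
    have hs : nb φ X = s.card := Set.ncard_eq_toFinset_card _ (hfin X)
    rw [hs, ← Finset.card_range J, ← Finset.card_product, nb, ← Set.ncard_coe_finset]
    refine Set.ncard_le_ncard_of_injOn (fun p => p.1 + p.2 • u) ?_ ?_ (hfin _)
    · rintro ⟨w, j⟩ hp
      simp only [Finset.coe_product, Set.mem_prod, Finset.mem_coe, Finset.mem_range] at hp
      have hw : ‖φ w‖ ≤ X := by simpa [s] using hp.1
      simp only [Set.mem_setOf_eq]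
      have e : φ (w + j • u) = φ w + (j:ℝ) • φ u := by rw [map_add, map_nsmul, Nat.cast_smul_eq_nsmul]
      rw [e]
      refine (norm_add_le _ _).trans ?_
      rw [norm_smul, hun]
      have hj : (j:ℝ) ≤ 1 / X := by
        have : (j:ℝ) + 1 ≤ J := by exact_mod_cast hp.2
        linarith
      simp only [Real.norm_natCast]
      have : (j:ℝ) * (m * ‖φ v‖) ≤ 1 / X * (3 * X) := by gcongr
      have e3 : 1 / X * (3 * X) = 3 := by field_simp
      linarith
    · rintro ⟨w, j⟩ hp ⟨w', j'⟩ hp' h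
      simp only [Finset.coe_product, Set.mem_prod, Finset.mem_coe, Finset.mem_range] at hp hp'
      have hw : ‖φ w‖ ≤ X := by simpa [s] using hp.1
      have hw' : ‖φ w'‖ ≤ X := by simpa [s] using hp'.1
      simp only at h
      have e := congrArg φ h
      rw [map_add, map_add, map_nsmul φ j u, map_nsmul φ j' u] at e
      have hd : φ w - φ w' = ((j':ℝ) - j) • φ u := by
        have e' : φ w + (j:ℝ) • φ u = φ w' + (j':ℝ) • φ u := by
          rw [Nat.cast_smul_eq_nsmul, Nat.cast_smul_eq_nsmul]; exact e
        rw [sub_smul]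
        rw [sub_eq_sub_iff_add_eq_add, e', add_comm]
      have hn : |(j':ℝ) - j| * ‖φ u‖ ≤ 2 * X := by
        rw [← Real.norm_eq_abs, ← norm_smul, ← hd]
        refine (norm_sub_le _ _).trans (by linarith)
      have hjj : j = j' := by
        by_contra hne
        have h1 : (1:ℝ) ≤ |(j':ℝ) - j| := by
          have : (1:ℤ) ≤ |(j':ℤ) - j| := Int.one_le_abs (by lia)
          exact_mod_cast this
        rw [hun] at hn
        nlinarith
      subst hjj
      simp only [add_left_inj] at h
      rw [h]
  have h2 : (nb φ X : ℝ) * J ≤ nb φ (4 * X0 + 3) := by exact_mod_cast hmain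
  have h3 : (nb φ X : ℝ) * (1 / X) ≤ nb φ (4 * X0 + 3) := le_trans (by gcongr) h2
  have h4 : (nb φ X : ℝ) = X * (nb φ X * (1 / X)) := by field_simp
  rw [h4]
  have : X * (nb φ X * (1 / X)) ≤ X * nb φ (4 * X0 + 3) := by gcongr
  linarith
end QH
end

open scoped BigOperators
open Finset Filter Topology Matrix
noncomputable section
namespace QH
variable {ι : Type*} [Fintype ι] [DecidableEq ι]

/-- entrywise absolute sum -/
def mabs (Y : Matrix ι ι ℝ) : ℝ := ∑ i, ∑ j, |Y i j|

lemma mabs_nonneg (Y : Matrix ι ι ℝ) : 0 ≤ mabs Y := by unfold mabs; positivity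

lemma mv_le (Y : Matrix ι ι ℝ) (y : ι → ℝ) : ‖Y *ᵥ y‖ ≤ mabs Y * ‖y‖ := by
  rw [pi_norm_le_iff_of_nonneg (mul_nonneg (mabs_nonneg Y) (norm_nonneg _))]
  intro i
  calc ‖(Y *ᵥ y) i‖ = ‖∑ j, Y i j * y j‖ := rfl
    _ ≤ ∑ j, |Y i j| * ‖y‖ := by
      refine (norm_sum_le _ _).trans (Finset.sum_le_sum fun j _ => ?_)
      rw [norm_mul, Real.norm_eq_abs]
      gcongr; exact norm_le_pi_norm y j
    _ = (∑ j, |Y i j|) * ‖y‖ := by rw [Finset.sum_mul]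
    _ ≤ mabs Y * ‖y‖ := by
      gcongr
      exact Finset.single_le_sum (f := fun i => ∑ j, |Y i j|) (fun i _ => by positivity) (Finset.mem_univ i)

lemma int_ball_finite (K : ℝ) : {m : ι → ℤ | ‖(fun i => (m i:ℝ))‖ ≤ K}.Finite := by
  classical
  refine (Set.finite_Icc (fun _ : ι => -⌈K⌉) (fun _ : ι => ⌈K⌉)).subset ?_
  intro m hm
  have h : ∀ i, |m i| ≤ ⌈K⌉ := by
    intro i
    have h1 : |(m i:ℝ)| ≤ K := (norm_le_pi_norm (fun i => (m i:ℝ)) i).trans hm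
    have h2 : |(m i:ℝ)| ≤ ⌈K⌉ := h1.trans (Int.le_ceil _)
    exact_mod_cast h2
  exact ⟨fun i => (abs_le.mp (h i)).1, fun i => (abs_le.mp (h i)).2⟩

/-- the real scaling matrix -/
def gR (i0 i1 : ι) (R : ℝ) : Matrix ι ι ℝ := Matrix.diagonal fun i => if i = i0 then R⁻¹ else if i = i1 then R else 1

/-- the diagonal of moduli -/
def dL (i0 : ι) (L : ℕ) (i : ι) : ℤ := if i = i0 then (L:ℤ) else 1

/-- the matrix P -/
def PM (A M : Matrix ι ι ℝ) (W : Matrix ι ι ℤ) (i0 i1 : ι) (R : ℝ) (L : ℕ) : Matrix ι ι ℝ :=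
  A * gR i0 i1 R * M * ((W * Matrix.diagonal (dL i0 L)).map (Int.cast : ℤ → ℝ))

lemma boxcount (A M : Matrix ι ι ℝ) (i0 i1 : ι) (hi : i1 ≠ i0) (K : ℝ) (hK : 0 ≤ K) :
    ∃ C : ℝ, 0 < C ∧ ∀ R : ℝ, 1 ≤ R → ∀ L : ℕ, 1 ≤ L → ∀ W W' : Matrix ι ι ℤ, W * W' = 1 → 
      (PM A M W i0 i1 R L).det ≠ 0 → ∀ S : Finset (ι → ℤ), 
      (∀ v ∈ S, ‖((PM A M W i0 i1 R L)⁻¹)ᵀ *ᵥ (fun i => (v i:ℝ))‖ ≤ K) → (S.card : ℝ) ≤ C * L * R := by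
  classical
  set K' := mabs Aᵀ * K with hK'
  have hK'0 : 0 ≤ K' := mul_nonneg (mabs_nonneg _) hK
  set K2 := mabs Mᵀ * (2 * K' + 1) with hK2
  set c := (int_ball_finite (ι := ι) K2).toFinset.card with hc
  refine ⟨(c + 1) * (2 * K' + 3), by positivity, ?_⟩
  intro R hR L hL W W' hW hdet S hS
  have hW' : W' * W = 1 := mul_eq_one_comm.mp hW
  set P := PM A M W i0 i1 R L with hP
  have hLR : (0:ℝ) < L := by exact_mod_cast hL
  have hR0 : 0 < R := by linarith
  let s : (ι → ℤ) → (ι → ℝ) := fun v => gR i0 i1 R *ᵥ (Aᵀ *ᵥ ((P⁻¹)ᵀ *ᵥ (fun i => (v i:ℝ))))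
  have hv : ∀ v : ι → ℤ, ∀ i, (v i:ℝ) = (dL i0 L i : ℝ) * (((W.map (Int.cast : ℤ → ℝ))ᵀ *ᵥ (Mᵀ *ᵥ s v)) i) := by
    intro v i
    have h1 : Pᵀ *ᵥ ((P⁻¹)ᵀ *ᵥ (fun i => (v i:ℝ))) = fun i => (v i:ℝ) := by
      rw [Matrix.mulVec_mulVec, ← Matrix.transpose_mul, Matrix.nonsing_inv_mul _ (isUnit_iff_ne_zero.mpr hdet)]
      simp
    have h2 : Pᵀ = Matrix.diagonal (fun i => (dL i0 L i : ℝ)) * (W.map (Int.cast : ℤ → ℝ))ᵀ * Mᵀ * gR i0 i1 R * Aᵀ := by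
      rw [hP, PM]
      have : (W * Matrix.diagonal (dL i0 L)).map (Int.cast : ℤ → ℝ) = W.map (Int.cast : ℤ → ℝ) * Matrix.diagonal (fun i => (dL i0 L i : ℝ)) := by
        have := Matrix.map_mul (L := W) (M := Matrix.diagonal (dL i0 L)) (f := Int.castRingHom ℝ)
        simp only [Int.coe_castRingHom] at this
        rw [this, Matrix.diagonal_map (by simp)]
      rw [this]
      simp only [Matrix.transpose_mul, Matrix.diagonal_transpose, gR, Matrix.mul_assoc]
    have h3 := congrFun h1 i
    rw [h2] at h3
    simp only [← Matrix.mulVec_mulVec, Matrix.mulVec_diagonal] at h3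
    simp only [s]
    exact h3.symm
  have hy : ∀ v ∈ S, ∀ i, |(Aᵀ *ᵥ ((P⁻¹)ᵀ *ᵥ (fun i => (v i:ℝ)))) i| ≤ K' := by
    intro v hvS i
    refine (norm_le_pi_norm (Aᵀ *ᵥ ((P⁻¹)ᵀ *ᵥ (fun i => (v i:ℝ)))) i).trans ?_
    refine (mv_le _ _).trans ?_
    exact mul_le_mul_of_nonneg_left (hS v hvS) (mabs_nonneg _)
  have hs1 : ∀ v ∈ S, |s v i1| ≤ K' * R := by
    intro v hvS
    simp only [s, gR, Matrix.mulVec_diagonal, hi, if_false, if_true]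
    rw [abs_mul, abs_of_pos hR0, mul_comm]
    exact mul_le_mul_of_nonneg_right (hy v hvS i1) hR0.le
  have hsi : ∀ v ∈ S, ∀ i, i ≠ i1 → |s v i| ≤ K' := by
    intro v hvS i hii
    have := hy v hvS i
    simp only [s, gR, Matrix.mulVec_diagonal, hii, if_false]
    split_ifs
    · rw [abs_mul, abs_of_pos (inv_pos.mpr hR0)]
      calc _ ≤ 1 * K' := by gcongr; exact inv_le_one_of_one_le₀ hR
        _ = K' := one_mul _
    · simpa using this
  let κ : (ι → ℤ) → ℤ × ℤ := fun v => (v i0 % L, ⌊s v i1⌋)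
  set T : Finset (ℤ × ℤ) := (Finset.Ico 0 (L:ℤ)) ×ˢ (Finset.Icc (-⌈K' * R⌉) ⌈K' * R⌉) with hT
  have hmaps : ∀ v ∈ S, κ v ∈ T := by
    intro v hvS
    rw [hT, Finset.mem_product, Finset.mem_Ico, Finset.mem_Icc]
    have h := abs_le.mp (hs1 v hvS)
    refine ⟨⟨Int.emod_nonneg _ (by lia), Int.emod_lt_of_pos _ (by lia)⟩, ?_, ?_⟩
    · simp only [κ]
      rw [Int.le_floor]; push_cast
      linarith [Int.le_ceil (K' * R)]
    · simp only [κ]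
      have : (⌊s v i1⌋:ℝ) ≤ ⌈K' * R⌉ := (Int.floor_le _).trans (h.2.trans (Int.le_ceil _))
      exact_mod_cast this
  have hfib : ∀ k ∈ T, (S.filter (fun v => κ v = k)).card ≤ c := by
    intro k _
    rcases (S.filter (fun v => κ v = k)).eq_empty_or_nonempty with h | ⟨v0, hv0⟩
    · rw [h]; simp
    · obtain ⟨hv0S, hv0k⟩ := Finset.mem_filter.mp hv0
      let m' : (ι → ℤ) → (ι → ℤ) := fun v i => (v i - v0 i) / dL i0 L i
      have hm' : ∀ v ∈ S.filter (fun v => κ v = k), ∀ i, dL i0 L i * m' v i = v i - v0 i := by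
        intro v hv i
        obtain ⟨hvS, hvk⟩ := Finset.mem_filter.mp hv
        apply Int.mul_ediv_cancel'
        simp only [dL]
        split_ifs with hii
        · subst hii
          have : v i % L = v0 i % L := congrArg Prod.fst (hvk.trans hv0k.symm)
          exact Int.ModEq.dvd (show v0 i ≡ v i [ZMOD L] from this.symm)
        · exact one_dvd _
      have hdne : ∀ i, (dL i0 L i : ℝ) ≠ 0 := by
        intro i; simp only [dL]; split_ifs
        · exact_mod_cast (by lia : L ≠ 0)
        · simp
      have hcast : ∀ v ∈ S.filter (fun v => κ v = k), (fun i => ((W'ᵀ *ᵥ m' v) i : ℝ)) = Mᵀ *ᵥ (s v - s v0) := by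
        intro v hvf
        have e1 : (fun i => (m' v i : ℝ)) = (W.map (Int.cast : ℤ → ℝ))ᵀ *ᵥ (Mᵀ *ᵥ (s v - s v0)) := by
          funext i
          have e2 : (dL i0 L i : ℝ) * (m' v i : ℝ) = v i - v0 i := by exact_mod_cast congrArg (Int.cast : ℤ → ℝ) (hm' v hvf i)
          rw [hv v i, hv v0 i, ← mul_sub] at e2
          rw [mul_left_cancel₀ (hdne i) e2, Matrix.mulVec_sub, Matrix.mulVec_sub]; rfl
        have e3 : (fun i => ((W'ᵀ *ᵥ m' v) i : ℝ)) = (W'.map (Int.cast : ℤ → ℝ))ᵀ *ᵥ (fun i => (m' v i : ℝ)) := by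
          funext i
          simp [Matrix.mulVec, dotProduct]
        rw [e3, e1, Matrix.mulVec_mulVec, ← Matrix.transpose_mul]
        have : W.map (Int.cast : ℤ → ℝ) * W'.map (Int.cast : ℤ → ℝ) = 1 := by
          have := Matrix.map_mul (L := W) (M := W') (f := Int.castRingHom ℝ)
          simp only [Int.coe_castRingHom] at this
          rw [← this, hW, Matrix.map_one _ (by simp) (by simp)]
        rw [this]; simp
      rw [hc]
      refine Finset.card_le_card_of_injOn (fun v => W'ᵀ *ᵥ m' v) ?_ ?_
      · intro v hvf
        have hvf' := Finset.mem_coe.mp hvf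
        obtain ⟨hvS, hvk⟩ := Finset.mem_filter.mp hvf'
        rw [Finset.mem_coe, Set.Finite.mem_toFinset, Set.mem_setOf_eq, hcast v hvf']
        refine (mv_le _ _).trans ?_
        rw [hK2]
        refine mul_le_mul_of_nonneg_left ?_ (mabs_nonneg _)
        rw [pi_norm_le_iff_of_nonneg (by positivity)]
        intro i
        rw [Pi.sub_apply, Real.norm_eq_abs]
        by_cases hii : i = i1
        · subst hii
          have e : ⌊s v i⌋ = ⌊s v0 i⌋ := congrArg Prod.snd (hvk.trans hv0k.symm)
          have := Int.abs_sub_lt_one_of_floor_eq_floor e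
          linarith
        · have h1 := hsi v hvS i hii
          have h2 := hsi v0 hv0S i hii
          have := abs_sub (s v i) (s v0 i)
          linarith
      · intro v hvf w hwf h
        have hvf' := Finset.mem_coe.mp hvf
        have hwf' := Finset.mem_coe.mp hwf
        have h2 : m' v = m' w := by
          have := congrArg (fun z => Wᵀ *ᵥ z) h
          simp only [Matrix.mulVec_mulVec, ← Matrix.transpose_mul, hW'] at this
          simpa using this
        funext i
        have h3 := hm' v hvf' i
        have h4 := hm' w hwf' i
        rw [h2, h4] at h3
        linarith
  have hcard := Finset.card_le_mul_card_image_of_maps_to hmaps c hfib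
  have hTc : (T.card : ℝ) ≤ L * ((2 * K' + 3) * R) := by
    rw [hT, Finset.card_product, Int.card_Ico, Int.card_Icc]
    rw [Nat.cast_mul]
    have h0 : 0 ≤ ⌈K' * R⌉ := Int.ceil_nonneg (by positivity)
    have e1 : (((L:ℤ) - 0).toNat : ℝ) = L := by rw [sub_zero, Int.toNat_natCast]
    have e2 : (((⌈K' * R⌉ + 1 - -⌈K' * R⌉).toNat : ℕ) : ℝ) = ⌈K' * R⌉ + 1 + ⌈K' * R⌉ := by
      have : (((⌈K' * R⌉ + 1 - -⌈K' * R⌉).toNat : ℕ) : ℤ) = ⌈K' * R⌉ + 1 + ⌈K' * R⌉ := by lia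
      exact_mod_cast this
    rw [e1, e2]
    have := Int.ceil_lt_add_one (K' * R)
    gcongr
    nlinarith
  calc (S.card : ℝ) ≤ c * T.card := by exact_mod_cast hcard
    _ ≤ (c + 1) * (L * ((2 * K' + 3) * R)) := by
        clear_value c
        exact mul_le_mul (by linarith) hTc (Nat.cast_nonneg _) (by positivity)
    _ = _ := by ring

lemma gauss_bound (A M : Matrix ι ι ℝ) (i0 i1 : ι) (hi : i1 ≠ i0) (X0 : ℝ) (hX0 : 0 ≤ X0) :
    ∃ C : ℝ, 0 < C ∧ ∀ R : ℝ, 1 ≤ R → ∀ L : ℕ, 1 ≤ L → ∀ W W' : Matrix ι ι ℤ, W * W' = 1 → 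
      (PM A M W i0 i1 R L).det ≠ 0 → ∀ X : ℝ, 0 < X → X ≤ X0 → ∀ S : Finset (ι → ℤ), 
      ∑ v ∈ S, Real.exp (-Real.pi * ((∑ i, (((PM A M W i0 i1 R L)⁻¹)ᵀ *ᵥ (fun i => (v i:ℝ))) i ^ 2) / X ^ 2))
       ≤ C * (1 + X * L * R) := by
  obtain ⟨C, hC, h⟩ := boxcount A M i0 i1 hi (4 * X0 + 3) (by positivity)
  have hg : 0 ≤ gK ι := tsum_nonneg fun _ => (Real.exp_pos _).le
  refine ⟨Real.exp (Real.pi * Fintype.card ι) * (gK ι + 1) * (1 + C), by positivity, ?_⟩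
  intro R hR L hL W W' hW hdet X hX hXX S
  set P := PM A M W i0 i1 R L with hP
  let φ : (ι → ℤ) →+ (ι → ℝ) := 
    { toFun := fun v => (P⁻¹)ᵀ *ᵥ (fun i => (v i:ℝ))
      map_zero' := by
        have : (fun i => (((0 : ι → ℤ) i : ℤ):ℝ)) = 0 := by funext i; simp
        rw [this, Matrix.mulVec_zero]
      map_add' := by intro v w; rw [← Matrix.mulVec_add]; congr 1; funext i; simp }
  have hfin : ∀ X : ℝ, {v | ‖φ v‖ ≤ X}.Finite := by
    intro X
    refine (int_ball_finite (mabs Pᵀ * X)).subset ?_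
    intro v hv
    have h1 : Pᵀ *ᵥ ((P⁻¹)ᵀ *ᵥ (fun i => (v i:ℝ))) = fun i => (v i:ℝ) := by
      rw [Matrix.mulVec_mulVec, ← Matrix.transpose_mul, Matrix.nonsing_inv_mul _ (isUnit_iff_ne_zero.mpr hdet)]
      simp
    simp only [Set.mem_setOf_eq]
    rw [← h1]
    refine (mv_le _ _).trans (mul_le_mul_of_nonneg_left hv (mabs_nonneg _))
  have h1 := gauss_le_nb φ hfin X hX S
  have h2 := nb_le φ hfin X X0 hX hXX
  have h3 : (nb φ (4 * X0 + 3) : ℝ) ≤ C * L * R := by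
    rw [nb, Set.ncard_eq_toFinset_card _ (hfin _)]
    refine h R hR L hL W W' hW hdet _ ?_
    intro v hv
    rw [Set.Finite.mem_toFinset] at hv
    exact hv
  refine h1.trans ?_
  have hXLR : 0 ≤ X * L * R := by positivity
  have h4 : (nb φ X : ℝ) ≤ (1 + C) * (1 + X * L * R) := by
    have : X * nb φ (4 * X0 + 3) ≤ X * (C * L * R) := by gcongr
    nlinarith
  calc _ ≤ Real.exp (Real.pi * Fintype.card ι) * (gK ι + 1) * ((1 + C) * (1 + X * L * R)) := by gcongr; linarith
    _ = _ := by ring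
end QH
end

open scoped BigOperators
open Finset Filter Topology Matrix
noncomputable section
namespace QH
variable {ι : Type*} [Fintype ι] [DecidableEq ι]

lemma vecMul_tv (l : ι → ℤ) (i j : ι) (c : ℤ) (a : ι) :
    (l ᵥ* Matrix.transvection i j c) a = l a + if a = j then l i * c else 0 := by
  rw [Matrix.transvection, Matrix.vecMul_add, Matrix.vecMul_one, Pi.add_apply]
  congr 1
  simp only [Matrix.vecMul, dotProduct, Matrix.single_apply]
  by_cases h : a = j
  · subst h
    simp
  · simp [h, Ne.symm h]

lemma uni_exists (i0 : ι) (l : ι → ℤ) : ∃ W W' : Matrix ι ι ℤ, W * W' = 1 ∧ ∀ i ≠ i0, (l ᵥ* W) i = 0 := by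
  have step : ∀ (l : ι → ℤ) (i j : ι) (c : ℤ), i ≠ j → 
      (∃ W W' : Matrix ι ι ℤ, W * W' = 1 ∧ ∀ a ≠ i0, ((l ᵥ* Matrix.transvection i j c) ᵥ* W) a = 0) →
      ∃ W W' : Matrix ι ι ℤ, W * W' = 1 ∧ ∀ a ≠ i0, (l ᵥ* W) a = 0 := by
    rintro l i j c hij ⟨W, W', hW, h⟩
    refine ⟨Matrix.transvection i j c * W, W' * Matrix.transvection i j (-c), ?_, ?_⟩
    · calc Matrix.transvection i j c * W * (W' * Matrix.transvection i j (-c)) 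
          = Matrix.transvection i j c * (W * W') * Matrix.transvection i j (-c) := by simp only [Matrix.mul_assoc]
        _ = 1 := by rw [hW, Matrix.mul_one, Matrix.transvection_mul_transvection_same i j hij]; simp
    · intro a ha
      rw [← Matrix.vecMul_vecMul]; exact h a ha
  induction hs : ∑ i, (l i).natAbs using Nat.strong_induction_on generalizing l with
  | _ s ih =>
  by_cases h0 : ∀ i ≠ i0, l i = 0
  · exact ⟨1, 1, by simp, by simpa using h0⟩
  push Not at h0
  obtain ⟨j, hj, hlj⟩ := h0
  have red : ∀ i j, i ≠ j → l i ≠ 0 → l j ≠ 0 → (l i).natAbs ≤ (l j).natAbs → 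
      ∃ W W' : Matrix ι ι ℤ, W * W' = 1 ∧ ∀ a ≠ i0, (l ᵥ* W) a = 0 := by
    intro i j hij hi hj hle
    obtain ⟨c, hc⟩ : ∃ c : ℤ, (l j + l i * c).natAbs < (l j).natAbs := by
      rcases le_or_gt 0 (l i) with h1 | h1 <;> rcases le_or_gt 0 (l j) with h2 | h2
      · exact ⟨-1, by lia⟩
      · exact ⟨1, by lia⟩
      · exact ⟨1, by lia⟩
      · exact ⟨-1, by lia⟩
    refine step l i j c hij (ih _ ?_ _ rfl)
    rw [← hs]
    refine Finset.sum_lt_sum (fun a _ => ?_) ⟨j, Finset.mem_univ _, ?_⟩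
    · rw [vecMul_tv]; split_ifs with h
      · subst h; exact hc.le
      · simp
    · rw [vecMul_tv]; simpa using hc
  by_cases h1 : ∃ i, i ≠ j ∧ l i ≠ 0
  · obtain ⟨i, hij, hi⟩ := h1
    rcases le_total (l i).natAbs (l j).natAbs with h | h
    · exact red i j hij hi hlj h
    · exact red j i hij.symm hlj hi h
  · push Not at h1
    refine step l j i0 1 hj (step _ i0 j (-1) hj.symm ⟨1, 1, by simp, ?_⟩)
    intro a ha
    rw [Matrix.vecMul_one, vecMul_tv, vecMul_tv, vecMul_tv]
    have := h1 i0 hj.symm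
    by_cases haj : a = j
    · subst haj; simp [ha, this]
    · simp [haj, ha, h1 a haj]
end QH
end

open scoped BigOperators
open Finset Filter Topology Matrix
noncomputable section
namespace QH
variable {ι : Type*} [Fintype ι] [DecidableEq ι]

lemma det_PM (A M : Matrix ι ι ℝ) (W W' : Matrix ι ι ℤ) (hW : W * W' = 1) (i0 i1 : ι) (hi : i1 ≠ i0) (R : ℝ) (hR : 0 < R) (L : ℕ) :
    |(PM A M W i0 i1 R L).det| = |A.det| * |M.det| * L := by
  have hg : (gR i0 i1 R).det = 1 := by
    rw [gR, Matrix.det_diagonal, ← Finset.mul_prod_erase _ _ (Finset.mem_univ i0), 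
      ← Finset.mul_prod_erase _ _ (Finset.mem_erase.mpr ⟨hi, Finset.mem_univ i1⟩), Finset.prod_eq_one]
    · simp [hi, hR.ne']
    · intro i hii
      simp only [Finset.mem_erase] at hii
      simp [hii.1, hii.2.1]
  have hWd : |W.det| = 1 := by
    have : W.det * W'.det = 1 := by rw [← Matrix.det_mul, hW, Matrix.det_one]
    exact Int.isUnit_iff_abs_eq.mp (IsUnit.of_mul_eq_one _ this)
  have hd : (Matrix.diagonal (dL i0 L)).det = L := by
    rw [Matrix.det_diagonal, Finset.prod_eq_single i0]
    · simp [dL]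
    · intro b _ hb; simp [dL, hb]
    · simp
  have h2 : ((W * Matrix.diagonal (dL i0 L)).map (Int.cast : ℤ → ℝ)).det = ((W.det * L : ℤ) : ℝ) := by
    have := (Int.castRingHom ℝ).map_det (W * Matrix.diagonal (dL i0 L))
    rw [Matrix.det_mul, hd] at this
    exact this.symm
  have h3 : |((W.det * L : ℤ) : ℝ)| = L := by
    rw [← Int.cast_abs, abs_mul, hWd]; simp
  rw [PM, Matrix.det_mul, Matrix.det_mul, Matrix.det_mul, hg, h2, abs_mul, h3, mul_one, abs_mul]

variable {P : Matrix ι ι ℝ} {s γ : ι → ℝ} {C : Matrix ι ι ℤ} {l : ι → ℤ} {k : ℤ}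

open Classical in
lemma ptw1 (hS : Setup P s γ C l k) {Z : ℝ} (hZ : 0 < Z) (q : ℕ) [NeZero q] (θ : ℝ) (T : Finset ℕ) (E : ℝ)
    (hE : ∀ v : ι → ZMod q, ‖∑ b ∈ T, GS (ZMod.stdAddChar (N := q)) C l k (b : ZMod q) v‖ ≤ E) :
    ‖∑ b ∈ T, Theta P s γ Z ((b:ℝ) / q + θ)‖ ≤ E * ∑' v : ι → ℤ, ‖dg ((q : ℝ) • P) (zw s Z θ) (fun i => (v i:ℝ))‖ := by
  have hsum := (Theta_expand hS hZ q 0 θ).1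
  have h1 : HasSum (fun v : ι → ℤ => ∑ b ∈ T, dg ((q:ℝ) • P) (zw s Z θ) (fun i => (v i:ℝ)) * 
     Complex.exp (2 * Real.pi * Complex.I * ((∑ i, (v i:ℂ) * γ i) / q)) * GS (ZMod.stdAddChar (N := q)) C l k (b:ZMod q) (fun i => (v i : ZMod q)))
     (∑ b ∈ T, Theta P s γ Z ((b:ℝ) / q + θ)) := by
    refine hasSum_sum fun b _ => ?_
    have := (Theta_expand hS hZ q (b:ℤ) θ).2
    simpa only [Int.cast_natCast] using this
  rw [← h1.tsum_eq, ← tsum_mul_left]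
  refine tsum_of_norm_bounded (hsum.mul_left E).hasSum fun v => ?_
  rw [← Finset.mul_sum, norm_mul, norm_mul]
  have he : ‖Complex.exp (2 * Real.pi * Complex.I * ((∑ i, (v i:ℂ) * γ i) / q))‖ = 1 := by
    have : (2 * Real.pi * Complex.I * ((∑ i, (v i:ℂ) * γ i) / q) : ℂ) = ((2 * Real.pi * ((∑ i, v i * γ i) / q) : ℝ) : ℂ) * Complex.I := by
      push_cast; ring
    rw [this, Complex.norm_exp_ofReal_mul_I]
  rw [he, mul_one, mul_comm]
  gcongr
  exact hE _

lemma ptw2 (A M : Matrix ι ι ℝ) (hA : A.det ≠ 0) (hM : M.det ≠ 0) (i0 i1 : ι) (hi : i1 ≠ i0) (hd : 5 ≤ Fintype.card ι) :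
    ∃ K : ℝ, 0 < K ∧ ∀ R : ℝ, 1 ≤ R → ∀ L : ℕ, 1 ≤ L → ∀ W W' : Matrix ι ι ℤ, W * W' = 1 → 
      ∀ (s γ : ι → ℝ) (C : Matrix ι ι ℤ) (l : ι → ℤ) (k : ℤ), Setup (PM A M W i0 i1 R L) s γ C l k →
      ∀ Z : ℝ, 1 ≤ Z → ∀ (q : ℕ) [NeZero q], q ≤ ⌊Z⌋₊ → ∀ θ : ℝ, |θ| * (q * ⌊Z⌋₊) ≤ 1 →
      ∑' v : ι → ℤ, ‖dg ((q : ℝ) • (PM A M W i0 i1 R L)) (zw s Z θ) (fun i => (v i:ℝ))‖ ≤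
        K * (L:ℝ)⁻¹ * Z ^ Fintype.card ι * ((q:ℝ) ^ Fintype.card ι)⁻¹ * (1 + q * L * R / Z) * (1 + (2 * Z ^ 2 * θ) ^ 2) ^ (-(3/4) : ℝ) := by
  obtain ⟨K, hK, hg⟩ := gauss_bound A M i0 i1 hi 5 (by norm_num)
  have hAM : 0 < |A.det| * |M.det| := by positivity
  refine ⟨K * (|A.det| * |M.det|)⁻¹, by positivity, ?_⟩
  intro R hR L hL W W' hW s γ C l k hS Z hZ q _ hqQ θ hθ
  have hZ0 : 0 < Z := by linarith
  have hq : (0:ℝ) < q := by exact_mod_cast NeZero.pos q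
  have hL0 : (0:ℝ) < L := by exact_mod_cast hL
  have hR0 : 0 < R := by linarith
  set Y := 1 + 4 * (Z ^ 2 * θ) ^ 2 with hY
  have hY1 : 1 ≤ Y := by rw [hY]; nlinarith [sq_nonneg (Z ^ 2 * θ)]
  have hY0 : 0 < Y := by linarith
  set X := q * Real.sqrt Y / Z with hX
  have hXpos : 0 < X := by positivity
  have hX2 : X ^ 2 = q ^ 2 * Y / Z ^ 2 := by rw [hX, div_pow, mul_pow, Real.sq_sqrt hY0.le]
  have hQ1 : 1 ≤ ⌊Z⌋₊ := Nat.le_floor (by simpa using hZ)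
  have hQ2 : Z ≤ 2 * (⌊Z⌋₊:ℝ) := by
    have h1 := Nat.lt_floor_add_one Z
    have h2 : (1:ℝ) ≤ ⌊Z⌋₊ := by exact_mod_cast hQ1
    linarith
  have hQ3 : (⌊Z⌋₊:ℝ) ≤ Z := Nat.floor_le hZ0.le
  have hqZ : (q:ℝ) ≤ Z := le_trans (by exact_mod_cast hqQ) hQ3
  have hX5 : X ≤ 5 := by
    have : X ^ 2 ≤ 5 ^ 2 := by
      rw [hX2, div_le_iff₀ (by positivity), hY]
      have h1 : |θ| * q * Z ≤ 2 := by
        have : |θ| * q * Z ≤ |θ| * q * (2 * (⌊Z⌋₊:ℝ)) := by gcongr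
        linarith
      have h2 : (θ * q * Z) ^ 2 ≤ 2 ^ 2 := by
        apply sq_le_sq'
        · have := neg_abs_le θ
          have : -|θ| * (q * Z) ≤ θ * (q * Z) := by gcongr
          linarith
        · have := le_abs_self θ
          have : θ * (q * Z) ≤ |θ| * (q * Z) := by gcongr
          linarith
      have h3 : (q:ℝ) ^ 2 ≤ Z ^ 2 := by gcongr
      have h4 : (θ * q * Z) ^ 2 * Z ^ 2 ≤ 2 ^ 2 * Z ^ 2 := by gcongr
      nlinarith
    exact abs_le_of_sq_le_sq' this (by norm_num) |>.2
  set d := Fintype.card ι with hdd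
  have hmain := hg R hR L hL W W' hW hS.hP X hXpos hX5
  have hconst : 0 ≤ ((q : ℝ) ^ d)⁻¹ * |(PM A M W i0 i1 R L).det|⁻¹ * Z ^ d * Y ^ (-(d / 4 : ℝ)) := by positivity
  have hbd : ∑' v : ι → ℤ, ‖dg ((q : ℝ) • (PM A M W i0 i1 R L)) (zw s Z θ) (fun i => (v i:ℝ))‖ ≤
      ((q : ℝ) ^ d)⁻¹ * |(PM A M W i0 i1 R L).det|⁻¹ * Z ^ d * Y ^ (-(d / 4 : ℝ)) * (K * (1 + X * L * R)) := by
    refine Real.tsum_le_of_sum_le (fun v => norm_nonneg _) fun S => ?_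
    simp_rw [dg_zw_norm hS hZ0 q θ]
    rw [← Finset.mul_sum]
    rw [← hY, ← hX2]
    exact mul_le_mul_of_nonneg_left (hmain S) hconst
  refine hbd.trans ?_
  rw [det_PM A M W W' hW i0 i1 hi R hR0 L]
  have e1 : (1 + (2 * Z ^ 2 * θ) ^ 2) = Y := by rw [hY]; ring
  rw [e1]
  have hs1 : 1 ≤ Real.sqrt Y := Real.one_le_sqrt.mpr hY1
  have h5 : 1 + X * L * R ≤ (1 + q * L * R / Z) * Y ^ (1/2:ℝ) := by
    rw [← Real.sqrt_eq_rpow, hX]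
    have : q * Real.sqrt Y / Z * L * R = q * L * R / Z * Real.sqrt Y := by ring
    rw [this, add_mul]; linarith
  have h6 : Y ^ (-(d / 4 : ℝ)) * Y ^ (1/2:ℝ) ≤ Y ^ (-(3/4) : ℝ) := by
    rw [← Real.rpow_add hY0]
    apply Real.rpow_le_rpow_of_exponent_le hY1
    have : (5:ℝ) ≤ d := by exact_mod_cast hd
    linarith
  calc ((q : ℝ) ^ d)⁻¹ * (|A.det| * |M.det| * L)⁻¹ * Z ^ d * Y ^ (-(d / 4 : ℝ)) * (K * (1 + X * L * R))
      ≤ ((q : ℝ) ^ d)⁻¹ * (|A.det| * |M.det| * L)⁻¹ * Z ^ d * Y ^ (-(d / 4 : ℝ)) * (K * ((1 + q * L * R / Z) * Y ^ (1/2:ℝ))) := by gcongr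
    _ = ((q : ℝ) ^ d)⁻¹ * (|A.det| * |M.det| * L)⁻¹ * Z ^ d * K * (1 + q * L * R / Z) * (Y ^ (-(d / 4 : ℝ)) * Y ^ (1/2:ℝ)) := by ring
    _ ≤ ((q : ℝ) ^ d)⁻¹ * (|A.det| * |M.det| * L)⁻¹ * Z ^ d * K * (1 + q * L * R / Z) * (Y ^ (-(3/4) : ℝ)) := by gcongr
    _ = _ := by rw [mul_inv]; ring
end QH
end

open scoped BigOperators
open Finset Filter Topology Matrix
noncomputable section
namespace QH
open MeasureTheory
variable {ι : Type*} [Fintype ι] [DecidableEq ι]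

lemma jb_integrable : Integrable (fun x : ℝ => (1 + x ^ 2) ^ (-(3/4) : ℝ)) := by
  have := integrable_rpow_neg_one_add_norm_sq (E := ℝ) (μ := volume) (r := 3/2) (by simp; norm_num)
  have e : (-(3/2) / 2 : ℝ) = -(3/4) := by norm_num
  simpa [e] using this

theorem count_bound (A M : Matrix ι ι ℝ) (hA : A.det ≠ 0) (hM : M.det ≠ 0) (i0 i1 : ι) (hi : i1 ≠ i0) (hd : 5 ≤ Fintype.card ι) (K0 : ℝ) :
    ∃ K : ℝ, 0 < K ∧ ∀ R : ℝ, 1 ≤ R → ∀ L : ℕ, 1 ≤ L → ∀ W W' : Matrix ι ι ℤ, W * W' = 1 → 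
      ∀ (s γ : ι → ℝ) (C : Matrix ι ι ℤ) (l : ι → ℤ) (k : ℤ), Setup (PM A M W i0 i1 R L) s γ C l k →
      ∀ Z : ℝ, 1 ≤ Z → ∀ TB : ℕ → ℝ, 
      (∀ (q : ℕ) [NeZero q], q ≤ ⌊Z⌋₊ → ∀ u v, ‖TS (ZMod.stdAddChar (N := q)) C l k u v‖ ≤ TB q) →
      ∀ S : Finset (ι → ℤ), (∀ c ∈ S, qpoly C l k c = 0 ∧ ∑ i, ((PM A M W i0 i1 R L) *ᵥ (fun i => c i + γ i)) i ^ 2 ≤ K0 * Z ^ 2) →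
      (S.card : ℝ) ≤ K * (L:ℝ)⁻¹ * (Z ^ Fintype.card ι * (Z ^ 2)⁻¹) * 
        ∑ q ∈ Finset.Icc 1 ⌊Z⌋₊, ((q:ℝ) ^ Fintype.card ι)⁻¹ * ((2 + Real.log q) * TB q) * (1 + q * L * R / Z) := by
  classical
  obtain ⟨K, hK, hp⟩ := ptw2 A M hA hM i0 i1 hi hd
  set J : ℝ := ∫ x : ℝ, (1 + x ^ 2) ^ (-(3/4) : ℝ) with hJ
  have hJ0 : 0 ≤ J := integral_nonneg fun x => by positivity
  refine ⟨Real.exp (Real.pi * K0) * (K * (J + 1)), by positivity, ?_⟩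
  intro R hR L hL W W' hW s γ C l k hS Z hZ TB hTB S hSS
  have hZ0 : 0 < Z := by linarith
  have hL0 : (0:ℝ) < L := by exact_mod_cast hL
  have hR0 : 0 < R := by linarith
  refine (count_le hS hZ0 S K0 hSS).trans ?_
  set d := Fintype.card ι with hdd
  set P := PM A M W i0 i1 R L with hP
  have hQ1 : 1 ≤ ⌊Z⌋₊ := Nat.le_floor (by simpa using hZ)
  rw [farey_integral _ (Theta_continuous hS hZ0) (Theta_periodic hS Z) ⌊Z⌋₊ hQ1]
  have hterm : ∀ q ∈ Finset.Icc 1 ⌊Z⌋₊, ‖∑ b ∈ Finset.range q,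
      ∫ θ, {θ : ℝ | cond ⌊Z⌋₊ q b θ}.indicator (fun θ => Theta P s γ Z (b / q + θ)) θ‖ ≤ 
      K * (J + 1) * (L:ℝ)⁻¹ * (Z ^ d * (Z ^ 2)⁻¹) * (((q:ℝ) ^ d)⁻¹ * ((2 + Real.log q) * TB q) * (1 + q * L * R / Z)) := by
    intro q hq
    rw [Finset.mem_Icc] at hq
    haveI : NeZero q := ⟨by lia⟩
    have hq0 : (0:ℝ) < q := by exact_mod_cast hq.1
    have hTB0 : 0 ≤ TB q := (norm_nonneg _).trans (hTB q hq.2 0 0)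
    have hlog : 0 ≤ Real.log q := Real.log_natCast_nonneg q
    have hIntegr : ∀ b ∈ Finset.range q, Integrable ({θ : ℝ | cond ⌊Z⌋₊ q b θ}.indicator (fun θ => Theta P s γ Z (b / q + θ))) := by
      intro b _
      rw [integrable_indicator_iff (cond_meas _ _ _)]
      have hcont : Continuous (fun θ => Theta P s γ Z (b / q + θ)) := (Theta_continuous hS hZ0).comp (by fun_prop)
      refine IntegrableOn.mono_set (hcont.integrableOn_Icc (a := -1) (b := 1)) ?_
      intro θ hθ
      have := cond_lt (by exact_mod_cast hq.1) hθ
      rw [Set.mem_Icc, ← abs_le]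
      have h1 : (1:ℝ) ≤ ((q:ℤ):ℝ) * ((⌊Z⌋₊:ℤ):ℝ) := by
        have : (1:ℤ) ≤ (q:ℤ) * (⌊Z⌋₊:ℤ) := by
          have h1 : (1:ℤ) ≤ q := by exact_mod_cast hq.1
          have h2 : (1:ℤ) ≤ ⌊Z⌋₊ := by exact_mod_cast hQ1
          nlinarith
        exact_mod_cast this
      nlinarith [abs_nonneg θ]
    rw [← integral_finset_sum _ hIntegr]
    set c : ℝ := K * (L:ℝ)⁻¹ * Z ^ d * ((q:ℝ) ^ d)⁻¹ * (1 + q * L * R / Z) * ((2 + Real.log q) * TB q) with hc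
    have hc0 : 0 ≤ c := by positivity
    have hbint : Integrable (fun θ : ℝ => c * (1 + (2 * Z ^ 2 * θ) ^ 2) ^ (-(3/4) : ℝ)) := by
      exact (jb_integrable.comp_mul_left' (show 2 * Z ^ 2 ≠ 0 by positivity)).const_mul c
    refine (norm_integral_le_of_norm_le hbint (Filter.Eventually.of_forall fun θ => ?_)).trans ?_
    · have e : ∑ b ∈ Finset.range q, {θ : ℝ | cond ⌊Z⌋₊ q b θ}.indicator (fun θ => Theta P s γ Z (b / q + θ)) θ
          = ∑ b ∈ (Finset.range q).filter (fun b : ℕ => cond ⌊Z⌋₊ q b θ), Theta P s γ Z (b / q + θ) := by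
        rw [Finset.sum_filter]
        refine Finset.sum_congr rfl fun b _ => ?_
        rw [Set.indicator_apply]; rfl
      rw [e]
      rcases ((Finset.range q).filter (fun b : ℕ => cond ⌊Z⌋₊ q b θ)).eq_empty_or_nonempty with h | ⟨b, hb⟩
      · rw [h]; simp only [Finset.sum_empty, norm_zero]; positivity
      · have hb' := (Finset.mem_filter.mp hb).2
        have hlt := cond_lt (by exact_mod_cast hq.1) hb'
        refine (ptw1 hS hZ0 q θ _ _ (fun v => cond_sum_le q ⌊Z⌋₊ C l k v (TB q) (fun u => hTB q hq.2 u v) θ)).trans ?_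
        have := hp R hR L hL W W' hW s γ C l k hS Z hZ q hq.2 θ (by push_cast at hlt; exact hlt.le)
        refine (mul_le_mul_of_nonneg_left this (by positivity)).trans (le_of_eq ?_)
        rw [hc]; ring
    · rw [integral_const_mul]
      have h2 := Measure.integral_comp_mul_left (fun x : ℝ => (1 + x ^ 2) ^ (-(3/4) : ℝ)) (2 * Z ^ 2)
      rw [h2, ← hJ, smul_eq_mul, abs_of_pos (by positivity), hc]
      have h3 : (2 * Z ^ 2)⁻¹ * J ≤ (Z ^ 2)⁻¹ * (J + 1) := by
        gcongr <;> nlinarith [sq_nonneg Z]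
      calc _ ≤ K * (L:ℝ)⁻¹ * Z ^ d * ((q:ℝ) ^ d)⁻¹ * (1 + q * L * R / Z) * ((2 + Real.log q) * TB q) * ((Z ^ 2)⁻¹ * (J + 1)) := by gcongr
        _ = _ := by ring
  calc _ ≤ Real.exp (Real.pi * K0) * ∑ q ∈ Finset.Icc 1 ⌊Z⌋₊, K * (J + 1) * (L:ℝ)⁻¹ * (Z ^ d * (Z ^ 2)⁻¹) * (((q:ℝ) ^ d)⁻¹ * ((2 + Real.log q) * TB q) * (1 + q * L * R / Z)) := by
        refine mul_le_mul_of_nonneg_left ?_ (Real.exp_pos _).le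
        exact (norm_sum_le _ _).trans (Finset.sum_le_sum hterm)
    _ = _ := by
        rw [← Finset.mul_sum]; ring
end QH
end

open scoped BigOperators
open Finset Filter Topology Matrix
noncomputable section
namespace QH
lemma four_pow_omega (ε : ℝ) (hε : 0 < ε) : ∃ C : ℝ, 0 < C ∧ ∀ M : ℕ, 1 ≤ M → (4:ℝ) ^ M.primeFactors.card ≤ C * (M:ℝ) ^ ε := by
  set P0 := ⌈(4:ℝ) ^ (1/ε)⌉₊ with hP0
  refine ⟨4 ^ P0, by positivity, fun M hM => ?_⟩
  have h1 : (4:ℝ) ^ M.primeFactors.card = ∏ p ∈ M.primeFactors, (4:ℝ) := by simp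
  have h2 : ∏ p ∈ M.primeFactors, (4:ℝ) ≤ ∏ p ∈ M.primeFactors, ((if p < P0 then 4 else 1) * (p:ℝ) ^ ε) := by
    refine Finset.prod_le_prod (fun _ _ => by norm_num) fun p hp => ?_
    have hp1 : (1:ℝ) ≤ p := by exact_mod_cast (Nat.prime_of_mem_primeFactors hp).one_lt.le
    have hp2 : (1:ℝ) ≤ (p:ℝ) ^ ε := Real.one_le_rpow hp1 hε.le
    split_ifs with h
    · linarith
    · have h3 : (4:ℝ) ^ (1/ε) ≤ p := (Nat.le_ceil _).trans (by exact_mod_cast (not_lt.mp h))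
      calc (4:ℝ) = ((4:ℝ) ^ (1/ε)) ^ ε := by rw [← Real.rpow_mul (by norm_num)]; field_simp; simp
        _ ≤ (p:ℝ) ^ ε := by gcongr
        _ = _ := by ring
  have h3 : ∏ p ∈ M.primeFactors, (if p < P0 then 4 else 1 : ℝ) ≤ 4 ^ P0 := by
    rw [Finset.prod_ite]
    simp only [Finset.prod_const, one_pow, mul_one]
    refine pow_le_pow_right₀ (by norm_num) ?_
    calc _ ≤ (Finset.range P0).card := by
          apply Finset.card_le_card
          intro p hp
          exact Finset.mem_range.mpr (Finset.mem_filter.mp hp).2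
      _ = P0 := Finset.card_range _
  have h4 : ∏ p ∈ M.primeFactors, (p:ℝ) ^ ε ≤ (M:ℝ) ^ ε := by
    rw [Real.finset_prod_rpow _ _ (fun _ _ => by positivity)]
    have : (∏ p ∈ M.primeFactors, (p:ℝ)) ≤ M := by
      have := Nat.le_of_dvd hM (Nat.prod_primeFactors_dvd M)
      have h' : ((∏ p ∈ M.primeFactors, p : ℕ) : ℝ) ≤ (M : ℝ) := Nat.cast_le.mpr this
      rwa [Nat.cast_prod] at h'
    exact Real.rpow_le_rpow (by positivity) this hε.le
  rw [h1]
  refine h2.trans ?_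
  rw [Finset.prod_mul_distrib]
  exact mul_le_mul h3 h4 (by positivity) (by positivity)

/-- inverse square root as a monoid hom -/
def isq : ℕ →* ℝ where
  toFun m := (Real.sqrt m)⁻¹
  map_one' := by simp
  map_mul' a b := by push_cast; rw [Real.sqrt_mul (by positivity), mul_inv]

lemma isq_prime {p : ℕ} (hp : p.Prime) : isq p ≤ 3/4 := by
  have h : (4/3:ℝ) ≤ Real.sqrt p := by
    apply Real.le_sqrt_of_sq_le
    have : (2:ℝ) ≤ p := by exact_mod_cast hp.two_le
    nlinarith
  have : (Real.sqrt p)⁻¹ ≤ (4/3:ℝ)⁻¹ := by gcongr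
  calc isq p = (Real.sqrt p)⁻¹ := rfl
    _ ≤ _ := this
    _ = _ := by norm_num

lemma smooth_sum (ε : ℝ) (hε : 0 < ε) : ∃ C : ℝ, 0 < C ∧ ∀ M : ℕ, 1 ≤ M → ∀ T : Finset ℕ, 
    (∀ m ∈ T, m ≠ 0 ∧ m.primeFactors ⊆ M.primeFactors) → ∑ m ∈ T, (Real.sqrt m)⁻¹ ≤ C * (M:ℝ) ^ ε := by
  obtain ⟨C, hC, h⟩ := four_pow_omega ε hε
  refine ⟨C, hC, fun M hM T hT => le_trans ?_ (h M hM)⟩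
  have hnn : ∀ m : ℕ, 0 ≤ isq m := fun m => by show 0 ≤ (Real.sqrt m)⁻¹; positivity
  obtain ⟨-, hs⟩ := EulerProduct.summable_and_hasSum_factoredNumbers_prod_filter_prime_geometric (f := isq)
    (fun {p} hp => by rw [Real.norm_of_nonneg (hnn p)]; linarith [isq_prime hp]) M.primeFactors
  have h1 : ∑ m ∈ T, (Real.sqrt m)⁻¹ ≤ ∏ p ∈ M.primeFactors with p.Prime, (1 - isq p)⁻¹ := by
    rw [← hs.tsum_eq]
    have := hs.summable.sum_le_tsum (T.subtype (· ∈ Nat.factoredNumbers M.primeFactors)) (fun m _ => hnn m)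
    refine le_trans (le_of_eq ?_) this
    rw [Finset.sum_subtype_eq_sum_filter (f := fun m => isq m), Finset.filter_true_of_mem]
    · rfl
    · intro m hm
      exact Nat.mem_factoredNumbers_of_primeFactors_subset (hT m hm).1 (hT m hm).2
  refine h1.trans ?_
  have e : (M.primeFactors.filter Nat.Prime) = M.primeFactors := 
    Finset.filter_true_of_mem fun p hp => Nat.prime_of_mem_primeFactors hp
  rw [e]
  calc ∏ p ∈ M.primeFactors, (1 - isq p)⁻¹ ≤ ∏ p ∈ M.primeFactors, (4:ℝ) := by
        refine Finset.prod_le_prod (fun p hp => ?_) fun p hp => ?_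
        · have := isq_prime (Nat.prime_of_mem_primeFactors hp)
          exact inv_nonneg.mpr (by linarith)
        · have := isq_prime (Nat.prime_of_mem_primeFactors hp)
          rw [inv_le_comm₀ (by linarith) (by norm_num)]; linarith
    _ = _ := by simp

lemma decomp (M : ℕ) (hM : M ≠ 0) (q : ℕ) : q ≠ 0 → ∃ f m a b : ℕ, q = f * (m * (a ^ 2 * b ^ 3)) ∧ Squarefree f ∧ 
    f.Coprime (m * (a ^ 2 * b ^ 3)) ∧ f.Coprime M ∧ m.primeFactors ⊆ M.primeFactors := by
  induction q using Nat.recOnPosPrimePosCoprime with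
  | zero => intro h; exact absurd rfl h
  | one => intro _; exact ⟨1, 1, 1, 1, by simp, squarefree_one, by simp, by simp, by simp⟩
  | prime_pow p n hp hn =>
    intro _
    by_cases h : p ∣ M
    · refine ⟨1, p ^ n, 1, 1, by simp, squarefree_one, by simp, by simp, ?_⟩
      rw [Nat.primeFactors_prime_pow hn.ne' hp]
      simp [hp, h, hM]
    · have hc : p.Coprime M := (Nat.Prime.coprime_iff_not_dvd hp).mpr h
      rcases Nat.lt_or_ge n 2 with h1 | h1
      · have : n = 1 := by lia
        subst this
        exact ⟨p, 1, 1, 1, by simp, hp.prime.squarefree, by simp, hc, by simp⟩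
      · rcases Nat.even_or_odd' n with ⟨j, hj | hj⟩
        · exact ⟨1, 1, p ^ j, 1, by rw [hj]; ring, squarefree_one, by simp, by simp, by simp⟩
        · obtain ⟨i, rfl⟩ : ∃ i, j = i + 1 := ⟨j - 1, by lia⟩
          exact ⟨1, 1, p ^ i, p, by rw [hj]; ring, squarefree_one, by simp, by simp, by simp⟩
  | coprime x y hx hy hxy ihx ihy =>
    intro _
    obtain ⟨f, m, a, b, h1, h2, h3, h4, h5⟩ := ihx (by lia)
    obtain ⟨f', m', a', b', h1', h2', h3', h4', h5'⟩ := ihy (by lia)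
    have hm : m ≠ 0 := by rintro rfl; simp at h1; lia
    have hm' : m' ≠ 0 := by rintro rfl; simp at h1'; lia
    have e : m * m' * ((a * a') ^ 2 * (b * b') ^ 3) = (m * (a ^ 2 * b ^ 3)) * (m' * (a' ^ 2 * b' ^ 3)) := by ring
    set g := m * (a ^ 2 * b ^ 3)
    set g' := m' * (a' ^ 2 * b' ^ 3)
    have c1 : f.Coprime f' := Nat.Coprime.of_dvd (h1 ▸ Nat.dvd_mul_right f g) (h1' ▸ Nat.dvd_mul_right f' g') hxy
    have c2 : f.Coprime g' := Nat.Coprime.of_dvd (h1 ▸ Nat.dvd_mul_right f g) (h1' ▸ Nat.dvd_mul_left g' f') hxy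
    have c3 : f'.Coprime g := (Nat.Coprime.of_dvd (h1 ▸ Nat.dvd_mul_left g f) (h1' ▸ Nat.dvd_mul_right f' g') hxy).symm
    refine ⟨f * f', m * m', a * a', b * b', ?_, ?_, ?_, h4.mul_left h4', ?_⟩
    · rw [e, h1, h1']; ring
    · exact (Nat.squarefree_mul c1).mpr ⟨h2, h2'⟩
    · rw [e]
      exact (h3.mul_right c2).mul_left (c3.mul_right h3')
    · rw [Nat.primeFactors_mul hm hm']
      exact Finset.union_subset h5 h5'

lemma harm (Y : ℕ) : ∑ a ∈ Finset.Icc 1 Y, ((a:ℝ))⁻¹ ≤ 1 + Real.log Y := by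
  have := harmonic_le_one_add_log Y
  rw [harmonic_eq_sum_Icc] at this
  push_cast at this
  exact this

lemma good_sum (ε : ℝ) (hε : 0 < ε) : ∃ C : ℝ, 0 < C ∧ ∀ M : ℕ, 1 ≤ M → ∃ f g : ℕ → ℕ, 
    (∀ q, 1 ≤ q → q = f q * g q ∧ Squarefree (f q) ∧ (f q).Coprime (g q) ∧ (f q).Coprime M) ∧
    ∀ Y : ℕ, ∑ q ∈ Finset.Icc 1 Y, ((f q:ℝ))⁻¹ * (Real.sqrt (g q))⁻¹ ≤ C * (M:ℝ) ^ ε * (1 + Real.log Y) ^ 3 := by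
  obtain ⟨C, hC, hs⟩ := smooth_sum ε hε
  refine ⟨C, hC, fun M hM => ?_⟩
  have hdec := decomp M (by lia)
  choose! f m a b h using hdec
  refine ⟨f, fun q => m q * (a q ^ 2 * b q ^ 3), ?_, ?_⟩
  · intro q hq
    obtain ⟨h1, h2, h3, h4, h5⟩ := h q (by lia)
    exact ⟨h1, h2, h3, h4⟩
  · intro Y
    set I := Finset.Icc 1 Y with hI
    set T := I.filter (fun m => m.primeFactors ⊆ M.primeFactors) with hT
    set F : ℕ × ℕ × ℕ × ℕ → ℝ := fun x => ((x.1:ℝ))⁻¹ * ((Real.sqrt x.2.1)⁻¹ * ((x.2.2.1:ℝ)⁻¹ * (x.2.2.2:ℝ)⁻¹)) with hF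
    let φ : ℕ → ℕ × ℕ × ℕ × ℕ := fun q => (f q, m q, a q, b q)
    have hpos : ∀ q ∈ I, 1 ≤ f q ∧ 1 ≤ m q ∧ 1 ≤ a q ∧ 1 ≤ b q ∧ f q ≤ Y ∧ m q ≤ Y ∧ a q ≤ Y ∧ b q ≤ Y := by
      intro q hq
      rw [hI, Finset.mem_Icc] at hq
      obtain ⟨h1, -⟩ := h q (by lia)
      have hf : f q ≠ 0 := by intro h0; rw [h0] at h1; simp at h1; lia
      have hm : m q ≠ 0 := by intro h0; rw [h0] at h1; simp at h1; lia
      have ha : a q ≠ 0 := by intro h0; rw [h0] at h1; simp at h1; lia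
      have hb : b q ≠ 0 := by intro h0; rw [h0] at h1; simp at h1; lia
      have d1 : f q ∣ q := ⟨_, h1⟩
      have d2 : m q ∣ q := ⟨f q * (a q ^ 2 * b q ^ 3), by linarith⟩
      have d3 : a q ∣ q := ⟨f q * (m q * a q * b q ^ 3), by linarith⟩
      have d4 : b q ∣ q := ⟨f q * (m q * a q ^ 2 * b q ^ 2), by linarith⟩
      have := Nat.le_of_dvd hq.1 d1
      have := Nat.le_of_dvd hq.1 d2
      have := Nat.le_of_dvd hq.1 d3
      have := Nat.le_of_dvd hq.1 d4
      refine ⟨?_, ?_, ?_, ?_, ?_, ?_, ?_, ?_⟩ <;> lia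
    have hle : ∀ q ∈ I, ((f q:ℝ))⁻¹ * (Real.sqrt ((m q * (a q ^ 2 * b q ^ 3) : ℕ)))⁻¹ ≤ F (φ q) := by
      intro q hq
      obtain ⟨p1, p2, p3, p4, -⟩ := hpos q hq
      have ha : (1:ℝ) ≤ a q := by exact_mod_cast p3
      have hb : (1:ℝ) ≤ b q := by exact_mod_cast p4
      have hm : (1:ℝ) ≤ m q := by exact_mod_cast p2
      simp only [hF, φ]
      have e : Real.sqrt ((m q * (a q ^ 2 * b q ^ 3) : ℕ)) = Real.sqrt (m q) * (a q * Real.sqrt (b q ^ 3)) := by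
        push_cast
        rw [Real.sqrt_mul (by positivity), Real.sqrt_mul (by positivity), Real.sqrt_sq (by positivity)]
      rw [e, mul_inv, mul_inv]
      have : (b q:ℝ) ≤ Real.sqrt (b q ^ 3) := by
        apply Real.le_sqrt_of_sq_le
        exact pow_le_pow_right₀ hb (by norm_num)
      gcongr
    have hinj : Set.InjOn φ I := by
      intro q hq q' hq' hqq
      have hq := Finset.mem_Icc.mp (Finset.mem_coe.mp hq)
      have hq' := Finset.mem_Icc.mp (Finset.mem_coe.mp hq')
      simp only [φ, Prod.mk.injEq] at hqq
      rw [(h q (by lia)).1, (h q' (by lia)).1, hqq.1, hqq.2.1, hqq.2.2.1, hqq.2.2.2]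
    have hsub : I.image φ ⊆ I ×ˢ (T ×ˢ (I ×ˢ I)) := by
      intro x hx
      obtain ⟨q, hq, rfl⟩ := Finset.mem_image.mp hx
      obtain ⟨p1, p2, p3, p4, p5, p6, p7, p8⟩ := hpos q hq
      rw [hI, Finset.mem_Icc] at hq
      have h5 := (h q (by lia)).2.2.2.2
      simp only [φ, Finset.mem_product, hT, Finset.mem_filter, hI, Finset.mem_Icc]
      exact ⟨⟨p1, p5⟩, ⟨⟨p2, p6⟩, h5⟩, ⟨p3, p7⟩, ⟨p4, p8⟩⟩
    have hTs : ∑ x ∈ T, (Real.sqrt x)⁻¹ ≤ C * (M:ℝ) ^ ε := by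
      refine hs M hM T ?_
      intro x hx
      rw [hT, Finset.mem_filter, hI, Finset.mem_Icc] at hx
      exact ⟨by lia, hx.2⟩
    have hlog : 0 ≤ Real.log Y := Real.log_natCast_nonneg Y
    calc _ ≤ ∑ q ∈ I, F (φ q) := Finset.sum_le_sum hle
      _ = ∑ x ∈ I.image φ, F x := (Finset.sum_image hinj).symm
      _ ≤ ∑ x ∈ I ×ˢ (T ×ˢ (I ×ˢ I)), F x := 
          Finset.sum_le_sum_of_subset_of_nonneg hsub fun x _ _ => by simp only [hF]; positivity
      _ = (∑ x ∈ I, (x:ℝ)⁻¹) * ((∑ x ∈ T, (Real.sqrt x)⁻¹) * ((∑ x ∈ I, (x:ℝ)⁻¹) * (∑ x ∈ I, (x:ℝ)⁻¹))) := by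
          rw [Finset.sum_product, Finset.sum_mul_sum]
          simp_rw [Finset.sum_product, Finset.sum_mul_sum, Finset.mul_sum]
          rfl
      _ ≤ (1 + Real.log Y) * ((C * (M:ℝ) ^ ε) * ((1 + Real.log Y) * (1 + Real.log Y))) := by
          have hh := harm Y
          gcongr
      _ = _ := by ring
end QH
end

open scoped BigOperators
open Finset Filter Topology Matrix
noncomputable section
namespace QH
lemma log_pow4 (ε : ℝ) (hε : 0 < ε) : ∃ C : ℝ, 0 < C ∧ ∀ Z : ℝ, 1 ≤ Z → (2 + Real.log Z) ^ 4 ≤ C * Z ^ ε := by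
  refine ⟨(2 + 4/ε) ^ 4, by positivity, fun Z hZ => ?_⟩
  have h1 : Real.log Z ≤ Z ^ (ε/4) / (ε/4) := Real.log_le_rpow_div (by linarith) (by positivity)
  have h2 : 1 ≤ Z ^ (ε/4) := Real.one_le_rpow hZ (by positivity)
  have h3 : 0 ≤ Real.log Z := Real.log_nonneg hZ
  have h4 : Z ^ (ε/4) / (ε/4) = 4/ε * Z ^ (ε/4) := by field_simp
  have h5 : 2 + Real.log Z ≤ (2 + 4/ε) * Z ^ (ε/4) := by nlinarith
  calc (2 + Real.log Z) ^ 4 ≤ ((2 + 4/ε) * Z ^ (ε/4)) ^ 4 := by gcongr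
    _ = (2 + 4/ε) ^ 4 * (Z ^ (ε/4)) ^ 4 := by ring
    _ = _ := by
      congr 1
      rw [← Real.rpow_natCast, ← Real.rpow_mul (by linarith)]; congr 1; push_cast; ring

variable {ι : Type*} [Fintype ι] [DecidableEq ι]

lemma TB_sum (i0 : ι) (hd : 5 ≤ Fintype.card ι) (D : ℕ) (ε : ℝ) (hε : 0 < ε) : ∃ K : ℝ, 0 < K ∧ ∀ L : ℕ, ∀ (C : Matrix ι ι ℤ) (l : ι → ℤ) (k : ℤ) (N' : Matrix ι ι ℤ),
    N'.det.natAbs = D → Arith C l k i0 L N' → ∃ TB : ℕ → ℝ, (∀ q, 0 ≤ TB q) ∧ 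
      (∀ (q : ℕ) [NeZero q], ∀ u v, ‖TS (ZMod.stdAddChar (N := q)) C l k u v‖ ≤ TB q) ∧
      ∀ Y : ℕ, 1 ≤ Y → ∑ q ∈ Finset.Icc 1 Y, ((q:ℝ) ^ Fintype.card ι)⁻¹ * TB q * q ≤ K * (L:ℝ) ^ ε * (1 + Real.log Y) ^ 3 := by
  set d := Fintype.card ι with hdd
  rcases hd.eq_or_lt with h5 | h6
  · obtain ⟨K, hK, hg⟩ := good_sum ε hε
    refine ⟨(Real.sqrt (D ^ d : ℕ) + 1) * (K * (2 * D + 1 : ℝ) ^ ε), by positivity, ?_⟩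
    intro L C l k N' hD H
    have hL := H.hL
    have hD0 : 1 ≤ D := by
      have := H.hdet
      omega
    have hM : 1 ≤ 2 * D * L := by
      have := Nat.mul_pos (show 0 < 2 * D by omega) hL
      omega
    obtain ⟨f, g, hfg, hsum⟩ := hg (2 * D * L) hM
    refine ⟨fun q => Real.sqrt (f q) ^ (d + 1) * (Real.sqrt (D ^ d : ℕ) * (g q * Real.sqrt (g q ^ d : ℕ))), fun q => by positivity, ?_, ?_⟩
    · intro q _ u v
      obtain ⟨h1, h2, h3, h4⟩ := hfg q (Nat.one_le_iff_ne_zero.mpr (NeZero.ne q))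
      have := H.TS_good (by rw [← hdd, ← h5]; decide) (f q) (g q) q h1 h2 h3 (by rw [hD]; exact h4) _ (ZMod.isPrimitive_stdAddChar q) u v
      rwa [hD] at this
    · intro Y hY
      have hlog : 0 ≤ Real.log Y := Real.log_natCast_nonneg Y
      calc ∑ q ∈ Finset.Icc 1 Y, ((q:ℝ) ^ d)⁻¹ * (Real.sqrt (f q) ^ (d + 1) * (Real.sqrt (D ^ d : ℕ) * (g q * Real.sqrt (g q ^ d : ℕ)))) * q
          = ∑ q ∈ Finset.Icc 1 Y, Real.sqrt (D ^ d : ℕ) * (((f q:ℝ))⁻¹ * (Real.sqrt (g q))⁻¹) := by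
            refine Finset.sum_congr rfl fun q hq => ?_
            have hq1 := (Finset.mem_Icc.mp hq).1
            obtain ⟨h1, h2, h3, h4⟩ := hfg q hq1
            have hf0 : 0 < f q := Nat.pos_of_ne_zero fun h => by rw [h] at h1; omega
            have hg0 : 0 < g q := Nat.pos_of_ne_zero fun h => by rw [h] at h1; omega
            have hf : (0:ℝ) < Real.sqrt (f q) := Real.sqrt_pos.mpr (by exact_mod_cast hf0)
            have hg : (0:ℝ) < Real.sqrt (g q) := Real.sqrt_pos.mpr (by exact_mod_cast hg0)
            have e1 : (f q : ℝ) = Real.sqrt (f q) ^ 2 := (Real.sq_sqrt (by positivity)).symm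
            have e2 : (g q : ℝ) = Real.sqrt (g q) ^ 2 := (Real.sq_sqrt (by positivity)).symm
            have e3 : Real.sqrt (g q ^ d : ℕ) = Real.sqrt (g q) ^ d := by
              rw [Nat.cast_pow]
              rw [Real.sqrt_eq_iff_mul_self_eq (by positivity) (by positivity), ← pow_add, ← two_mul, pow_mul, Real.sq_sqrt (by positivity)]
            have e4 : (q:ℝ) = Real.sqrt (f q) ^ 2 * Real.sqrt (g q) ^ 2 := by
              rw [← e1, ← e2]; exact_mod_cast h1
            rw [e3, e4]
            set x := Real.sqrt (f q)
            set y := Real.sqrt (g q)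
            set c := Real.sqrt (D ^ d : ℕ)
            rw [e1, e2, ← h5]
            field_simp
        _ = Real.sqrt (D ^ d : ℕ) * ∑ q ∈ Finset.Icc 1 Y, (((f q:ℝ))⁻¹ * (Real.sqrt (g q))⁻¹) := by rw [Finset.mul_sum]
        _ ≤ Real.sqrt (D ^ d : ℕ) * (K * ((2 * D * L : ℕ):ℝ) ^ ε * (1 + Real.log Y) ^ 3) := by gcongr; exact hsum Y
        _ ≤ (Real.sqrt (D ^ d : ℕ) + 1) * (K * (2 * D + 1 : ℝ) ^ ε * (L:ℝ) ^ ε * (1 + Real.log Y) ^ 3) := by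
            have : ((2 * D * L : ℕ):ℝ) ^ ε ≤ (2 * D + 1 : ℝ) ^ ε * (L:ℝ) ^ ε := by
              rw [← Real.mul_rpow (by positivity) (by positivity)]
              push_cast
              gcongr
              linarith
            have h0 : K * ((2 * D * L : ℕ):ℝ) ^ ε ≤ K * (2 * D + 1 : ℝ) ^ ε * (L:ℝ) ^ ε := by
              have := mul_le_mul_of_nonneg_left this hK.le
              linarith
            gcongr
            linarith
        _ = _ := by ring
  · refine ⟨Real.sqrt (D ^ d : ℕ) + 1, by positivity, ?_⟩
    intro L C l k N' hD H
    refine ⟨fun q => Real.sqrt (D ^ d : ℕ) * (q * Real.sqrt (q ^ d : ℕ)), fun q => by positivity, ?_, ?_⟩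
    · intro q _ u v
      have := H.TS_le q _ (ZMod.isPrimitive_stdAddChar q) u v
      rwa [hD] at this
    · intro Y hY
      have hL1 : (1:ℝ) ≤ (L:ℝ) ^ ε := Real.one_le_rpow (by exact_mod_cast H.hL) hε.le
      have hlog : 0 ≤ Real.log Y := Real.log_natCast_nonneg Y
      calc ∑ q ∈ Finset.Icc 1 Y, ((q:ℝ) ^ d)⁻¹ * (Real.sqrt (D ^ d : ℕ) * (q * Real.sqrt (q ^ d : ℕ))) * q
          ≤ ∑ q ∈ Finset.Icc 1 Y, Real.sqrt (D ^ d : ℕ) * (q:ℝ)⁻¹ := by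
            refine Finset.sum_le_sum fun q hq => ?_
            have hq1 := (Finset.mem_Icc.mp hq).1
            have hq1' : (1:ℝ) ≤ q := by exact_mod_cast hq1
            have hx : (1:ℝ) ≤ Real.sqrt q := Real.one_le_sqrt.mpr hq1'
            have e3 : Real.sqrt (q ^ d : ℕ) = Real.sqrt q ^ d := by
              rw [Nat.cast_pow]
              rw [Real.sqrt_eq_iff_mul_self_eq (by positivity) (by positivity), ← pow_add, ← two_mul, pow_mul, Real.sq_sqrt (by positivity)]
            have e1 : (q : ℝ) = Real.sqrt q ^ 2 := (Real.sq_sqrt (by positivity)).symm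
            rw [e3]
            set x := Real.sqrt q
            set c := Real.sqrt (D ^ d : ℕ)
            rw [e1]
            obtain ⟨m, hm⟩ : ∃ m, d = 6 + m := ⟨d - 6, by omega⟩
            have : ((x^2) ^ d)⁻¹ * (c * (x^2 * x ^ d)) * x^2 = c * (x^2)⁻¹ * (x ^ m)⁻¹ := by
              rw [hm]; field_simp; ring
            rw [this]
            exact mul_le_of_le_one_right (by positivity) (inv_le_one_of_one_le₀ (one_le_pow₀ hx))
        _ = Real.sqrt (D ^ d : ℕ) * ∑ q ∈ Finset.Icc 1 Y, (q:ℝ)⁻¹ := by rw [Finset.mul_sum]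
        _ ≤ Real.sqrt (D ^ d : ℕ) * (1 + Real.log Y) := by gcongr; exact harm Y
        _ ≤ (Real.sqrt (D ^ d : ℕ) + 1) * 1 * (1 + Real.log Y) ^ 3 := by
          rw [mul_one]
          gcongr
          · linarith
          · exact le_self_pow₀ (by linarith) (by norm_num)
        _ ≤ _ := by gcongr

theorem count_bound2 (A M : Matrix ι ι ℝ) (hA : A.det ≠ 0) (hM : M.det ≠ 0) (i0 i1 : ι) (hi : i1 ≠ i0) (hd : 5 ≤ Fintype.card ι) (K0 : ℝ) (D : ℕ) (ε : ℝ) (hε : 0 < ε) :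
    ∃ K : ℝ, 0 < K ∧ ∀ R : ℝ, 1 ≤ R → ∀ L : ℕ, 1 ≤ L → ∀ W W' : Matrix ι ι ℤ, W * W' = 1 → 
      ∀ (s γ : ι → ℝ) (C : Matrix ι ι ℤ) (l : ι → ℤ) (k : ℤ) (N' : Matrix ι ι ℤ), Setup (PM A M W i0 i1 R L) s γ C l k →
      N'.det.natAbs = D → Arith C l k i0 L N' →
      ∀ Z : ℝ, 1 ≤ Z → 
      ∀ S : Finset (ι → ℤ), (∀ c ∈ S, qpoly C l k c = 0 ∧ ∑ i, ((PM A M W i0 i1 R L) *ᵥ (fun i => c i + γ i)) i ^ 2 ≤ K0 * Z ^ 2) →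
      (S.card : ℝ) ≤ K * ((L:ℝ)⁻¹ * (Z ^ Fintype.card ι * (Z ^ 2)⁻¹) * ((L:ℝ) ^ ε * Z ^ ε * (1 + L * R / Z))) := by
  obtain ⟨K1, hK1, h1⟩ := count_bound A M hA hM i0 i1 hi hd K0
  obtain ⟨K2, hK2, h2⟩ := TB_sum i0 hd D ε hε
  obtain ⟨K3, hK3, h3⟩ := log_pow4 ε hε
  refine ⟨K1 * (K2 * K3), by positivity, ?_⟩
  intro R hR L hL W W' hW s γ C l k N' hS hD hAr Z hZ S hSS
  obtain ⟨TB, hTB0, hTB, hsum⟩ := h2 L C l k N' hD hAr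
  refine (h1 R hR L hL W W' hW s γ C l k hS Z hZ TB (fun q _ _ u v => hTB q u v) S hSS).trans ?_
  have hY : 1 ≤ ⌊Z⌋₊ := Nat.one_le_floor_iff _ |>.mpr hZ
  have hlogZ : 0 ≤ Real.log Z := Real.log_nonneg hZ
  have key : ∑ q ∈ Finset.Icc 1 ⌊Z⌋₊, ((q:ℝ) ^ Fintype.card ι)⁻¹ * ((2 + Real.log q) * TB q) * (1 + q * L * R / Z)
      ≤ K2 * K3 * ((L:ℝ) ^ ε * Z ^ ε * (1 + L * R / Z)) := by
    have hLR : 0 ≤ L * R / Z := by positivity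
    calc _ ≤ ∑ q ∈ Finset.Icc 1 ⌊Z⌋₊, (2 + Real.log Z) * (1 + L * R / Z) * (((q:ℝ) ^ Fintype.card ι)⁻¹ * TB q * q) := by
          refine Finset.sum_le_sum fun q hq => ?_
          obtain ⟨hq1, hq2⟩ := Finset.mem_Icc.mp hq
          have hq1' : (1:ℝ) ≤ q := by exact_mod_cast hq1
          have hqZ : (q:ℝ) ≤ Z := (Nat.le_floor_iff (by linarith)).mp hq2
          have hl : Real.log q ≤ Real.log Z := Real.log_le_log (by linarith) hqZ
          have hl0 : 0 ≤ Real.log q := Real.log_nonneg hq1'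
          have e : 1 + q * L * R / Z ≤ q * (1 + L * R / Z) := by
            have : q * (1 + L * R / Z) = q + q * L * R / Z := by ring
            rw [this]; linarith
          have := hTB0 q
          calc _ ≤ ((q:ℝ) ^ Fintype.card ι)⁻¹ * ((2 + Real.log Z) * TB q) * (q * (1 + L * R / Z)) := by gcongr
            _ = _ := by ring
      _ = (2 + Real.log Z) * (1 + L * R / Z) * ∑ q ∈ Finset.Icc 1 ⌊Z⌋₊, (((q:ℝ) ^ Fintype.card ι)⁻¹ * TB q * q) := by rw [Finset.mul_sum]
      _ ≤ (2 + Real.log Z) * (1 + L * R / Z) * (K2 * (L:ℝ) ^ ε * (2 + Real.log Z) ^ 3) := by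
          gcongr
          refine (hsum _ hY).trans ?_
          have h0 : 0 ≤ Real.log ⌊Z⌋₊ := Real.log_natCast_nonneg _
          have : Real.log ⌊Z⌋₊ ≤ Real.log Z := Real.log_le_log (by exact_mod_cast hY) (Nat.floor_le (by linarith))
          gcongr
          linarith
      _ = K2 * (L:ℝ) ^ ε * (1 + L * R / Z) * (2 + Real.log Z) ^ 4 := by ring
      _ ≤ K2 * (L:ℝ) ^ ε * (1 + L * R / Z) * (K3 * Z ^ ε) := by gcongr; exact h3 Z hZ
      _ = _ := by ring
  calc _ ≤ K1 * (L:ℝ)⁻¹ * (Z ^ Fintype.card ι * (Z ^ 2)⁻¹) * (K2 * K3 * ((L:ℝ) ^ ε * Z ^ ε * (1 + L * R / Z))) := by gcongr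
    _ = _ := by ring
end QH
end

open scoped BigOperators
open Finset Filter Topology Matrix
noncomputable section
namespace QH
variable {ι : Type*} [Fintype ι] [DecidableEq ι]

lemma quad_exp {A : Type*} [CommRing A] (X U : Matrix ι ι A) (x0 c : ι → A) (L : A) :
    (x0 + L • (U *ᵥ c)) ⬝ᵥ X *ᵥ (x0 + L • (U *ᵥ c)) = x0 ⬝ᵥ X *ᵥ x0 + L * ((((X + Xᵀ) *ᵥ x0) ᵥ* U) ⬝ᵥ c)
      + L ^ 2 * (c ⬝ᵥ (Uᵀ * X * U) *ᵥ c) := by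
  have e1 : c ⬝ᵥ (Uᵀ * X * U) *ᵥ c = (U *ᵥ c) ⬝ᵥ X *ᵥ (U *ᵥ c) := by
    rw [← Matrix.mulVec_mulVec, ← Matrix.mulVec_mulVec, Matrix.dotProduct_mulVec c, Matrix.vecMul_transpose]
  have e2 : (((X + Xᵀ) *ᵥ x0) ᵥ* U) ⬝ᵥ c = x0 ⬝ᵥ X *ᵥ (U *ᵥ c) + (U *ᵥ c) ⬝ᵥ X *ᵥ x0 := by
    rw [← Matrix.dotProduct_mulVec, Matrix.add_mulVec, add_dotProduct, Matrix.mulVec_transpose, ← Matrix.dotProduct_mulVec, add_comm]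
    congr 1
    exact dotProduct_comm _ _
  rw [e1, e2]
  simp only [Matrix.mulVec_add, Matrix.mulVec_smul, dotProduct_add, add_dotProduct, dotProduct_smul, smul_dotProduct, smul_eq_mul]
  ring

lemma qpoly_dot {A : Type*} [CommRing A] (C : Matrix ι ι ℤ) (l : ι → ℤ) (k : ℤ) (x : ι → A) :
    qpoly C l k x = x ⬝ᵥ (C.map (Int.cast : ℤ → A)) *ᵥ x + (fun i => (l i : A)) ⬝ᵥ x + (k : A) := by
  unfold qpoly
  congr 2
  simp only [dotProduct, Matrix.mulVec, Matrix.map_apply, Finset.mul_sum]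
  refine Finset.sum_congr rfl fun i _ => Finset.sum_congr rfl fun j _ => by ring

lemma intcast_mul {A : Type*} [CommRing A] (X Y : Matrix ι ι ℤ) :
    (X * Y).map (Int.cast : ℤ → A) = X.map Int.cast * Y.map Int.cast := 
  Matrix.map_mul (f := Int.castRingHom A)

/-- integer setup -/
theorem int_setup (i0 : ι) (Cf N : Matrix ι ι ℤ) (hN : Cf + Cfᵀ = N) (hdet : N.det ≠ 0) (L : ℕ) (hL : 1 ≤ L)
    (x0 : ι → ℤ) (hx0 : x0 ⬝ᵥ Cf *ᵥ x0 = 0) (hg : ∀ p : ℤ, p ∣ L → (∀ i, p ∣ x0 i) → IsUnit p) :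
    ∃ (L' e : ℕ) (W W' : Matrix ι ι ℤ) (Ct : Matrix ι ι ℤ) (l' : ι → ℤ), L = e * L' ∧ (e : ℤ) ∣ N.det ∧ W * W' = 1 ∧
      Arith Ct l' 0 i0 L' (Wᵀ * N * W) ∧
      (∀ c : ι → ℤ, (L : ℤ) ^ 2 * qpoly Ct l' 0 c = (x0 + (L:ℤ) • ((W * Matrix.diagonal (dL i0 L')) *ᵥ c)) ⬝ᵥ Cf *ᵥ (x0 + (L:ℤ) • ((W * Matrix.diagonal (dL i0 L')) *ᵥ c))) ∧
      (∀ x : ι → ℤ, x ⬝ᵥ Cf *ᵥ x = 0 → (∀ i, (L:ℤ) ∣ x i - x0 i) → ∃ c, x = x0 + (L:ℤ) • ((W * Matrix.diagonal (dL i0 L')) *ᵥ c)) := by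
  set l := N *ᵥ x0 with hl
  obtain ⟨W, W', hW, hlW⟩ := uni_exists i0 l
  have hW2 : W' * W = 1 := mul_eq_one_comm.mp hW
  set e0 : ℤ := (l ᵥ* W) i0 with he0
  set e : ℕ := Int.gcd e0 L with he
  have heL : e ∣ L := by
    have : (e:ℤ) ∣ L := Int.gcd_dvd_right _ _
    exact_mod_cast this
  have he0' : (e : ℤ) ∣ e0 := Int.gcd_dvd_left _ _
  obtain ⟨L', hL'⟩ := heL
  obtain ⟨m, hm⟩ := he0'
  have hepos : 0 < e := Nat.pos_of_ne_zero fun h => by rw [h] at hL'; omega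
  have hL'pos : 1 ≤ L' := Nat.pos_of_ne_zero fun h => by rw [h] at hL'; omega
  have hL0 : (L:ℤ) ≠ 0 := by exact_mod_cast (show L ≠ 0 by omega)
  have hez : (e:ℤ) ≠ 0 := by exact_mod_cast hepos.ne'
  have hcop : IsCoprime m (L' : ℤ) := by
    rw [Int.isCoprime_iff_gcd_eq_one]
    have h1 : Int.gcd ((e:ℤ) * m) ((e:ℤ) * L') = e * Int.gcd m L' := by
      rw [Int.gcd_mul_left]; simp
    rw [← hm] at h1
    have h2 : ((e:ℤ) * L') = L := by rw [hL']; push_cast; rfl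
    rw [h2, ← he] at h1
    exact Nat.eq_of_mul_eq_mul_left hepos (by rw [← h1, mul_one])
  have hlWe : ∀ i, (l ᵥ* W) i = if i = i0 then e0 else 0 := by
    intro i
    split_ifs with h
    · rw [h]
    · exact hlW i h
  have hedet : (e : ℤ) ∣ N.det := by
    -- e divides l
    have h1 : ∀ i, (e:ℤ) ∣ l i := by
      have h : l = (l ᵥ* W) ᵥ* W' := by rw [Matrix.vecMul_vecMul, hW, Matrix.vecMul_one]
      intro i
      rw [h]
      refine Finset.dvd_sum fun j _ => Dvd.dvd.mul_right ?_ _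
      rw [hlWe]
      split_ifs
      · exact ⟨m, hm⟩
      · exact dvd_zero _
    have h2 : ∀ i, (e:ℤ) ∣ N.det * x0 i := by
      intro i
      have h3 : N.adjugate *ᵥ l = N.det • x0 := by
        rw [hl, Matrix.mulVec_mulVec, Matrix.adjugate_mul, Matrix.smul_mulVec, Matrix.one_mulVec]
      have h4 := congrFun h3 i
      simp only [Pi.smul_apply, smul_eq_mul] at h4
      rw [← h4]
      exact Finset.dvd_sum fun j _ => Dvd.dvd.mul_left (h1 j) _
    have h3 : (e:ℤ) ∣ N.det * L := Dvd.dvd.mul_left (Int.gcd_dvd_right _ _) _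
    -- gcd combination
    set G : ℤ := gcd (Finset.univ.gcd x0) (L:ℤ) with hG
    have hGu : IsUnit G := hg G (gcd_dvd_right _ _) fun i => (gcd_dvd_left _ _).trans (Finset.gcd_dvd (Finset.mem_univ i))
    have h5 : (e:ℤ) ∣ N.det * Finset.univ.gcd x0 := by
      have : (e:ℤ) ∣ Finset.univ.gcd (fun i => N.det * x0 i) := Finset.dvd_gcd fun i _ => h2 i
      rw [Finset.gcd_mul_left] at this
      exact this.trans (mul_dvd_mul_right (normalize_dvd_iff.mpr dvd_rfl) _)
    have h6 : (e:ℤ) ∣ N.det * G := by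
      have := dvd_gcd h5 h3
      rw [_root_.gcd_mul_left] at this
      exact this.trans (mul_dvd_mul_right (normalize_dvd_iff.mpr dvd_rfl) _)
    exact (hGu.dvd_mul_right).mp h6
  set U := W * Matrix.diagonal (dL i0 L') with hU
  set Ct := Uᵀ * Cf * U with hCt
  set l' : ι → ℤ := fun i => if i = i0 then m else 0 with hl'
  have hlU : l ᵥ* U = (L:ℤ) • l' := by
    rw [hU, ← Matrix.vecMul_vecMul]
    funext i
    rw [Matrix.vecMul_diagonal, hlWe]
    simp only [Pi.smul_apply, hl', dL, smul_eq_mul]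
    split_ifs
    · rw [hm, hL']; push_cast; ring
    · simp
  have hDN : (Wᵀ * N * W).det = N.det := by
    have : W.det * W'.det = 1 := by rw [← Matrix.det_mul, hW, Matrix.det_one]
    have h2 : W.det * W.det = 1 := by
      rcases Int.isUnit_iff.mp (IsUnit.of_mul_eq_one _ this) with h | h <;> rw [h] <;> norm_num
    rw [Matrix.det_mul, Matrix.det_mul, Matrix.det_transpose]
    linear_combination N.det * h2
  have hdiag : (Matrix.diagonal (dL i0 L')) = Matrix.diagonal (fun i => if i = i0 then (L' : ℤ) else 1) := rfl
  have hexp : ∀ {A : Type} [CommRing A] (c : ι → A), (L : A) ^ 2 * qpoly Ct l' 0 c = 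
      ((fun i => (x0 i : A)) + (L:A) • ((U.map (Int.cast : ℤ → A)) *ᵥ c)) ⬝ᵥ (Cf.map (Int.cast : ℤ → A)) *ᵥ ((fun i => (x0 i : A)) + (L:A) • ((U.map (Int.cast : ℤ → A)) *ᵥ c)) := by
    intro A _ c
    rw [quad_exp, qpoly_dot]
    have h1 : (fun i => (x0 i : A)) ⬝ᵥ (Cf.map (Int.cast : ℤ → A)) *ᵥ (fun i => (x0 i : A)) = 0 := by
      have := congrArg (Int.cast : ℤ → A) hx0
      simpa [dotProduct, Matrix.mulVec, Finset.mul_sum] using this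
    have h2 : (((Cf.map (Int.cast : ℤ → A)) + (Cf.map (Int.cast : ℤ → A))ᵀ) *ᵥ (fun i => (x0 i : A))) ᵥ* (U.map (Int.cast : ℤ → A)) = (L : A) • (fun i => (l' i : A)) := by
      funext i
      have := congrArg (Int.cast : ℤ → A) (congrFun hlU i)
      rw [hl, ← hN] at this
      simpa [dotProduct, Matrix.mulVec, Matrix.vecMul, Finset.sum_mul] using this
    have h3 : Ct.map (Int.cast : ℤ → A) = (U.map (Int.cast : ℤ → A))ᵀ * Cf.map (Int.cast : ℤ → A) * U.map (Int.cast : ℤ → A) := by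
      rw [hCt, intcast_mul, intcast_mul]; rfl
    rw [h1, h2, h3, smul_dotProduct]
    simp only [smul_eq_mul, Int.cast_zero]
    ring
  refine ⟨L', e, W, W', Ct, l', hL', hedet, hW, ⟨hL'pos, ?_, by rw [hDN]; exact hdet, ?_, ?_, ?_⟩, ?_, ?_⟩
  · rw [← hdiag, hCt, hU, ← hN]
    simp only [Matrix.transpose_mul, Matrix.transpose_transpose, Matrix.diagonal_transpose, Matrix.mul_add, Matrix.add_mul, Matrix.mul_assoc]
  · have : Ct = Matrix.diagonal (dL i0 L') * (Wᵀ * Cf * W * Matrix.diagonal (dL i0 L')) := by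
      rw [hCt, hU]
      simp only [Matrix.transpose_mul, Matrix.diagonal_transpose, Matrix.mul_assoc]
    rw [this, Matrix.diagonal_mul]
    exact Dvd.dvd.mul_right (by simp [dL]) _
  · simpa [hl'] using hcop
  · intro p hp hpd
    haveI : Fact p.Prime := ⟨hp⟩
    rw [hDN] at hpd
    have hpL' : ((L' : ℕ) : ZMod p) ≠ 0 := by
      intro h
      rw [ZMod.natCast_eq_zero_iff] at h
      exact hpd (Dvd.dvd.mul_left (by exact_mod_cast h) _)
    have hpe : ((e : ℕ) : ZMod p) ≠ 0 := by
      intro h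
      rw [ZMod.natCast_eq_zero_iff] at h
      have : (p:ℤ) ∣ N.det := dvd_trans (by exact_mod_cast h) hedet
      exact hpd ((this.mul_left 2).mul_right _)
    have hpL : ((L : ℕ) : ZMod p) ≠ 0 := by
      rw [hL']; push_cast; exact mul_ne_zero hpe hpL'
    set UU := U.map (Int.cast : ℤ → ZMod p) with hUU
    have hWW : W.map (Int.cast : ℤ → ZMod p) * W'.map (Int.cast : ℤ → ZMod p) = 1 := by
      rw [← intcast_mul, hW]
      ext i j
      simp [Matrix.one_apply]
    have hdet' : UU.det ≠ 0 := by
      rw [hUU, hU, intcast_mul, Matrix.det_mul]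
      refine mul_ne_zero (fun h => ?_) ?_
      · have := congrArg Matrix.det hWW
        rw [Matrix.det_mul, h, Matrix.det_one, zero_mul] at this
        exact zero_ne_one this
      · rw [Matrix.diagonal_map (by simp), Matrix.det_diagonal]
        refine Finset.prod_ne_zero_iff.mpr fun i _ => ?_
        simp only [dL]
        split_ifs
        · simpa using hpL'
        · simp
    have hinv : UU * UU⁻¹ = 1 := Matrix.mul_nonsing_inv _ (isUnit_iff_ne_zero.mpr hdet')
    set h : ι → ZMod p := (L : ZMod p)⁻¹ • (UU⁻¹ *ᵥ (fun i => (x0 i : ZMod p))) with hh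
    refine ⟨h, fun x => ?_⟩
    have hx : (fun i => (x0 i : ZMod p)) = (L : ZMod p) • (UU *ᵥ h) := by
      rw [hh, Matrix.mulVec_smul, smul_smul, mul_inv_cancel₀ hpL, one_smul, Matrix.mulVec_mulVec, hinv, Matrix.one_mulVec]
    have key := hexp (A := ZMod p) x
    rw [hx, ← smul_add, ← Matrix.mulVec_add] at key
    have e1 : ((L : ZMod p) • UU *ᵥ (h + x)) ⬝ᵥ (Cf.map (Int.cast : ℤ → ZMod p)) *ᵥ ((L : ZMod p) • UU *ᵥ (h + x)) =
        (L : ZMod p) ^ 2 * ((h + x) ⬝ᵥ (Ct.map (Int.cast : ℤ → ZMod p)) *ᵥ (h + x)) := by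
      have := quad_exp (Cf.map (Int.cast : ℤ → ZMod p)) UU 0 (h + x) (L : ZMod p)
      have h3 : Ct.map (Int.cast : ℤ → ZMod p) = UUᵀ * Cf.map (Int.cast : ℤ → ZMod p) * UU := by
        rw [hCt, intcast_mul, intcast_mul]; rfl
      rw [h3]
      simpa using this
    rw [e1] at key
    have key2 := mul_left_cancel₀ (pow_ne_zero 2 hpL) key
    rw [key2]
    simp only [dotProduct, Matrix.mulVec, Matrix.map_apply, Finset.mul_sum, Pi.add_apply]
    refine Finset.sum_congr rfl fun i _ => Finset.sum_congr rfl fun j _ => by ring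
  · intro c
    have := hexp (A := ℤ) c
    have m1 : ∀ X : Matrix ι ι ℤ, X.map (Int.cast : ℤ → ℤ) = X := fun X => by ext i j; simp
    rw [m1, m1] at this
    exact this
  · intro x hx hxL
    choose y hy using hxL
    have hxy : x = x0 + (L:ℤ) • y := by
      funext i
      simp only [Pi.add_apply, Pi.smul_apply, smul_eq_mul]
      linarith [hy i]
    have h1 := quad_exp Cf 1 x0 y (L:ℤ)
    rw [Matrix.one_mulVec, ← hxy, hx, hx0, hN, ← hl, Matrix.vecMul_one] at h1
    have h2 : (L:ℤ) ∣ l ⬝ᵥ y := by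
      refine ⟨-(y ⬝ᵥ ((1:Matrix ι ι ℤ)ᵀ * Cf * 1) *ᵥ y), mul_left_cancel₀ hL0 ?_⟩
      linear_combination -h1
    have h3 : l ⬝ᵥ y = e0 * (W' *ᵥ y) i0 := by
      have : l ⬝ᵥ y = (l ᵥ* W) ⬝ᵥ (W' *ᵥ y) := by
        rw [← Matrix.dotProduct_mulVec, Matrix.mulVec_mulVec, hW, Matrix.one_mulVec]
      rw [this, dotProduct, Finset.sum_eq_single i0]
      · intro i _ hi
        rw [hlWe, if_neg hi, zero_mul]
      · simp
    have h4 : (L':ℤ) ∣ (W' *ᵥ y) i0 := by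
      rw [h3, hm, hL', Nat.cast_mul, mul_assoc] at h2
      exact hcop.symm.dvd_of_dvd_mul_left (Int.dvd_of_mul_dvd_mul_left hez h2)
    obtain ⟨c0, hc0⟩ := h4
    refine ⟨fun i => if i = i0 then c0 else (W' *ᵥ y) i, ?_⟩
    rw [hxy]
    congr 2
    rw [← Matrix.mulVec_mulVec]
    have : Matrix.diagonal (dL i0 L') *ᵥ (fun i => if i = i0 then c0 else (W' *ᵥ y) i) = W' *ᵥ y := by
      funext i
      rw [Matrix.mulVec_diagonal]
      simp only [dL]
      split_ifs with h
      · rw [h, hc0]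
      · rw [one_mul]
    rw [this, Matrix.mulVec_mulVec, hW, Matrix.one_mulVec]
end QH
end

open scoped BigOperators
open Finset Filter Topology Matrix
noncomputable section
namespace QH
variable {ι : Type*} [Fintype ι] [DecidableEq ι]

lemma real_diag (X : Matrix ι ι ℝ) (hX : (X + Xᵀ).det ≠ 0) : ∃ (A : Matrix ι ι ℝ) (s : ι → ℝ), A.det ≠ 0 ∧ (∀ i, s i ^ 2 = 1) ∧
    ∀ x, x ⬝ᵥ X *ᵥ x = ∑ i, s i * (A *ᵥ x) i ^ 2 := by
  obtain ⟨w, E, hE⟩ := diag_form (two_ne_zero) X hX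
  set E' := LinearMap.toMatrix' (E : (ι → ℝ) →ₗ[ℝ] (ι → ℝ)) with hE'
  have hEd : E'.det ≠ 0 := by
    have h1 : E' * LinearMap.toMatrix' (E.symm : (ι → ℝ) →ₗ[ℝ] (ι → ℝ)) = 1 := by
      rw [hE', ← LinearMap.toMatrix'_comp]
      simp
    intro h
    have := congrArg Matrix.det h1
    rw [Matrix.det_mul, h, Matrix.det_one, zero_mul] at this
    exact zero_ne_one this
  have hEx : ∀ x, E' *ᵥ x = E x := fun x => by
    rw [hE', ← Matrix.toLin'_apply, Matrix.toLin'_toMatrix']; rfl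
  refine ⟨Matrix.diagonal (fun i => Real.sqrt |(w i : ℝ)|) * E', fun i => SignType.sign (w i : ℝ), ?_, ?_, ?_⟩
  · rw [Matrix.det_mul, Matrix.det_diagonal]
    refine mul_ne_zero (Finset.prod_ne_zero_iff.mpr fun i _ => ?_) hEd
    exact (Real.sqrt_pos.mpr (abs_pos.mpr (w i).ne_zero)).ne'
  · intro i
    show ((SignType.sign (w i : ℝ) : SignType) : ℝ) ^ 2 = 1
    rcases lt_or_gt_of_ne (w i).ne_zero with h | h
    · rw [sign_neg h]; simp
    · rw [sign_pos h]; simp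
  · intro x
    have : x ⬝ᵥ X *ᵥ x = ∑ i, ∑ j, X i j * x i * x j := by
      simp only [dotProduct, Matrix.mulVec, Finset.mul_sum]
      refine Finset.sum_congr rfl fun i _ => Finset.sum_congr rfl fun j _ => by ring
    rw [this, hE]
    refine Finset.sum_congr rfl fun i _ => ?_
    rw [← Matrix.mulVec_mulVec, Matrix.mulVec_diagonal, hEx, mul_pow, Real.sq_sqrt (abs_nonneg _), ← mul_assoc, sign_mul_abs]

lemma pm_apply (A M : Matrix ι ι ℝ) (W : Matrix ι ι ℤ) (i0 i1 : ι) (R : ℝ) (L L' : ℕ) (hL : 1 ≤ L) (γ : ι → ℝ) (x0 : ι → ℤ)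
    (hγ : (L:ℝ) • (((W * Matrix.diagonal (dL i0 L')).map (Int.cast : ℤ → ℝ)) *ᵥ γ) = fun i => (x0 i : ℝ)) (c : ι → ℤ) :
    PM A M W i0 i1 R L' *ᵥ (fun i => c i + γ i) = 
      (L:ℝ)⁻¹ • (A *ᵥ (gR i0 i1 R *ᵥ (M *ᵥ (fun i => (((x0 + (L:ℤ) • ((W * Matrix.diagonal (dL i0 L')) *ᵥ c)) i : ℤ) : ℝ))))) := by
  have hL0 : (L:ℝ) ≠ 0 := by positivity
  set U := W * Matrix.diagonal (dL i0 L') with hU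
  have h1 : (fun i => (((x0 + (L:ℤ) • (U *ᵥ c)) i : ℤ) : ℝ)) = (L:ℝ) • ((U.map (Int.cast : ℤ → ℝ)) *ᵥ (fun i => c i + γ i)) := by
    have h2 : (fun i => (c i : ℝ) + γ i) = (fun i => (c i : ℝ)) + γ := rfl
    rw [h2, Matrix.mulVec_add, smul_add, hγ]
    funext i
    simp [Matrix.mulVec, dotProduct]
    ring
  rw [h1]
  simp only [Matrix.mulVec_smul, smul_smul, inv_mul_cancel₀ hL0, one_smul, Matrix.mulVec_mulVec]
  unfold PM
  rw [← hU]
  simp only [Matrix.mul_assoc]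

lemma gamma_exists (W W' : Matrix ι ι ℤ) (hW : W * W' = 1) (i0 : ι) (L L' : ℕ) (hL : 1 ≤ L) (hL' : 1 ≤ L') (x0 : ι → ℤ) :
    ∃ γ : ι → ℝ, (L:ℝ) • (((W * Matrix.diagonal (dL i0 L')).map (Int.cast : ℤ → ℝ)) *ᵥ γ) = fun i => (x0 i : ℝ) := by
  set UU := (W * Matrix.diagonal (dL i0 L')).map (Int.cast : ℤ → ℝ) with hUU
  have hL0 : (L:ℝ) ≠ 0 := by positivity
  have hL0' : (L':ℝ) ≠ 0 := by positivity
  have hWW : W.map (Int.cast : ℤ → ℝ) * W'.map (Int.cast : ℤ → ℝ) = 1 := by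
    rw [← intcast_mul, hW]
    ext i j
    simp [Matrix.one_apply]
  have hdet' : UU.det ≠ 0 := by
    rw [hUU, intcast_mul, Matrix.det_mul]
    refine mul_ne_zero (fun h => ?_) ?_
    · have := congrArg Matrix.det hWW
      rw [Matrix.det_mul, h, Matrix.det_one, zero_mul] at this
      exact zero_ne_one this
    · rw [Matrix.diagonal_map (by simp), Matrix.det_diagonal]
      refine Finset.prod_ne_zero_iff.mpr fun i _ => ?_
      simp only [dL]
      split_ifs
      · simpa using hL0'
      · simp
  have hinv : UU * UU⁻¹ = 1 := Matrix.mul_nonsing_inv _ (isUnit_iff_ne_zero.mpr hdet')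
  refine ⟨(L : ℝ)⁻¹ • (UU⁻¹ *ᵥ (fun i => (x0 i : ℝ))), ?_⟩
  rw [Matrix.mulVec_smul, smul_smul, mul_inv_cancel₀ hL0, one_smul, Matrix.mulVec_mulVec, hinv, Matrix.one_mulVec]

/-- abstract count : solutions through a base point -/
theorem sol_count (i0 i1 : ι) (hi : i1 ≠ i0) (hd : 5 ≤ Fintype.card ι) (Cf N : Matrix ι ι ℤ) (hN : Cf + Cfᵀ = N) (hdet : N.det ≠ 0)
    (A M : Matrix ι ι ℝ) (s : ι → ℝ) (hA : A.det ≠ 0) (hM : M.det ≠ 0) (hs : ∀ i, s i ^ 2 = 1)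
    (hF : ∀ R : ℝ, 1 ≤ R → ∀ x : ι → ℤ, ((x ⬝ᵥ Cf *ᵥ x : ℤ) : ℝ) = ∑ i, s i * (A *ᵥ (gR i0 i1 R *ᵥ (M *ᵥ (fun i => (x i : ℝ))))) i ^ 2)
    (K1 : ℝ) (hK1 : 0 ≤ K1) (ε : ℝ) (hε : 0 < ε) :
    ∃ K : ℝ, 0 < K ∧ ∀ R : ℝ, 1 ≤ R → ∀ L : ℕ, 1 ≤ L → ∀ Z : ℝ, 1 ≤ Z → ∀ T : Set (ι → ℤ), 
      (∀ x ∈ T, x ⬝ᵥ Cf *ᵥ x = 0 ∧ ‖gR i0 i1 R *ᵥ (M *ᵥ (fun i => (x i : ℝ)))‖ ≤ K1 * (L * Z) ∧ 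
        (∀ p : ℤ, p ∣ L → (∀ i, p ∣ x i) → IsUnit p)) → 
      (∀ x ∈ T, ∀ y ∈ T, ∀ i, (L:ℤ) ∣ x i - y i) →
      (Nat.card T : ℝ) ≤ K * ((L:ℝ)⁻¹ * (Z ^ Fintype.card ι * (Z ^ 2)⁻¹) * ((L:ℝ) ^ ε * Z ^ ε * (1 + L * R / Z))) := by
  obtain ⟨K, hK, hcount⟩ := count_bound2 A M hA hM i0 i1 hi hd (Fintype.card ι * (mabs A * K1) ^ 2) N.det.natAbs ε hε
  refine ⟨K * N.det.natAbs, mul_pos hK (by exact_mod_cast Int.natAbs_pos.mpr hdet), ?_⟩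
  intro R hR L hL Z hZ T hT hTL
  have hL0 : (0:ℝ) < L := by exact_mod_cast hL
  rcases T.finite_or_infinite with hfin | hinf
  swap
  · haveI := hinf.to_subtype
    rw [Nat.card_eq_zero_of_infinite, Nat.cast_zero]
    positivity
  rcases T.eq_empty_or_nonempty with hemp | ⟨x0, hx0⟩
  · rw [hemp]; simp; positivity
  obtain ⟨hx1, hx2, hx3⟩ := hT x0 hx0
  obtain ⟨L', e, W, W', Ct, l', hLe, hedet, hW, hAr, hq, hsol⟩ := int_setup i0 Cf N hN hdet L hL x0 hx1 hx3
  have hL' := hAr.hL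
  obtain ⟨γ, hγ⟩ := gamma_exists W W' hW i0 L L' hL hL' x0
  have hpm := pm_apply A M W i0 i1 R L L' hL γ x0 hγ
  have hL0' : (0:ℝ) < L' := by exact_mod_cast hL'
  have hsetup : Setup (PM A M W i0 i1 R L') s γ Ct l' 0 := by
    refine ⟨?_, hs, ?_⟩
    · have := det_PM A M W W' hW i0 i1 hi R (by linarith) L'
      rw [← abs_pos, this]
      have := abs_pos.mpr hA
      have := abs_pos.mpr hM
      positivity
    · intro c
      have h1 := congrArg (Int.cast : ℤ → ℝ) (hq c)
      rw [hF R hR] at h1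
      rw [hpm]
      simp only [Pi.smul_apply, smul_eq_mul, mul_pow]
      push_cast at h1
      have h2 : ∀ (y : ι → ℝ), ∑ i, s i * ((L:ℝ)⁻¹ ^ 2 * y i ^ 2) = (L:ℝ)⁻¹ ^ 2 * ∑ i, s i * y i ^ 2 := by
        intro y; rw [Finset.mul_sum]; refine Finset.sum_congr rfl fun i _ => by ring
      rw [h2]
      push_cast
      rw [← h1]
      field_simp
  have hDN : (Wᵀ * N * W).det.natAbs = N.det.natAbs := by
    have : W.det * W'.det = 1 := by rw [← Matrix.det_mul, hW, Matrix.det_one]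
    have h2 : W.det.natAbs = 1 := Int.isUnit_iff_natAbs_eq.mp (IsUnit.of_mul_eq_one _ this)
    rw [Matrix.det_mul, Matrix.det_mul, Matrix.det_transpose, Int.natAbs_mul, Int.natAbs_mul, h2]
    ring
  have hex : ∀ x : T, ∃ c : ι → ℤ, (x : ι → ℤ) = x0 + (L:ℤ) • ((W * Matrix.diagonal (dL i0 L')) *ᵥ c) := fun x =>
    hsol x (hT x x.2).1 (hTL x x.2 x0 hx0)
  choose φ hφ using hex
  have hinj : Function.Injective φ := by
    intro x y h
    apply Subtype.ext
    rw [hφ x, hφ y, h]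
  haveI : Fintype T := hfin.fintype
  have hmain := hcount R hR L' hL' W W' hW s γ Ct l' 0 _ hsetup hDN hAr Z hZ (Finset.univ.map ⟨φ, hinj⟩) (by
    intro c hc
    obtain ⟨x, -, rfl⟩ := Finset.mem_map.mp hc
    simp only [Function.Embedding.coeFn_mk]
    have h1 := hq (φ x)
    rw [← hφ x, (hT x x.2).1] at h1
    refine ⟨?_, ?_⟩
    · have : (L:ℤ) ^ 2 ≠ 0 := pow_ne_zero _ (by exact_mod_cast hL0.ne')
      simpa [hL0.ne', (show L ≠ 0 by omega)] using h1
    · rw [hpm, ← hφ x]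
      have h2 := (hT x x.2).2.1
      set z := gR i0 i1 R *ᵥ (M *ᵥ (fun i => ((x : ι → ℤ) i : ℝ))) with hz
      have h3 : ∀ i, (((L:ℝ)⁻¹ • (A *ᵥ z)) i) ^ 2 ≤ (mabs A * K1) ^ 2 * Z ^ 2 := by
        intro i
        rw [← mul_pow]
        apply sq_le_sq'
        · have h4 : |((L:ℝ)⁻¹ • (A *ᵥ z)) i| ≤ mabs A * K1 * Z := by
            rw [Pi.smul_apply, smul_eq_mul, abs_mul, abs_of_pos (by positivity)]
            calc (L:ℝ)⁻¹ * |(A *ᵥ z) i| ≤ (L:ℝ)⁻¹ * (mabs A * (K1 * (L * Z))) := by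
                  gcongr
                  refine (norm_le_pi_norm (A *ᵥ z) i).trans ((mv_le A z).trans ?_)
                  gcongr
                  exact mabs_nonneg A
              _ = _ := by field_simp
          linarith [(abs_le.mp h4).1]
        · have h4 : |((L:ℝ)⁻¹ • (A *ᵥ z)) i| ≤ mabs A * K1 * Z := by
            rw [Pi.smul_apply, smul_eq_mul, abs_mul, abs_of_pos (by positivity)]
            calc (L:ℝ)⁻¹ * |(A *ᵥ z) i| ≤ (L:ℝ)⁻¹ * (mabs A * (K1 * (L * Z))) := by
                  gcongr
                  refine (norm_le_pi_norm (A *ᵥ z) i).trans ((mv_le A z).trans ?_)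
                  gcongr
                  exact mabs_nonneg A
              _ = _ := by field_simp
          linarith [(abs_le.mp h4).2]
      calc _ ≤ ∑ i : ι, (mabs A * K1) ^ 2 * Z ^ 2 := Finset.sum_le_sum fun i _ => h3 i
        _ = _ := by simp; ring)
  rw [Finset.card_map, Finset.card_univ, ← Nat.card_eq_fintype_card] at hmain
  refine hmain.trans ?_
  have he : (e:ℝ) ≤ N.det.natAbs := by
    have : e ∣ N.det.natAbs := Int.natCast_dvd.mp hedet
    exact_mod_cast Nat.le_of_dvd (Int.natAbs_pos.mpr hdet) this
  have hLL : (L:ℝ) = e * L' := by exact_mod_cast hLe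
  have he1 : (1:ℝ) ≤ e := by
    have : 1 ≤ e := Nat.pos_of_ne_zero fun h => by rw [h] at hLe; omega
    exact_mod_cast this
  have hi1 : (L':ℝ)⁻¹ ≤ N.det.natAbs * (L:ℝ)⁻¹ := by
    rw [hLL, mul_inv, ← mul_assoc]
    refine le_mul_of_one_le_left (by positivity) ?_
    rw [← div_eq_mul_inv, one_le_div (by linarith)]
    exact he
  have hle : (L':ℝ) ≤ L := by rw [hLL]; exact le_mul_of_one_le_left hL0'.le he1
  calc _ ≤ K * ((N.det.natAbs * (L:ℝ)⁻¹) * (Z ^ Fintype.card ι * (Z ^ 2)⁻¹) * ((L:ℝ) ^ ε * Z ^ ε * (1 + L * R / Z))) := by gcongr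
    _ = _ := by ring
end QH
end

namespace QH
open Quad
/-- upper triangular integral matrix of the form -/
def Cfm {m : ℕ} (N : Matrix (Fin m) (Fin m) ℤ) : Matrix (Fin m) (Fin m) ℤ := fun i j => if i < j then N i j else if i = j then N i i / 2 else 0

lemma Cfm_add {m : ℕ} (N : Matrix (Fin m) (Fin m) ℤ) (hs : N.IsSymm) (he : ∀ i, Even (N i i)) : Cfm N + (Cfm N)ᵀ = N := by
  ext i j
  simp only [Matrix.add_apply, Matrix.transpose_apply, Cfm]
  rcases lt_trichotomy i j with h | h | h
  · simp [h, h.not_gt, h.ne']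
  · subst h
    obtain ⟨r, hr⟩ := he i
    simp; omega
  · simp [h, h.not_gt, h.ne']
    exact hs.apply i j

lemma FR_eq {m : ℕ} (N : Matrix (Fin m) (Fin m) ℤ) (hs : N.IsSymm) (he : ∀ i, Even (N i i)) (x : Fin m → ℝ) :
    FR N x = x ⬝ᵥ ((Cfm N).map (Int.cast : ℤ → ℝ)) *ᵥ x := by
  have h1 : ∑ i, ∑ j, (N i j : ℝ) * x i * x j = 2 * (x ⬝ᵥ ((Cfm N).map (Int.cast : ℤ → ℝ)) *ᵥ x) := by
    have e : x ⬝ᵥ ((Cfm N).map (Int.cast : ℤ → ℝ)) *ᵥ x = ∑ i, ∑ j, (Cfm N i j : ℝ) * x i * x j := by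
      simp only [dotProduct, Matrix.mulVec, Matrix.map_apply, Finset.mul_sum]
      refine Finset.sum_congr rfl fun i _ => Finset.sum_congr rfl fun j _ => by ring
    have e2 : ∑ i, ∑ j, (Cfm N i j : ℝ) * x i * x j = ∑ i, ∑ j, (Cfm N j i : ℝ) * x i * x j := by
      rw [Finset.sum_comm]
      refine Finset.sum_congr rfl fun i _ => Finset.sum_congr rfl fun j _ => by ring
    rw [e, two_mul]
    nth_rewrite 2 [e2]
    rw [← Finset.sum_add_distrib]
    refine Finset.sum_congr rfl fun i _ => ?_
    rw [← Finset.sum_add_distrib]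
    refine Finset.sum_congr rfl fun j _ => ?_
    have := congrFun (congrFun (Cfm_add N hs he) i) j
    simp only [Matrix.add_apply, Matrix.transpose_apply] at this
    rw [← this]; push_cast; ring
  unfold FR
  rw [h1]; ring

lemma Fint_eq {m : ℕ} (N : Matrix (Fin m) (Fin m) ℤ) (hs : N.IsSymm) (he : ∀ i, Even (N i i)) (x : Fin m → ℤ) :
    Fint N x = x ⬝ᵥ (Cfm N) *ᵥ x := by
  have h0 := FR_eq N hs he (fun i => (x i : ℝ))
  have h1 : ∑ i, ∑ j, N i j * x i * x j = 2 * (x ⬝ᵥ (Cfm N) *ᵥ x) := by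
    have : ((∑ i, ∑ j, N i j * x i * x j : ℤ) : ℝ) = ((2 * (x ⬝ᵥ (Cfm N) *ᵥ x) : ℤ) : ℝ) := by
      unfold FR at h0
      rw [div_eq_iff (by norm_num)] at h0
      push_cast
      rw [h0]
      simp [dotProduct, Matrix.mulVec]
      ring
    exact_mod_cast this
  unfold Fint
  rw [h1]; omega

lemma QFR_le {m : ℕ} (G : Matrix (Fin m) (Fin m) ℝ) (u : Fin m → ℝ) (r : ℝ) (hr : ∀ i, |u i| ≤ r) :
    |QFR G u| ≤ (∑ i, ∑ j, |G i j|) * r ^ 2 := by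
  unfold QFR
  refine (Finset.abs_sum_le_sum_abs _ _).trans ?_
  rw [Finset.sum_mul]
  refine Finset.sum_le_sum fun i _ => ?_
  refine (Finset.abs_sum_le_sum_abs _ _).trans ?_
  rw [Finset.sum_mul]
  refine Finset.sum_le_sum fun j _ => ?_
  rw [abs_mul, abs_mul, mul_assoc, pow_two]
  have := hr i
  have := hr j
  have : 0 ≤ r := (abs_nonneg _).trans this
  gcongr

lemma emb_ne0 {n : ℕ} (i : Fin (n-1)) : (emb i : Fin (n+1)) ≠ 0 := by
  intro h; have := congrArg Fin.val h; simp [emb] at this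

lemma emb_ne1 {n : ℕ} (hn : 4 ≤ n) (i : Fin (n-1)) : (emb i : Fin (n+1)) ≠ 1 := by
  intro h; have := congrArg Fin.val h
  have h1 : ((1 : Fin (n+1)) : ℕ) = 1 := by
    rw [Fin.val_one']; exact Nat.mod_eq_of_lt (by omega)
  rw [h1] at this
  simp [emb] at this

lemma fin01 {n : ℕ} (hn : 4 ≤ n) : (1 : Fin (n+1)) ≠ 0 := by
  intro h; have := congrArg Fin.val h
  have h1 : ((1 : Fin (n+1)) : ℕ) = 1 := by
    rw [Fin.val_one']; exact Nat.mod_eq_of_lt (by omega)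
  rw [h1] at this
  simp at this

/-- size of the renormalised coordinates -/
lemma gt_size {n : ℕ} (hn : 4 ≤ n) (G : Matrix (Fin (n-1)) (Fin (n-1)) ℝ) (R₀ R B : ℝ) (hR₀ : 1 ≤ R₀) (hR : R₀ ≤ R) (hB : 1 ≤ B)
    (t : Fin (n+1) → ℝ) (a b : Fin (n+1) → ℝ) (hab : ∀ j : Fin (n+1), 2 ≤ j.val → max |a j| |b j| ≤ R₀)
    (ht0 : t 0 ≠ 0) (hJ : t 0 * t 1 + QFR G (fun i => t (emb i)) = 0)
    (hz : ∀ j : Fin (n+1), 2 ≤ j.val → a j ≤ R * (t j / t 0) ∧ R * (t j / t 0) ≤ b j) (hb : |t 0| ≤ B) :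
    ‖gR 0 1 R *ᵥ t‖ ≤ (1 + R₀ + (∑ i, ∑ j, |G i j|) * R₀ ^ 2) * (B / R) := by
  have hR0 : 0 < R := by linarith
  set KG := ∑ i, ∑ j, |G i j| with hKG
  have hKG0 : 0 ≤ KG := by positivity
  have ht0' : 0 < |t 0| := abs_pos.mpr ht0
  have hj : ∀ j : Fin (n+1), 2 ≤ j.val → |t j| ≤ R₀ * |t 0| / R := by
    intro j hj2
    obtain ⟨h1, h2⟩ := hz j hj2
    have h3 : |R * (t j / t 0)| ≤ R₀ := (abs_le_max_abs_abs h1 h2).trans (hab j hj2)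
    rw [abs_mul, abs_div, abs_of_pos hR0] at h3
    rw [le_div_iff₀ hR0]
    rw [mul_div_assoc', div_le_iff₀ ht0'] at h3
    linarith
  have h1 : |t 1| ≤ KG * R₀ ^ 2 * |t 0| / R ^ 2 := by
    have h2 : |t 0| * |t 1| = |QFR G (fun i => t (emb i))| := by
      rw [← abs_mul, ← abs_neg]; congr 1; linarith
    have h3 := QFR_le G (fun i => t (emb i)) (R₀ * |t 0| / R) (fun i => hj _ (by simp [emb]))
    rw [← h2, ← hKG] at h3
    refine le_of_mul_le_mul_left (h3.trans (le_of_eq ?_)) ht0'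
    field_simp
  rw [pi_norm_le_iff_of_nonneg (by positivity)]
  intro i
  rw [gR, Matrix.mulVec_diagonal, Real.norm_eq_abs, abs_mul]
  have hBR : 0 ≤ B / R := by positivity
  have hs : (1 + R₀ + KG * R₀ ^ 2) * (B / R) = B / R + R₀ * (B / R) + KG * R₀ ^ 2 * (B / R) := by ring
  have p1 : 0 ≤ R₀ * (B / R) := by positivity
  have p2 : 0 ≤ KG * R₀ ^ 2 * (B / R) := by positivity
  rw [hs]
  split_ifs with hi0 hi1
  · subst hi0
    rw [abs_of_pos (by positivity)]
    have : R⁻¹ * |t 0| ≤ R⁻¹ * B := by gcongr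
    have e : R⁻¹ * B = B / R := by ring
    linarith
  · subst hi1
    rw [abs_of_pos hR0]
    have : R * |t 1| ≤ R * (KG * R₀ ^ 2 * B / R ^ 2) := by
      gcongr
      refine h1.trans ?_
      gcongr
    have e : R * (KG * R₀ ^ 2 * B / R ^ 2) = KG * R₀ ^ 2 * (B / R) := by field_simp
    linarith
  · have hv : 2 ≤ i.val := by
      have h0 : i.val ≠ 0 := fun h => hi0 (Fin.ext (by simpa using h))
      have h1' : i.val ≠ 1 := fun h => hi1 (Fin.ext (by rw [h, Fin.val_one', Nat.mod_eq_of_lt (by omega)]))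
      omega
    rw [abs_one, one_mul]
    refine (hj i hv).trans ?_
    have : R₀ * |t 0| / R ≤ R₀ * B / R := by gcongr
    have e : R₀ * B / R = R₀ * (B / R) := by ring
    linarith

lemma etau_ge {n : ℕ} (hn : 4 ≤ n) (τ B : ℝ) (hB : 1 ≤ B) : B ^ (-τ) ≤ Etau1 n τ B + 1 := by
  unfold Etau1
  split_ifs with h
  · have hn5 : (5:ℝ) ≤ n := by exact_mod_cast h
    rcases le_total 0 τ with h0 | h0
    · have h1 : B ^ (-τ) ≤ 1 := Real.rpow_le_one_of_one_le_of_nonpos hB (by linarith)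
      have h2 : 0 ≤ B ^ (-(((n : ℝ) - 3) * τ / 2)) := by positivity
      linarith
    · have : B ^ (-τ) ≤ B ^ (-(((n : ℝ) - 3) * τ / 2)) := Real.rpow_le_rpow_of_exponent_le hB (by nlinarith)
      linarith
  · have h2 : 0 ≤ B ^ (-((1 + τ)/4)) := by positivity
    linarith

lemma etau_nonneg {n : ℕ} (τ B : ℝ) (hB : 1 ≤ B) : 0 ≤ Etau1 n τ B := by
  unfold Etau1
  split_ifs <;> positivity

lemma final_ineq {n : ℕ} (hn : 4 ≤ n) (τ C₀ ε : ℝ) (hτ0 : -1 < τ) (hC₀ : 0 < C₀) (hε : 0 < ε) (B R : ℝ) (L : ℕ) (hB : 1 ≤ B) (hL : 1 ≤ L) (hR : 1 ≤ R)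
    (h : ((L:ℝ) * R) ^ 2 ≤ C₀ * B ^ (1 - τ)) (κ : ℝ) (hκ : κ = Real.sqrt C₀ + 1) (Z : ℝ) (hZ : Z = κ * B / (L * R)) :
    1 ≤ Z ∧ (L:ℝ)⁻¹ * (Z ^ (n+1) * (Z ^ 2)⁻¹) * ((L:ℝ) ^ (ε/2) * Z ^ (ε/2) * (1 + L * R / Z)) ≤ 
      (κ ^ (n-1) * κ ^ ε * (1 + C₀)) * (B ^ ((n : ℝ) - 1 + ε) * (Etau1 n τ B + 1) / ((L : ℝ)^n * R^(n-1))) := by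
  have hL0 : (1:ℝ) ≤ L := by exact_mod_cast hL
  have hκ1 : 1 ≤ κ := by rw [hκ]; linarith [Real.sqrt_nonneg C₀]
  have hκ0 : 0 < κ := by linarith
  have hB0 : 0 < B := by linarith
  have hLR : 1 ≤ L * R := by nlinarith
  have hLR0 : 0 < L * R := by linarith
  have h1 : L * R ≤ κ * B := by
    have h2 : B ^ (1 - τ) ≤ B ^ (2:ℝ) := Real.rpow_le_rpow_of_exponent_le hB (by linarith)
    have h3 : B ^ (2:ℝ) = B ^ 2 := by norm_cast
    have h4 : (L * R) ^ 2 ≤ (Real.sqrt C₀ * B) ^ 2 := by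
      rw [mul_pow (Real.sqrt C₀), Real.sq_sqrt hC₀.le, ← h3]
      exact h.trans (by gcongr)
    have h5 := (abs_le_of_sq_le_sq' h4 (by positivity)).2
    rw [hκ]; nlinarith
  have hZ1 : 1 ≤ Z := by rw [hZ, one_le_div hLR0]; exact h1
  refine ⟨hZ1, ?_⟩
  have hZ0 : 0 < Z := by linarith
  have hZB : Z ≤ κ * B := by rw [hZ]; exact div_le_self (by positivity) hLR
  have hLB : (L:ℝ) ≤ κ * B := le_trans (by nlinarith) h1
  have e1 : (L:ℝ) ^ (ε/2) * Z ^ (ε/2) ≤ κ ^ ε * B ^ ε := by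
    calc (L:ℝ) ^ (ε/2) * Z ^ (ε/2) ≤ (κ * B) ^ (ε/2) * (κ * B) ^ (ε/2) := by gcongr
      _ = (κ * B) ^ ε := by rw [← Real.rpow_add (by positivity)]; congr 1; ring
      _ = _ := Real.mul_rpow hκ0.le hB0.le
  have e2 : L * R / Z ≤ C₀ * B ^ (-τ) := by
    have : L * R / Z = (L * R) ^ 2 / (κ * B) := by rw [hZ]; field_simp
    rw [this, div_le_iff₀ (by positivity)]
    have h3 : B ^ (1 - τ) = B ^ (-τ) * B := by
      rw [show 1 - τ = -τ + 1 by ring, Real.rpow_add hB0, Real.rpow_one]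
    have h4 : 0 ≤ C₀ * B ^ (-τ) * B := by positivity
    calc _ ≤ C₀ * B ^ (1 - τ) := h
      _ = C₀ * B ^ (-τ) * B := by rw [h3]; ring
      _ ≤ κ * (C₀ * B ^ (-τ) * B) := le_mul_of_one_le_left h4 hκ1
      _ = _ := by ring
  have hE := etau_ge hn τ B hB
  have hE0 := etau_nonneg (n := n) τ B hB
  have e3 : 1 + L * R / Z ≤ (1 + C₀) * (Etau1 n τ B + 1) := by
    have : C₀ * B ^ (-τ) ≤ C₀ * (Etau1 n τ B + 1) := by gcongr
    nlinarith
  have e4 : (L:ℝ)⁻¹ * (Z ^ (n+1) * (Z ^ 2)⁻¹) = κ ^ (n-1) * B ^ (n-1) / ((L : ℝ)^n * R^(n-1)) := by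
    obtain ⟨m, rfl⟩ : ∃ m, n = m + 1 := ⟨n - 1, by omega⟩
    have : Z ^ (m+1+1) * (Z ^ 2)⁻¹ = Z ^ m := by field_simp; ring
    rw [this, hZ, Nat.add_sub_cancel, div_pow, mul_pow, mul_pow, pow_succ]
    field_simp
  have e5 : B ^ ((n : ℝ) - 1 + ε) = B ^ (n-1) * B ^ ε := by
    rw [Real.rpow_add hB0]
    congr 1
    rw [← Real.rpow_natCast]; congr 1
    rw [Nat.cast_sub (by omega)]; simp
  rw [e4, e5]
  calc _ ≤ κ ^ (n-1) * B ^ (n-1) / ((L : ℝ)^n * R^(n-1)) * (κ ^ ε * B ^ ε * ((1 + C₀) * (Etau1 n τ B + 1))) := by gcongr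
    _ = _ := by ring
end QH

namespace Quad

/-- Proposition 7.1 (upper bound in the full range `−1 < τ < 1`). -/
theorem NW_upper_bound_full_range (n : ℕ) (hn : 4 ≤ n)
    (N : Matrix (Fin (n+1)) (Fin (n+1)) ℤ) (hNsym : N.IsSymm)
    (hNeven : ∀ i, Even (N i i)) (hNdet : N.det ≠ 0)
    (ξ : Fin (n+1) → ℝ) (hξ : ξ ≠ 0) (hFξ : FR N ξ = 0)
    (M : Matrix (Fin (n+1)) (Fin (n+1)) ℝ) (hM : IsUnit M)
    (hMξ : M.mulVec ξ = fun i => if i = 0 then 1 else 0)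
    (G : Matrix (Fin (n-1)) (Fin (n-1)) ℝ) (hGsym : G.IsSymm) (hGdet : G.det ≠ 0)
    (hWitt : ∀ t : Fin (n+1) → ℝ,
      FR N (M⁻¹.mulVec t) = t 0 * t 1 + QFR G (fun i => t (emb i)))
    (a b : Fin (n+1) → ℝ) (hab : ∀ j : Fin (n+1), 2 ≤ j.val → a j < b j)
    (R₀ : ℝ) (hR₀ : 1 ≤ R₀)
    (hR₀F : ∀ u : Fin (n-1) → ℝ,
      (∀ i, a (emb i) / R₀ ≤ u i ∧ u i ≤ b (emb i) / R₀) → |QFR G u| ≤ 1)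
    (hR₀ab : ∀ j : Fin (n+1), 2 ≤ j.val → max |a j| |b j| ≤ R₀)
    (τ : ℝ) (hτ0 : -1 < τ) (hτ1 : τ < 1) (C₀ : ℝ) (hC₀ : 0 < C₀) (ε : ℝ) (hε : 0 < ε) :
    ∃ C : ℝ, 0 < C ∧
      ∀ B : ℝ, 1 ≤ B → ∀ L : ℕ, 1 ≤ L → ∀ R : ℝ, R₀ ≤ R →
        ((L : ℝ) * R)^2 ≤ C₀ * B ^ (1 - τ) →
        ∀ Γ : Fin (n+1) → ℤ, (L : ℤ) ∣ Fint N Γ →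
          Int.gcd (Finset.univ.gcd Γ) (L : ℤ) = 1 →
          (NW n N M a b B R L Γ : ℝ)
            ≤ C * (B ^ ((n : ℝ) - 1 + ε) * (Etau1 n τ B + 1) / ((L : ℝ)^n * R^(n-1))
                + B ^ (((n : ℝ) + 1) * (1 - τ) / 2 + ε) / ((L : ℝ)^(n+1) * R^n)) := by


  classical
  have hMdet : M.det ≠ 0 := ((Matrix.isUnit_iff_isUnit_det M).mp hM).ne_zero
  have hMinv : M⁻¹ * M = 1 := Matrix.nonsing_inv_mul _ (isUnit_iff_ne_zero.mpr hMdet)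
  have hCN := QH.Cfm_add N hNsym hNeven
  obtain ⟨A1, s, hA1, hs, hdiag⟩ := QH.real_diag ((QH.Cfm N).map (Int.cast : ℤ → ℝ)) (by
    have : (QH.Cfm N).map (Int.cast : ℤ → ℝ) + ((QH.Cfm N).map (Int.cast : ℤ → ℝ))ᵀ = N.map (Int.cast : ℤ → ℝ) := by
      ext i j
      have := congrFun (congrFun hCN i) j
      simp only [Matrix.add_apply, Matrix.transpose_apply, Matrix.map_apply] at this ⊢
      rw [← this]; push_cast; rfl
    rw [this]
    have h2 : (N.map (Int.cast : ℤ → ℝ)).det = ((N.det : ℤ) : ℝ) := by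
      have := (Int.castRingHom ℝ).map_det N
      exact this.symm
    rw [h2]
    exact_mod_cast hNdet)
  have hcast : ∀ x : Fin (n+1) → ℤ, ((x ⬝ᵥ (QH.Cfm N) *ᵥ x : ℤ) : ℝ) = FR N (fun i => (x i : ℝ)) := by
    intro x
    rw [QH.FR_eq N hNsym hNeven]
    simp [dotProduct, Matrix.mulVec]
  have hFJ : ∀ x : Fin (n+1) → ℤ, FR N (fun i => (x i : ℝ)) = tmap n M x 0 * tmap n M x 1 + QFR G (fun i => tmap n M x (emb i)) := by
    intro x
    rw [← hWitt, tmap, Matrix.mulVec_mulVec, hMinv, Matrix.one_mulVec]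
  have hA : (A1 * M⁻¹).det ≠ 0 := by
    rw [Matrix.det_mul]
    refine mul_ne_zero hA1 fun h => ?_
    have := congrArg Matrix.det hMinv
    rw [Matrix.det_mul, h, Matrix.det_one, zero_mul] at this
    exact zero_ne_one this
  have hF : ∀ R : ℝ, 1 ≤ R → ∀ x : Fin (n+1) → ℤ, ((x ⬝ᵥ (QH.Cfm N) *ᵥ x : ℤ) : ℝ) = 
      ∑ i, s i * ((A1 * M⁻¹) *ᵥ (QH.gR 0 1 R *ᵥ (M *ᵥ (fun i => (x i : ℝ))))) i ^ 2 := by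
    intro R hR x
    have hR0 : R ≠ 0 := by positivity
    rw [← Matrix.mulVec_mulVec, ← hdiag, ← QH.FR_eq N hNsym hNeven, hWitt, hcast, hFJ]
    have h1 : ∀ t : Fin (n+1) → ℝ, ∀ i, (QH.gR 0 1 R *ᵥ t) i = (if i = 0 then R⁻¹ else if i = 1 then R else 1) * t i := by
      intro t i; rw [QH.gR, Matrix.mulVec_diagonal]
    simp only [h1, if_true, if_neg (QH.fin01 hn), if_neg (QH.emb_ne0 _), if_neg (QH.emb_ne1 hn _), one_mul, tmap]
    field_simp
  set K1 : ℝ := 1 + R₀ + (∑ i, ∑ j, |G i j|) * R₀ ^ 2 with hK1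
  have hK10 : 0 ≤ K1 := by positivity
  obtain ⟨K, hK, hcount⟩ := QH.sol_count (0 : Fin (n+1)) 1 (QH.fin01 hn) (by simp; omega) (QH.Cfm N) N hCN hNdet (A1 * M⁻¹) M s hA hMdet hs hF K1 hK10 (ε/2) (by positivity)
  set κ : ℝ := Real.sqrt C₀ + 1 with hκ
  have hκ0 : 0 < κ := by positivity
  have hκ1 : 1 ≤ κ := by rw [hκ]; linarith [Real.sqrt_nonneg C₀]
  refine ⟨K * (κ ^ (n-1) * κ ^ ε * (1 + C₀)), by positivity, ?_⟩
  intro B hB L hL R hR hLR Γ hΓ hgcd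
  have hR1 : 1 ≤ R := hR₀.trans hR
  have hL0 : (0:ℝ) < L := by exact_mod_cast hL
  obtain ⟨hZ1, hfin⟩ := QH.final_ineq hn τ C₀ ε hτ0 hC₀ hε B R L hB hL hR1 hLR κ hκ _ rfl
  set Z := κ * B / (L * R) with hZ
  have hc := hcount R hR1 L hL Z hZ1 {x : Fin (n+1) → ℤ | x ≠ 0 ∧ Fint N x = 0 ∧ (∀ i, (L : ℤ) ∣ x i - Γ i) ∧
    tmap n M x 0 ≠ 0 ∧
    (∀ j : Fin (n+1), 2 ≤ j.val →
      a j ≤ R * (tmap n M x j / tmap n M x 0) ∧ R * (tmap n M x j / tmap n M x 0) ≤ b j) ∧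
    (∀ i, |tmap n M x i| ≤ B)} (by
      rintro x ⟨hx1, hx2, hx3, hx4, hx5, hx6⟩
      have hx2' := hx2
      rw [QH.Fint_eq N hNsym hNeven] at hx2'
      refine ⟨hx2', ?_, ?_⟩
      · have hJ : tmap n M x 0 * tmap n M x 1 + QFR G (fun i => tmap n M x (emb i)) = 0 := by
          rw [← hFJ, ← hcast, hx2', Int.cast_zero]
        have := QH.gt_size hn G R₀ R B hR₀ hR hB (tmap n M x) a b hR₀ab hx4 hJ hx5 (hx6 0)
        rw [← hK1] at this
        refine this.trans ?_
        gcongr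
        have e : (L:ℝ) * Z = κ * (B / R) := by rw [hZ]; field_simp
        rw [e]
        exact le_mul_of_one_le_left (by positivity) hκ1
      · intro p hpL hpx
        have h1 : ∀ i, p ∣ Γ i := fun i => by
          have := dvd_sub (hpx i) (hpL.trans (hx3 i))
          simpa using this
        have h2 : p ∣ Finset.univ.gcd Γ := Finset.dvd_gcd fun i _ => h1 i
        have h3 := Int.dvd_coe_gcd h2 hpL
        rw [hgcd] at h3
        exact isUnit_of_dvd_one (by simpa using h3))
    (by
      rintro x ⟨-, -, hx, -⟩ y ⟨-, -, hy, -⟩ i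
      have := dvd_sub (hx i) (hy i)
      simpa using this)
  have hcard : (NW n N M a b B R L Γ : ℝ) ≤ K * ((L:ℝ)⁻¹ * (Z ^ (n+1) * (Z ^ 2)⁻¹) * ((L:ℝ) ^ (ε/2) * Z ^ (ε/2) * (1 + L * R / Z))) := by
    rw [Fintype.card_fin] at hc
    exact hc
  refine hcard.trans ((mul_le_mul_of_nonneg_left hfin hK.le).trans ?_)
  rw [← mul_assoc]
  refine mul_le_mul_of_nonneg_left ?_ (by positivity)
  have : 0 ≤ B ^ (((n : ℝ) + 1) * (1 - τ) / 2 + ε) / ((L : ℝ)^(n+1) * R^n) := by positivity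
  linarith

end Quad
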